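/- arXiv:2409.01226 — 3 statements merged into one kernel-verified Lean document; each statement's English description precedes it below -/
import Mathlib

section
/- Let (t_n)_{n≥1} be a sequence of positive integers such that t_n ≤ n for each n and lim_{n→∞} (t_n − log_p n) = ∞. Then there exists a sequence (G_n)_{n≥1} of bipartite graphs such that G_n has a bipartition {A_n, B_n} with A_n, B_n disjoint sets of size n, such that 1 ≤ |N_{G_n}(a)| ≤ min{t_n, log_p n + log log n} for all a ∈ A_n, 1 ≤ |N_{G_n}(b)| ≤ min{t_n, log_p n + log log n} for all b ∈ B_n, and lim_{n→∞} c(G_n) = 0. -/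
open Filter

/-- A bipartite graph on vertex sets `A_n = B_n = Fin n` is given by its edge set
`E ⊆ A_n × B_n`.  `NB E S` is the neighborhood in `B_n` of a set `S ⊆ A_n`. -/
def NB {n : ℕ} (E : Finset (Fin n × Fin n)) (S : Finset (Fin n)) : Finset (Fin n) :=
  Finset.univ.filter fun b => ∃ a ∈ S, (a, b) ∈ E

/-- `NA E T` is the neighborhood in `A_n` of a set `T ⊆ B_n`. -/
def NA {n : ℕ} (E : Finset (Fin n × Fin n)) (T : Finset (Fin n)) : Finset (Fin n) :=
  Finset.univ.filter fun a => ∃ b ∈ T, (a, b) ∈ E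

/-- `c(G) = Σ_{S ∈ F_A(G)} p^{|S| - |N(S)|}`, where `F_A(G)` is the collection of nonempty
proper subsets `S ⊊ A` with `N(S) ≠ B` and `N(w) ⊄ N(S)` for all `w ∈ A \ S`. -/
noncomputable def cGraph (p : ℕ) {n : ℕ} (E : Finset (Fin n × Fin n)) : ℝ :=
  ∑ S ∈ Finset.univ.filter (fun S : Finset (Fin n) =>
      S.Nonempty ∧ S ≠ Finset.univ ∧ NB E S ≠ Finset.univ ∧
        ∀ w ∉ S, ¬ NB E {w} ⊆ NB E S),
    (p : ℝ) ^ ((S.card : ℤ) - ((NB E S).card : ℤ))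


open Finset in
lemma perm_swap_le {n : ℕ} (S W : Finset (Fin n)) (x : Fin n) (hx : x ∉ W) (y z : Fin n)
    (hz : z ∉ S) :
    (univ.filter fun π : Equiv.Perm (Fin n) => (∀ w ∈ W, π w ∈ S) ∧ π x = y).card ≤
    (univ.filter fun π : Equiv.Perm (Fin n) => (∀ w ∈ W, π w ∈ S) ∧ π x = z).card := by
  apply Finset.card_le_card_of_injOn (fun π => Equiv.swap y z * π)
  · intro π hπ
    simp only [coe_filter, mem_univ, true_and, Set.mem_ofPred_eq] at hπ ⊢
    obtain ⟨h1, h2⟩ := hπ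
    refine ⟨fun w hw => ?_, ?_⟩
    · have hne : π w ≠ y := by
        rw [← h2]; intro h; exact hx (π.injective h ▸ hw)
      have hne2 : π w ≠ z := fun h => hz (h ▸ h1 w hw)
      rw [Equiv.Perm.mul_apply, Equiv.swap_apply_of_ne_of_ne hne hne2]
      exact h1 w hw
    · rw [Equiv.Perm.mul_apply, h2, Equiv.swap_apply_left]
  · intro a _ b _ h
    exact mul_left_cancel h

open Finset in
lemma perm_count {n : ℕ} (S W : Finset (Fin n)) :
    (univ.filter fun π : Equiv.Perm (Fin n) => ∀ w ∈ W, π w ∈ S).card * n ^ W.card ≤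
      S.card ^ W.card * n.factorial := by
  induction W using Finset.induction_on with
  | empty => simp [Fintype.card_perm]
  | insert x W hx ih =>
    set f : Fin n → ℕ := fun y =>
      (univ.filter fun π : Equiv.Perm (Fin n) => (∀ w ∈ W, π w ∈ S) ∧ π x = y).card with hf
    have h1 : (univ.filter fun π : Equiv.Perm (Fin n) => ∀ w ∈ W, π w ∈ S).card
        = ∑ y, f y := by
      rw [Finset.card_eq_sum_card_fiberwise (f := fun π => π x) (t := univ) (by simp)]
      simp only [hf, Finset.filter_filter]
    have h2 : (univ.filter fun π : Equiv.Perm (Fin n) => ∀ w ∈ insert x W, π w ∈ S).card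
        = ∑ y ∈ S, f y := by
      rw [Finset.card_eq_sum_card_fiberwise (f := fun π => π x) (t := S)]
      · apply Finset.sum_congr rfl
        intro y hy
        simp only [hf, Finset.filter_filter]
        congr 1
        ext π
        simp only [mem_filter, mem_univ, true_and, mem_insert, forall_eq_or_imp]
        constructor
        · rintro ⟨⟨_, h⟩, h'⟩; exact ⟨h, h'⟩
        · rintro ⟨h, h'⟩; exact ⟨⟨h' ▸ hy, h⟩, h'⟩
      · intro π hπ
        simp at hπ
        exact hπ.1
    have h3 : (∑ y ∈ S, f y) * Sᶜ.card ≤ S.card * ∑ z ∈ Sᶜ, f z := by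
      calc (∑ y ∈ S, f y) * Sᶜ.card = ∑ y ∈ S, ∑ z ∈ Sᶜ, f y := by
            rw [Finset.sum_mul]; simp [mul_comm]
        _ ≤ ∑ y ∈ S, ∑ z ∈ Sᶜ, f z := by
            apply Finset.sum_le_sum; intro y hy
            apply Finset.sum_le_sum; intro z hz
            exact perm_swap_le S W x hx y z (by simpa using hz)
        _ = _ := by simp
    have h4 : S.card + Sᶜ.card = n := by simp
    have h5 : (∑ y ∈ S, f y) * n ≤ S.card * ∑ y, f y := by
      rw [← Finset.sum_add_sum_compl S f]
      calc (∑ y ∈ S, f y) * n = (∑ y ∈ S, f y) * (S.card + Sᶜ.card) :=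
            congrArg (fun m => (∑ y ∈ S, f y) * m) h4.symm
        _ ≤ _ := by nlinarith
    rw [h2, Finset.card_insert_of_notMem hx, pow_succ, pow_succ]
    rw [h1] at ih
    calc (∑ y ∈ S, f y) * (n ^ W.card * n) = ((∑ y ∈ S, f y) * n) * n ^ W.card := by ring
      _ ≤ (S.card * ∑ y, f y) * n ^ W.card := Nat.mul_le_mul_right _ h5
      _ = S.card * ((∑ y, f y) * n ^ W.card) := by ring
      _ ≤ S.card * (S.card ^ W.card * n.factorial) := Nat.mul_le_mul_left _ ih
      _ = _ := by ring

open Finset in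
lemma perm_count_real {n : ℕ} (hn : 1 ≤ n) (S W : Finset (Fin n)) :
    ((univ.filter fun π : Equiv.Perm (Fin n) => ∀ w ∈ W, π w ∈ S).card : ℝ) ≤
      n.factorial * ((S.card : ℝ) / n) ^ W.card := by
  have h := perm_count S W
  have hn' : (0 : ℝ) < (n : ℝ) ^ W.card := by positivity
  rw [div_pow, ← mul_div_assoc, le_div_iff₀ hn']
  rw [mul_comm (n.factorial : ℝ)]
  exact_mod_cast h

open Finset in
lemma perm_exp {n : ℕ} (hn : 1 ≤ n) (p : ℝ) (hp : 1 ≤ p) (S U : Finset (Fin n)) :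
    ∑ π : Equiv.Perm (Fin n), p ^ (S.filter fun a => π a ∈ U).card ≤
      n.factorial * Real.exp ((p - 1) * (S.card * U.card / n)) := by
  have h1 : ∀ π : Equiv.Perm (Fin n), p ^ (S.filter fun a => π a ∈ U).card =
      ∑ W ∈ S.powerset, if ∀ w ∈ W, π w ∈ U then (p - 1) ^ W.card else 0 := by
    intro π
    have := Finset.sum_pow_mul_eq_add_pow (p - 1) 1 (S.filter fun a => π a ∈ U)
    simp only [one_pow, mul_one, sub_add_cancel] at this
    rw [← this, ← Finset.sum_filter]
    apply Finset.sum_congr _ (fun _ _ => rfl)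
    ext W
    simp only [mem_powerset, mem_filter, Finset.subset_iff]
    constructor
    · intro h; exact ⟨fun x hx => (h hx).1, fun x hx => (h hx).2⟩
    · intro h x hx; exact ⟨h.1 hx, h.2 x hx⟩
  simp_rw [h1]
  rw [Finset.sum_comm]
  calc ∑ W ∈ S.powerset, ∑ π : Equiv.Perm (Fin n),
        (if ∀ w ∈ W, π w ∈ U then (p - 1) ^ W.card else 0)
      ≤ ∑ W ∈ S.powerset, n.factorial * (((p - 1) * ((U.card : ℝ) / n)) ^ W.card
          * 1 ^ (S.card - W.card)) := by
        apply Finset.sum_le_sum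
        intro W _
        rw [← Finset.sum_filter, Finset.sum_const, nsmul_eq_mul, mul_pow, one_pow, mul_one]
        have := perm_count_real hn U W
        have h0 : 0 ≤ (p - 1) ^ W.card := pow_nonneg (by linarith) _
        nlinarith [mul_le_mul_of_nonneg_right this h0]
    _ = n.factorial * ((p - 1) * ((U.card : ℝ) / n) + 1) ^ S.card := by
        rw [← Finset.mul_sum, Finset.sum_pow_mul_eq_add_pow]
    _ ≤ n.factorial * (Real.exp ((p - 1) * ((U.card : ℝ) / n))) ^ S.card := by
        have : 0 ≤ (p - 1) * ((U.card : ℝ) / n) := mul_nonneg (by linarith) (by positivity)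
        gcongr
        exact Real.add_one_le_exp _
    _ = _ := by
        rw [← Real.exp_nat_mul]
        congr 2
        ring

/-- The union of `d` permutations. -/
def EE {n d : ℕ} (ω : Fin d → Equiv.Perm (Fin n)) : Finset (Fin n × Fin n) :=
  Finset.univ.filter fun ab => ∃ i, ω i ab.1 = ab.2

lemma mem_NB_EE {n d : ℕ} (ω : Fin d → Equiv.Perm (Fin n)) (S : Finset (Fin n)) (b : Fin n) :
    b ∈ NB (EE ω) S ↔ ∃ a ∈ S, ∃ i, ω i a = b := by
  simp [NB, EE]

lemma mem_NA_EE {n d : ℕ} (ω : Fin d → Equiv.Perm (Fin n)) (S : Finset (Fin n)) (a : Fin n) :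
    a ∈ NA (EE ω) S ↔ ∃ b ∈ S, ∃ i, ω i a = b := by
  simp [NA, EE]

lemma NA_EE_inv {n d : ℕ} (ω : Fin d → Equiv.Perm (Fin n)) (S : Finset (Fin n)) :
    NA (EE ω) S = NB (EE ω⁻¹) S := by
  ext a
  rw [mem_NA_EE, mem_NB_EE]
  simp only [Pi.inv_apply, Equiv.Perm.inv_eq_iff_eq]
  constructor
  · rintro ⟨b, hb, i, h⟩; exact ⟨b, hb, i, h.symm⟩
  · rintro ⟨b, hb, i, h⟩; exact ⟨b, hb, i, h.symm⟩

lemma NB_EE_card_le {n d : ℕ} (ω : Fin d → Equiv.Perm (Fin n)) (S : Finset (Fin n)) :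
    (NB (EE ω) S).card ≤ d * S.card := by
  have : NB (EE ω) S ⊆ (Finset.univ ×ˢ S).image (fun x : Fin d × Fin n => ω x.1 x.2) := by
    intro b hb
    rw [mem_NB_EE] at hb
    obtain ⟨a, ha, i, h⟩ := hb
    simp only [Finset.mem_image, Finset.mem_product, Finset.mem_univ, true_and]
    exact ⟨(i, a), ha, h⟩
  refine (Finset.card_le_card this).trans (Finset.card_image_le.trans ?_)
  simp [Finset.card_product]

lemma NB_cons {n d : ℕ} (π : Equiv.Perm (Fin n)) (ω : Fin d → Equiv.Perm (Fin n))
    (S : Finset (Fin n)) :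
    NB (EE (Fin.cons π ω : Fin (d + 1) → Equiv.Perm (Fin n))) S =
      S.image π ∪ NB (EE ω) S := by
  ext b
  simp only [mem_NB_EE, Finset.mem_union, Finset.mem_image, Fin.exists_fin_succ, Fin.cons_zero,
    Fin.cons_succ]
  constructor
  · rintro ⟨a, ha, h | h⟩
    · exact Or.inl ⟨a, ha, h⟩
    · exact Or.inr ⟨a, ha, h⟩
  · rintro (⟨a, ha, h⟩ | ⟨a, ha, h⟩)
    · exact ⟨a, ha, Or.inl h⟩
    · exact ⟨a, ha, Or.inr h⟩

lemma NB_cons_card {n d : ℕ} (π : Equiv.Perm (Fin n)) (ω : Fin d → Equiv.Perm (Fin n))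
    (S : Finset (Fin n)) :
    (NB (EE (Fin.cons π ω : Fin (d + 1) → Equiv.Perm (Fin n))) S).card +
      (S.filter fun a => π a ∈ NB (EE ω) S).card = S.card + (NB (EE ω) S).card := by
  rw [NB_cons]
  have h := Finset.card_union_add_card_inter (S.image π) (NB (EE ω) S)
  rw [Finset.card_image_of_injective _ π.injective] at h
  rw [← h]
  congr 1
  rw [← Finset.card_image_of_injective _ π.injective]
  congr 1
  ext b
  simp only [Finset.mem_image, Finset.mem_filter, Finset.mem_inter]
  constructor
  · rintro ⟨a, ⟨ha, h⟩, rfl⟩; exact ⟨⟨a, ha, rfl⟩, h⟩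
  · rintro ⟨⟨a, ha, rfl⟩, h⟩; exact ⟨a, ⟨ha, h⟩, rfl⟩

lemma exp_NB {n : ℕ} (hn : 1 ≤ n) (p : ℝ) (hp : 1 ≤ p) (S : Finset (Fin n)) (D d : ℕ)
    (hd : d ≤ D) :
    ∑ ω : Fin d → Equiv.Perm (Fin n), (p⁻¹) ^ (NB (EE ω) S).card ≤
      (n.factorial * ((p⁻¹) ^ S.card *
        Real.exp ((p - 1) * (D * (S.card : ℝ) ^ 2 / n)))) ^ d := by
  have hp0 : 0 < p := by linarith
  induction d with
  | zero =>
    simp only [Finset.univ_unique, Finset.sum_singleton, pow_zero]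
    exact pow_le_one₀ (by positivity) (inv_le_one_of_one_le₀ hp)
  | succ d ih =>
    specialize ih (by omega)
    rw [← (Fin.consEquiv (fun _ : Fin (d + 1) => Equiv.Perm (Fin n))).sum_comp,
      Fintype.sum_prod_type, Finset.sum_comm]
    rw [pow_succ]
    refine le_trans ?_ (mul_le_mul_of_nonneg_right ih (by positivity))
    rw [Finset.sum_mul]
    apply Finset.sum_le_sum
    intro ω _
    have key : ∀ π : Equiv.Perm (Fin n),
        (p⁻¹) ^ (NB (EE ((Fin.consEquiv (fun _ : Fin (d + 1) => Equiv.Perm (Fin n))) (π, ω))) S).card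
        = (p⁻¹) ^ (NB (EE ω) S).card * ((p⁻¹) ^ S.card *
          p ^ (S.filter fun a => π a ∈ NB (EE ω) S).card) := by
      intro π
      have h := NB_cons_card π ω S
      have h2 : (p⁻¹) ^ (S.filter fun a => π a ∈ NB (EE ω) S).card *
          p ^ (S.filter fun a => π a ∈ NB (EE ω) S).card = 1 := by
        rw [← mul_pow, inv_mul_cancel₀ hp0.ne', one_pow]
      have h3 : (p⁻¹) ^ (NB (EE ω) S).card * (p⁻¹) ^ S.card =
          (p⁻¹) ^ (NB (EE (Fin.cons π ω : Fin (d + 1) → Equiv.Perm (Fin n))) S).card *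
          (p⁻¹) ^ (S.filter fun a => π a ∈ NB (EE ω) S).card := by
        rw [← pow_add, ← pow_add, h, add_comm]
      rw [← mul_assoc, h3, mul_assoc, h2, mul_one]
      rfl
    simp_rw [key]
    rw [← Finset.mul_sum, ← Finset.mul_sum]
    refine mul_le_mul_of_nonneg_left ?_ (by positivity)
    rw [mul_left_comm]
    refine mul_le_mul_of_nonneg_left ?_ (by positivity)
    refine (perm_exp hn p hp S _).trans ?_
    have hc : ((NB (EE ω) S).card : ℝ) ≤ D * S.card := by
      have := NB_EE_card_le ω S
      have h2 : d * S.card ≤ D * S.card := Nat.mul_le_mul_right _ (by omega)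
      exact_mod_cast this.trans h2
    have hp1 : 0 ≤ p - 1 := by linarith
    have hh : (S.card : ℝ) * (NB (EE ω) S).card ≤ D * (S.card : ℝ) ^ 2 := by
      nlinarith [Nat.cast_nonneg (α := ℝ) S.card]
    gcongr n.factorial * Real.exp ((p - 1) * (?_ / n))

open Finset in
lemma empty_count {n : ℕ} (hn : 1 ≤ n) (S T : Finset (Fin n)) (d : ℕ) :
    ((univ.filter fun ω : Fin d → Equiv.Perm (Fin n) => Disjoint (NB (EE ω) S) T).card : ℝ) ≤
      (n.factorial : ℝ) ^ d * Real.exp (-(d * S.card * T.card / n)) := by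
  have h1 : (univ.filter fun ω : Fin d → Equiv.Perm (Fin n) => Disjoint (NB (EE ω) S) T) =
      Fintype.piFinset fun _ : Fin d =>
        univ.filter fun π : Equiv.Perm (Fin n) => ∀ w ∈ S, π w ∈ Tᶜ := by
    ext ω
    simp only [mem_filter, mem_univ, true_and, Fintype.mem_piFinset, Finset.disjoint_left,
      mem_NB_EE, mem_compl]
    constructor
    · intro h i w hw; exact h ⟨w, hw, i, rfl⟩
    · rintro h b ⟨a, ha, i, rfl⟩; exact h i a ha
  rw [h1, Fintype.card_piFinset]
  simp only [prod_const, card_univ, Fintype.card_fin]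
  push_cast
  have h2 := perm_count_real hn Tᶜ S
  have hn0 : (0 : ℝ) < n := by exact_mod_cast hn
  have h3 : ((Tᶜ.card : ℝ) / n) ≤ Real.exp (-(T.card / n)) := by
    have h4 : (T.card : ℝ) + Tᶜ.card = n := by exact_mod_cast (by simp : T.card + Tᶜ.card = n)
    have h5 : ((Tᶜ.card : ℝ) / n) = -(T.card / n) + 1 := by
      field_simp; linarith
    rw [h5]; exact Real.add_one_le_exp _
  calc _ ≤ ((n.factorial : ℝ) * (Real.exp (-(T.card / n))) ^ S.card) ^ d := by
        gcongr
        refine h2.trans ?_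
        gcongr
    _ = _ := by
        rw [mul_pow, ← Real.exp_nat_mul, ← Real.exp_nat_mul]
        congr 2
        ring

lemma zpow_sub_nat (q : ℝ) (hq : 0 < q) (a b : ℕ) :
    q ^ ((a : ℤ) - (b : ℤ)) = q ^ a * (q⁻¹) ^ b := by
  rw [zpow_sub₀ hq.ne', zpow_natCast, zpow_natCast, inv_pow, div_eq_mul_inv]

/-- Truncated sum over small sets. -/
noncomputable def YY (q : ℝ) {n d : ℕ} (K : ℕ) (ω : Fin d → Equiv.Perm (Fin n)) : ℝ :=
  ∑ S ∈ Finset.univ.filter (fun S : Finset (Fin n) => 1 ≤ S.card ∧ S.card ≤ K),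
    q ^ S.card * (q⁻¹) ^ (NB (EE ω) S).card

lemma closed_eq {n : ℕ} (E : Finset (Fin n × Fin n)) (S : Finset (Fin n))
    (h : ∀ w ∉ S, ¬ NB E {w} ⊆ NB E S) : S = (NA E (NB E S)ᶜ)ᶜ := by
  ext a
  simp only [NA, Finset.mem_compl, Finset.mem_filter, Finset.mem_univ, true_and, not_exists,
    not_and]
  constructor
  · intro ha b hb hab
    exact hb (by simp only [NB, Finset.mem_filter, Finset.mem_univ, true_and]; exact ⟨a, ha, hab⟩)
  · intro hb
    by_contra ha
    apply h a ha
    intro b hab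
    by_contra hbS
    exact hb b hbS (by simpa [NB] using hab)

lemma cGraph_le (p : ℕ) (hp : 1 ≤ p) {n d : ℕ} (K : ℕ) (ω : Fin d → Equiv.Perm (Fin n))
    (hZ : ∀ S T : Finset (Fin n), K ≤ S.card → K ≤ T.card → ¬ Disjoint (NB (EE ω) S) T) :
    cGraph p (EE ω) ≤ YY p K ω + YY p K ω⁻¹ := by
  have hp0 : (0 : ℝ) < p := by exact_mod_cast hp
  unfold cGraph
  set F := Finset.univ.filter (fun S : Finset (Fin n) =>
      S.Nonempty ∧ S ≠ Finset.univ ∧ NB (EE ω) S ≠ Finset.univ ∧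
        ∀ w ∉ S, ¬ NB (EE ω) {w} ⊆ NB (EE ω) S) with hF
  have hpos : ∀ S : Finset (Fin n), 0 ≤ (p : ℝ) ^ ((S.card : ℤ) - ((NB (EE ω) S).card : ℤ)) :=
    fun S => by positivity
  have hsplit : F ⊆ F.filter (fun S => S.card ≤ K) ∪
      F.filter (fun S => ((NB (EE ω) S)ᶜ).card ≤ K) := by
    intro S hS
    simp only [Finset.mem_union, Finset.mem_filter, hS, true_and]
    by_contra hcon
    push Not at hcon
    exact hZ S (NB (EE ω) S)ᶜ hcon.1.le hcon.2.le disjoint_compl_right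
  refine (Finset.sum_le_sum_of_subset_of_nonneg hsplit (fun S _ _ => hpos S)).trans ?_
  have hun := Finset.sum_union_inter (s₁ := F.filter (fun S => S.card ≤ K))
    (s₂ := F.filter (fun S => ((NB (EE ω) S)ᶜ).card ≤ K))
    (f := fun S => (p : ℝ) ^ ((S.card : ℤ) - ((NB (EE ω) S).card : ℤ)))
  have hin : 0 ≤ ∑ S ∈ F.filter (fun S => S.card ≤ K) ∩
      F.filter (fun S => ((NB (EE ω) S)ᶜ).card ≤ K),
      (p : ℝ) ^ ((S.card : ℤ) - ((NB (EE ω) S).card : ℤ)) :=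
    Finset.sum_nonneg (fun S _ => hpos S)
  have h1 : ∑ S ∈ F.filter (fun S => S.card ≤ K),
      (p : ℝ) ^ ((S.card : ℤ) - ((NB (EE ω) S).card : ℤ)) ≤ YY p K ω := by
    unfold YY
    simp_rw [zpow_sub_nat (p : ℝ) hp0]
    apply Finset.sum_le_sum_of_subset_of_nonneg
    · intro S hS
      simp only [hF, Finset.mem_filter, Finset.mem_univ, true_and] at hS ⊢
      exact ⟨hS.1.1.card_pos, hS.2⟩
    · intros; positivity
  have h2 : ∑ S ∈ F.filter (fun S => ((NB (EE ω) S)ᶜ).card ≤ K),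
      (p : ℝ) ^ ((S.card : ℤ) - ((NB (EE ω) S).card : ℤ)) ≤ YY p K ω⁻¹ := by
    have hcl : ∀ S ∈ F, S = (NA (EE ω) (NB (EE ω) S)ᶜ)ᶜ := by
      intro S hS
      simp only [hF, Finset.mem_filter, Finset.mem_univ, true_and] at hS
      exact closed_eq _ _ hS.2.2.2
    have hval : ∀ S ∈ F, (p : ℝ) ^ ((S.card : ℤ) - ((NB (EE ω) S).card : ℤ)) =
        (fun T : Finset (Fin n) => (p : ℝ) ^ T.card * ((p : ℝ)⁻¹) ^ (NB (EE ω⁻¹) T).card)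
          (NB (EE ω) S)ᶜ := by
      intro S hS
      simp only
      rw [← zpow_sub_nat _ hp0, ← NA_EE_inv]
      congr 1
      have e1 := Finset.card_add_card_compl (NB (EE ω) S)
      have e2 := Finset.card_add_card_compl (NA (EE ω) (NB (EE ω) S)ᶜ)
      rw [← hcl S hS] at e2
      omega
    rw [Finset.sum_congr rfl (fun S hS => hval S (Finset.mem_filter.1 hS).1)]
    have hinj : Set.InjOn (fun S => (NB (EE ω) S)ᶜ)
        (F.filter (fun S => ((NB (EE ω) S)ᶜ).card ≤ K) : Set (Finset (Fin n))) := by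
      intro S hS S' hS' heq
      simp only at heq
      rw [hcl S (Finset.mem_filter.1 hS).1, hcl S' (Finset.mem_filter.1 hS').1, heq]
    rw [← Finset.sum_image (g := fun S => (NB (EE ω) S)ᶜ)
      (f := fun T : Finset (Fin n) => (p : ℝ) ^ T.card * ((p : ℝ)⁻¹) ^ (NB (EE ω⁻¹) T).card) hinj]
    unfold YY
    apply Finset.sum_le_sum_of_subset_of_nonneg
    · intro T hT
      simp only [Finset.mem_image] at hT
      obtain ⟨S, hS, rfl⟩ := hT
      simp only [hF, Finset.mem_filter, Finset.mem_univ, true_and] at hS ⊢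
      refine ⟨?_, hS.2⟩
      apply Finset.card_pos.2
      rw [Finset.nonempty_iff_ne_empty, Ne, Finset.compl_eq_empty_iff]
      exact hS.1.2.2.1
    · intros; positivity
  linarith

lemma NB_mono {n : ℕ} (E : Finset (Fin n × Fin n)) {S S' : Finset (Fin n)} (h : S' ⊆ S) :
    NB E S' ⊆ NB E S := by
  intro b
  simp only [NB, Finset.mem_filter, Finset.mem_univ, true_and]
  rintro ⟨a, ha, hab⟩
  exact ⟨a, h ha, hab⟩

lemma sum_YY_inv (q : ℝ) {n d : ℕ} (K : ℕ) :
    ∑ ω : Fin d → Equiv.Perm (Fin n), YY q K ω⁻¹ =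
      ∑ ω : Fin d → Equiv.Perm (Fin n), YY q K ω :=
  Equiv.sum_comp (Equiv.inv (Fin d → Equiv.Perm (Fin n))) (fun ω => YY q K ω)

/-- Existence of a good choice, given numeric bounds. -/
lemma exists_good (p : ℕ) (hp : 1 ≤ p) {n d : ℕ} (K : ℕ) (hn : 1 ≤ n) (R : ℝ)
    (hY : ∑ ω : Fin d → Equiv.Perm (Fin n), YY p K ω ≤ (n.factorial : ℝ) ^ d * R)
    (hR : 2 * R + 4 ^ n * Real.exp (-(d * K * K / n)) < 1) :
    ∃ ω : Fin d → Equiv.Perm (Fin n),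
      cGraph p (EE ω) ≤ 2 * R + 4 ^ n * Real.exp (-(d * K * K / n)) := by
  classical
  set Q := (Finset.univ : Finset (Finset (Fin n) × Finset (Fin n))).filter
    (fun x => K ≤ x.1.card ∧ K ≤ x.2.card) with hQ
  set Z : (Fin d → Equiv.Perm (Fin n)) → ℝ := fun ω =>
    ∑ x ∈ Q, if Disjoint (NB (EE ω) x.1) x.2 then (1 : ℝ) else 0 with hZ
  have hp0 : (0 : ℝ) < p := by exact_mod_cast hp
  have hYpos : ∀ ω : Fin d → Equiv.Perm (Fin n), 0 ≤ YY p K ω := fun ω => by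
    unfold YY; positivity
  have hZsum : ∑ ω, Z ω ≤ (n.factorial : ℝ) ^ d * (4 ^ n * Real.exp (-(d * K * K / n))) := by
    simp only [hZ]
    rw [Finset.sum_comm]
    have hb : ∀ x ∈ Q, (∑ ω : Fin d → Equiv.Perm (Fin n),
        if Disjoint (NB (EE ω) x.1) x.2 then (1 : ℝ) else 0) ≤
        (n.factorial : ℝ) ^ d * Real.exp (-(d * K * K / n)) := by
      intro x hx
      simp only [hQ, Finset.mem_filter, Finset.mem_univ, true_and] at hx
      rw [← Finset.sum_filter, Finset.sum_const, nsmul_eq_mul, mul_one]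
      refine (empty_count hn x.1 x.2 d).trans ?_
      have h1 : (K : ℝ) ≤ x.1.card := by exact_mod_cast hx.1
      have h2 : (K : ℝ) ≤ x.2.card := by exact_mod_cast hx.2
      gcongr
    refine (Finset.sum_le_sum hb).trans ?_
    rw [Finset.sum_const, nsmul_eq_mul]
    have hc : (Q.card : ℝ) ≤ 4 ^ n := by
      have : Q.card ≤ 4 ^ n := by
        refine (Finset.card_le_univ _).trans ?_
        simp [Fintype.card_prod, ← mul_pow]
      exact_mod_cast this
    calc _ ≤ (4 : ℝ) ^ n * ((n.factorial : ℝ) ^ d * Real.exp (-(d * K * K / n))) := by gcongr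
      _ = _ := by ring
  have htot : ∑ ω : Fin d → Equiv.Perm (Fin n), (YY p K ω + YY p K ω⁻¹ + Z ω) ≤
      ∑ ω : Fin d → Equiv.Perm (Fin n), (2 * R + 4 ^ n * Real.exp (-(d * K * K / n))) := by
    rw [Finset.sum_add_distrib, Finset.sum_add_distrib, sum_YY_inv, Finset.sum_const,
      Finset.card_univ, nsmul_eq_mul]
    have : (Fintype.card (Fin d → Equiv.Perm (Fin n)) : ℝ) = (n.factorial : ℝ) ^ d := by
      simp [Fintype.card_perm]
    rw [this]
    nlinarith
  obtain ⟨ω, _, hω⟩ := Finset.exists_le_of_sum_le Finset.univ_nonempty htot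
  refine ⟨ω, ?_⟩
  have hZ0 : 0 ≤ Z ω := Finset.sum_nonneg (fun x _ => by split_ifs <;> norm_num)
  refine (cGraph_le p hp K ω ?_).trans (by linarith)
  intro S T hS hT hd
  have : (1 : ℝ) ≤ Z ω := by
    have hm : (S, T) ∈ Q := by simp [hQ, hS, hT]
    have := Finset.single_le_sum (f := fun x : Finset (Fin n) × Finset (Fin n) =>
      if Disjoint (NB (EE ω) x.1) x.2 then (1 : ℝ) else 0)
      (fun x _ => by positivity) hm
    simp only [if_pos hd] at this
    exact this
  linarith [hYpos ω, hYpos ω⁻¹]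

/-- The bound for the expectation of `p ^ (-|N(S)|)`. -/
noncomputable def gg (p n d : ℕ) (s : ℕ) : ℝ :=
  (((p : ℝ)⁻¹) ^ d) ^ s * Real.exp ((p - 1) * (d ^ 2 * (s : ℝ) ^ 2 / n))

lemma exp_NB' {n : ℕ} (hn : 1 ≤ n) (p : ℕ) (hp : 1 ≤ p) (S : Finset (Fin n)) (d : ℕ) :
    ∑ ω : Fin d → Equiv.Perm (Fin n), ((p : ℝ)⁻¹) ^ (NB (EE ω) S).card ≤
      (n.factorial : ℝ) ^ d * gg p n d S.card := by
  refine (exp_NB hn p (by exact_mod_cast hp) S d d le_rfl).trans (le_of_eq ?_)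
  unfold gg
  rw [mul_pow, mul_pow, ← Real.exp_nat_mul, ← pow_mul, ← pow_mul, mul_comm d S.card]
  congr 3
  ring

lemma exp_NB_large {n : ℕ} (hn : 1 ≤ n) (p : ℕ) (hp : 1 ≤ p) (S : Finset (Fin n)) (d s : ℕ)
    (hs : s ≤ S.card) :
    ∑ ω : Fin d → Equiv.Perm (Fin n), ((p : ℝ)⁻¹) ^ (NB (EE ω) S).card ≤
      (n.factorial : ℝ) ^ d * gg p n d s := by
  obtain ⟨S', hS', hc⟩ := Finset.exists_subset_card_eq hs
  have := exp_NB' hn p hp S' d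
  rw [hc] at this
  refine le_trans (Finset.sum_le_sum fun ω _ => ?_) this
  have hp1 : (1 : ℝ) ≤ p := by exact_mod_cast hp
  exact pow_le_pow_of_le_one (by positivity) (inv_le_one_of_one_le₀ hp1)
    (Finset.card_le_card (NB_mono _ hS'))

lemma num_E (p n d s : ℕ) (hp : 1 ≤ p) (hn : 1 ≤ n) (hs : 1 ≤ s) (hd : 1 ≤ d)
    (h1 : 8 * p * d * s ≤ n) (h2 : (p : ℝ) * d ^ 2 ≤ Real.sqrt n) (h3 : (d : ℝ) ≤ 4 * Real.log n) :
    Real.exp ((p - 1) * (d ^ 2 * (s : ℝ) / n)) ≤ Real.exp 1 * s := by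
  have hn0 : (0 : ℝ) < n := by exact_mod_cast hn
  have hp0 : (1 : ℝ) ≤ p := by exact_mod_cast hp
  have hs0 : (1 : ℝ) ≤ s := by exact_mod_cast hs
  have hd0 : (1 : ℝ) ≤ d := by exact_mod_cast hd
  have h1' : (8 : ℝ) * p * d * s ≤ n := by exact_mod_cast h1
  by_cases hc : (p : ℝ) * d ^ 2 * s ≤ n
  · have : ((p : ℝ) - 1) * (d ^ 2 * (s : ℝ) / n) ≤ 1 := by
      rw [← mul_div_assoc, div_le_one hn0]
      have : 0 ≤ (d : ℝ) ^ 2 * s := by positivity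
      nlinarith
    calc _ ≤ Real.exp 1 := Real.exp_le_exp.2 this
      _ ≤ _ := le_mul_of_one_le_right (Real.exp_pos 1).le hs0
  · push Not at hc
    have hsq : Real.sqrt n * Real.sqrt n = n := Real.mul_self_sqrt hn0.le
    have hsqp : 0 < Real.sqrt n := Real.sqrt_pos.2 hn0
    have hs' : Real.sqrt n ≤ s := by
      by_contra hcon
      push Not at hcon
      have : (p : ℝ) * d ^ 2 * s ≤ Real.sqrt n * Real.sqrt n :=
        mul_le_mul h2 hcon.le (by positivity) hsqp.le
      linarith
    have he : ((p : ℝ) - 1) * (d ^ 2 * (s : ℝ) / n) ≤ Real.log n / 2 := by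
      have : ((p : ℝ) - 1) * (d ^ 2 * (s : ℝ) / n) ≤ d / 8 := by
        rw [← mul_div_assoc, div_le_iff₀ hn0]
        have h5 : (d : ℝ) * (8 * p * d * s) ≤ d * n := by gcongr
        have : 0 ≤ (d : ℝ) ^ 2 * s := by positivity
        nlinarith
      linarith
    calc _ ≤ Real.exp (Real.log n / 2) := Real.exp_le_exp.2 he
      _ = Real.sqrt n := by
        rw [Real.exp_half, Real.exp_log hn0]
      _ ≤ s := hs'
      _ ≤ _ := le_mul_of_one_le_left (by positivity) (by
        have := Real.add_one_le_exp (1 : ℝ); linarith)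

lemma num_A (p n d s : ℕ) (hp : 1 ≤ p) (hn : 1 ≤ n) (hs : 1 ≤ s) (hd : 1 ≤ d)
    (h1 : 8 * p * d * s ≤ n) (h2 : (p : ℝ) * d ^ 2 ≤ Real.sqrt n) (h3 : (d : ℝ) ≤ 4 * Real.log n) :
    (n.choose s : ℝ) * ((p : ℝ) ^ s * gg p n d s) ≤
      (p * Real.exp 1 ^ 2 * (n * ((p : ℝ)⁻¹) ^ d)) ^ s := by
  have hE := num_E p n d s hp hn hs hd h1 h2 h3
  have hC : (n.choose s : ℝ) ≤ (n : ℝ) ^ s / s.factorial := Nat.choose_le_pow_div s n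
  have hF : (s : ℝ) ^ s / s.factorial ≤ Real.exp s :=
    Real.pow_div_factorial_le_exp _ (by positivity) s
  have hG : Real.exp ((p - 1) * (d ^ 2 * (s : ℝ) ^ 2 / n)) ≤ (Real.exp 1 * s) ^ s := by
    refine le_trans (le_of_eq ?_) (pow_le_pow_left₀ (Real.exp_pos _).le hE s)
    rw [← Real.exp_nat_mul]
    congr 1
    ring
  have hes : Real.exp s = Real.exp 1 ^ s := by
    rw [← Real.exp_nat_mul, mul_one]
  unfold gg
  calc _ ≤ (n : ℝ) ^ s / s.factorial * ((p : ℝ) ^ s *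
        ((((p : ℝ)⁻¹) ^ d) ^ s * (Real.exp 1 * s) ^ s)) := by gcongr
    _ = (n : ℝ) ^ s * ((p : ℝ) ^ s * ((((p : ℝ)⁻¹) ^ d) ^ s * Real.exp 1 ^ s)) *
        ((s : ℝ) ^ s / s.factorial) := by rw [mul_pow]; ring
    _ ≤ (n : ℝ) ^ s * ((p : ℝ) ^ s * ((((p : ℝ)⁻¹) ^ d) ^ s * Real.exp 1 ^ s)) *
        Real.exp 1 ^ s := by rw [← hes]; gcongr
    _ = _ := by
      simp only [mul_pow]; ring

lemma num_B (p n d : ℕ) (hp : 2 ≤ p) (hn : 1 ≤ n) (hd : 1 ≤ d) (h16 : 16 * p * d ≤ n) :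
    gg p n d (n / (8 * p * d)) ≤ Real.exp (-(n / (32 * p))) := by
  have hn0 : (0 : ℝ) < n := by exact_mod_cast hn
  have hp0 : (2 : ℝ) ≤ p := by exact_mod_cast hp
  have hpp : (0 : ℝ) < p := by linarith
  have hd0 : (1 : ℝ) ≤ d := by exact_mod_cast hd
  set s := n / (8 * p * d) with hs
  have hpos : 0 < 8 * p * d := by positivity
  have hle : (8 : ℝ) * p * d * s ≤ n := by
    have := Nat.mul_div_le n (8 * p * d)
    rw [← hs] at this
    exact_mod_cast this
  have hge : (n : ℝ) ≤ 8 * p * d * s + 8 * p * d := by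
    have := (Nat.lt_mul_div_succ n hpos).le
    rw [← hs] at this
    have h2 : (n : ℝ) ≤ 8 * p * d * (s + 1) := by exact_mod_cast this
    linarith
  have h16' : (16 : ℝ) * p * d ≤ n := by exact_mod_cast h16
  have hlog : (5 / 8 : ℝ) ≤ Real.log p := by
    have := Real.log_two_gt_d9
    have h2 : Real.log 2 ≤ Real.log p := Real.log_le_log (by norm_num) hp0
    linarith
  unfold gg
  have hinv : ((p : ℝ)⁻¹ ^ d) ^ s = Real.exp (-(d * s * Real.log p)) := by
    rw [← pow_mul, inv_pow, Real.exp_neg]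
    congr 1
    rw [← Nat.cast_mul, Real.exp_nat_mul, Real.exp_log hpp]
  rw [hinv, ← Real.exp_add]
  apply Real.exp_le_exp.2
  have hds : 0 ≤ (d : ℝ) * s := by positivity
  have e1 : (d : ℝ) * s * (5 / 8) ≤ d * s * Real.log p := by gcongr
  have e2 : ((p : ℝ) - 1) * (d ^ 2 * (s : ℝ) ^ 2 / n) ≤ d * s / 8 := by
    rw [← mul_div_assoc, div_le_iff₀ hn0]
    have : (d : ℝ) * s * (8 * p * d * s) ≤ d * s * n := by gcongr
    nlinarith [sq_nonneg ((d : ℝ) * s)]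
  have e3 : (n : ℝ) / (32 * p) ≤ d * s / 2 := by
    rw [div_le_iff₀ (by positivity)]
    nlinarith
  linarith

lemma num_C (p n K : ℕ) (hp : 2 ≤ p) (hK : K * (2 ^ 14 * p ^ 3) ≤ n) :
    (128 * (p : ℝ) ^ 2) ^ K ≤ Real.exp (n / (128 * p)) := by
  have hp0 : (2 : ℝ) ≤ p := by exact_mod_cast hp
  have hK' : (K : ℝ) * (2 ^ 14 * p ^ 3) ≤ n := by exact_mod_cast hK
  calc (128 * (p : ℝ) ^ 2) ^ K ≤ (Real.exp (128 * (p : ℝ) ^ 2)) ^ K := by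
        gcongr
        have := Real.add_one_le_exp (128 * (p : ℝ) ^ 2)
        linarith
    _ = Real.exp (K * (128 * (p : ℝ) ^ 2)) := by rw [Real.exp_nat_mul]
    _ ≤ _ := by
        apply Real.exp_le_exp.2
        rw [le_div_iff₀ (by positivity)]
        nlinarith

lemma sum_YY_le (p n d K : ℕ) (hp : 2 ≤ p) (hn : 1 ≤ n) (hd : 1 ≤ d) (h16 : 16 * p * d ≤ n)
    (h2 : (p : ℝ) * d ^ 2 ≤ Real.sqrt n) (h3 : (d : ℝ) ≤ 4 * Real.log n)
    (hK : K * (2 ^ 14 * p ^ 3) ≤ n) (r : ℝ)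
    (hr : r = p * Real.exp 1 ^ 2 * (n * ((p : ℝ)⁻¹) ^ d)) (hr2 : r ≤ 1 / 2) :
    ∑ ω : Fin d → Equiv.Perm (Fin n), YY p K ω ≤
      (n.factorial : ℝ) ^ d * (2 * r + Real.exp (-(n / (64 * p)))) := by
  have hp0 : (2 : ℝ) ≤ p := by exact_mod_cast hp
  have hpp : (0 : ℝ) < p := by linarith
  have hr0 : 0 ≤ r := by rw [hr]; positivity
  set s0 := n / (8 * p * d) with hs0
  set x : ℝ := (128 * p)⁻¹ with hx
  have hx0 : 0 < x := by positivity
  have hx1 : x ≤ 1 := inv_le_one_of_one_le₀ (by linarith)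
  have hgg : ∀ s, 0 ≤ gg p n d s := fun s => by unfold gg; positivity
  set u : ℕ → ℝ := fun s => if 1 ≤ s ∧ s ≤ s0 then (p : ℝ) ^ s * gg p n d s else 0 with hu
  set C : ℝ := (128 * (p : ℝ) ^ 2) ^ K * Real.exp (-(n / (32 * p))) with hC
  have hC0 : 0 ≤ C := by positivity
  have hu0 : ∀ s, 0 ≤ u s := fun s => by
    simp only [hu]; split_ifs
    · exact mul_nonneg (by positivity) (hgg s)
    · exact le_rfl
  have step1 : ∑ ω : Fin d → Equiv.Perm (Fin n), YY p K ω ≤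
      ∑ S : Finset (Fin n), (n.factorial : ℝ) ^ d * (u S.card + x ^ S.card * C) := by
    unfold YY
    rw [Finset.sum_comm]
    refine le_trans (Finset.sum_le_sum (g := fun S : Finset (Fin n) =>
      (n.factorial : ℝ) ^ d * (u S.card + x ^ S.card * C)) ?_) ?_
    · intro S hS
      simp only [Finset.mem_filter, Finset.mem_univ, true_and] at hS
      rw [← Finset.mul_sum]
      by_cases hc : S.card ≤ s0
      · have h := exp_NB' hn p (by omega) S d
        have hus : u S.card = (p : ℝ) ^ S.card * gg p n d S.card := by
          simp only [hu]; rw [if_pos ⟨hS.1, hc⟩]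
        calc _ ≤ (p : ℝ) ^ S.card * ((n.factorial : ℝ) ^ d * gg p n d S.card) := by gcongr
          _ = (n.factorial : ℝ) ^ d * u S.card := by rw [hus]; ring
          _ ≤ _ := by
            gcongr
            have : 0 ≤ x ^ S.card * C := by positivity
            linarith
      · have h := exp_NB_large hn p (by omega) S d s0 (by omega)
        have hB := num_B p n d hp hn hd h16
        rw [← hs0] at hB
        have hpx : (p : ℝ) ^ S.card ≤ x ^ S.card * (128 * (p : ℝ) ^ 2) ^ K := by
          have e1 : (p : ℝ) = x * (128 * (p : ℝ) ^ 2) := by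
            rw [hx]; field_simp
          calc (p : ℝ) ^ S.card = x ^ S.card * (128 * (p : ℝ) ^ 2) ^ S.card := by
                rw [← mul_pow, ← e1]
            _ ≤ _ := by
              gcongr
              · nlinarith
              · exact hS.2
        calc _ ≤ (x ^ S.card * (128 * (p : ℝ) ^ 2) ^ K) *
              ((n.factorial : ℝ) ^ d * Real.exp (-(n / (32 * p)))) := by
              gcongr
              refine h.trans ?_
              gcongr
          _ = (n.factorial : ℝ) ^ d * (x ^ S.card * C) := by rw [hC]; ring
          _ ≤ _ := by
            gcongr
            have := hu0 S.card
            linarith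
    · apply Finset.sum_le_sum_of_subset_of_nonneg (Finset.subset_univ _)
      intro S _ _
      have := hu0 S.card
      positivity
  refine step1.trans ?_
  rw [← Finset.mul_sum]
  refine mul_le_mul_of_nonneg_left ?_ (by positivity)
  rw [Finset.sum_add_distrib]
  have hA : ∑ S : Finset (Fin n), u S.card ≤ 2 * r := by
    rw [← Finset.powerset_univ, Finset.sum_powerset_apply_card]
    simp only [Finset.card_univ, Fintype.card_fin, nsmul_eq_mul]
    rw [Finset.sum_range_succ']
    have hz : u 0 = 0 := by simp [hu]
    rw [hz, mul_zero, add_zero]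
    calc ∑ k ∈ Finset.range n, (n.choose (k + 1) : ℝ) * u (k + 1)
        ≤ ∑ k ∈ Finset.range n, r * (1 / 2) ^ k := by
          apply Finset.sum_le_sum
          intro k _
          have hrk : r ^ (k + 1) ≤ r * (1 / 2) ^ k := by
            rw [pow_succ, mul_comm]
            gcongr
          refine le_trans ?_ hrk
          by_cases hk : k + 1 ≤ s0
          · have huk : u (k + 1) = (p : ℝ) ^ (k + 1) * gg p n d (k + 1) := by
              simp only [hu]; rw [if_pos ⟨by omega, hk⟩]
            rw [huk, hr]
            apply num_A p n d (k + 1) (by omega) hn (by omega) hd _ h2 h3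
            refine le_trans (Nat.mul_le_mul_left _ hk) ?_
            exact Nat.mul_div_le n (8 * p * d)
          · have huk : u (k + 1) = 0 := by
              simp only [hu]; rw [if_neg (fun h => hk h.2)]
            rw [huk, mul_zero]; positivity
      _ = r * ∑ k ∈ Finset.range n, (1 / 2 : ℝ) ^ k := by rw [Finset.mul_sum]
      _ ≤ r * 2 := by gcongr; exact sum_geometric_two_le n
      _ = _ := by ring
  have hBB : ∑ S : Finset (Fin n), x ^ S.card * C ≤ Real.exp (-(n / (64 * p))) := by
    rw [← Finset.sum_mul]
    have h := Finset.sum_pow_mul_eq_add_pow x 1 (Finset.univ : Finset (Fin n))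
    simp only [one_pow, mul_one, Finset.powerset_univ, Finset.card_univ, Fintype.card_fin] at h
    rw [h, hC]
    calc (x + 1) ^ n * ((128 * (p : ℝ) ^ 2) ^ K * Real.exp (-(n / (32 * p))))
        ≤ (Real.exp x) ^ n * (Real.exp (n / (128 * p)) * Real.exp (-(n / (32 * p)))) := by
          gcongr
          · exact Real.add_one_le_exp x
          · exact num_C p n K hp hK
      _ = Real.exp (-(n / (64 * p))) := by
          rw [← Real.exp_nat_mul, ← Real.exp_add, ← Real.exp_add]
          congr 1
          rw [hx]
          field_simp
          ring
  linarith

lemma finite_main (p n d : ℕ) (hp : 2 ≤ p) (hn : 2 ^ 14 * p ^ 3 ≤ n) (h16 : 16 * p * d ≤ n)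
    (h2 : (p : ℝ) * d ^ 2 ≤ Real.sqrt n) (h3 : (d : ℝ) ≤ 4 * Real.log n)
    (hdM : 12 * (2 ^ 14 * p ^ 3) ^ 2 ≤ d) (r : ℝ)
    (hr : r = p * Real.exp 1 ^ 2 * (n * ((p : ℝ)⁻¹) ^ d)) (hr2 : r ≤ 1 / 2)
    (hB : 2 * (2 * r + Real.exp (-(n / (64 * p)))) + Real.exp (-n) < 1) :
    ∃ ω : Fin d → Equiv.Perm (Fin n),
      cGraph p (EE ω) ≤ 2 * (2 * r + Real.exp (-(n / (64 * p)))) + Real.exp (-n) := by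
  set M := 2 ^ 14 * p ^ 3 with hM
  have hM0 : 0 < M := by positivity
  have hn1 : 1 ≤ n := le_trans hM0 hn
  have hd1 : 1 ≤ d := le_trans (Nat.succ_le_of_lt (by positivity)) hdM
  set K := n / M with hK
  have hKle : K * M ≤ n := Nat.div_mul_le_self n M
  have hY := sum_YY_le p n d K hp hn1 hd1 h16 h2 h3 hKle r hr hr2
  have hn0 : (0 : ℝ) < n := by exact_mod_cast hn1
  have hM0' : (0 : ℝ) < M := by exact_mod_cast hM0
  have hKge : (n : ℝ) ≤ 2 * M * K := by
    have h1 : n < M * (K + 1) := Nat.lt_mul_div_succ n hM0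
    have h2 : 1 ≤ K := (Nat.one_le_div_iff hM0).2 hn
    have : n ≤ 2 * M * K := by nlinarith
    exact_mod_cast this
  have hdM' : (12 : ℝ) * M ^ 2 ≤ d := by exact_mod_cast hdM
  have hexp : (4 : ℝ) ^ n * Real.exp (-(d * K * K / n)) ≤ Real.exp (-n) := by
    have h4 : (4 : ℝ) ^ n ≤ Real.exp (2 * n) := by
      have : (4 : ℝ) ≤ Real.exp 2 := by
        have h1 := Real.add_one_le_exp (1 : ℝ)
        have h2 : Real.exp 2 = Real.exp 1 * Real.exp 1 := by rw [← Real.exp_add]; norm_num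
        nlinarith
      calc (4 : ℝ) ^ n ≤ Real.exp 2 ^ n := by gcongr
        _ = _ := by rw [← Real.exp_nat_mul, mul_comm]
    have h5 : (3 : ℝ) * n ≤ d * K * K / n := by
      rw [le_div_iff₀ hn0]
      have hK0 : (0 : ℝ) ≤ K := by positivity
      have a1 : (n : ℝ) * n ≤ (2 * M * K) * (2 * M * K) := by gcongr
      have a2 : (12 : ℝ) * M ^ 2 * (K * K) ≤ d * (K * K) := by gcongr
      nlinarith
    calc _ ≤ Real.exp (2 * n) * Real.exp (-(3 * n)) := by gcongr
      _ = _ := by rw [← Real.exp_add]; congr 1; ring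
  obtain ⟨ω, hω⟩ := exists_good p (by omega) K hn1 _ hY (by linarith)
  exact ⟨ω, by linarith⟩

lemma deg_NB {n d : ℕ} (hd : 1 ≤ d) (ω : Fin d → Equiv.Perm (Fin n)) (a : Fin n) :
    1 ≤ (NB (EE ω) {a}).card ∧ (NB (EE ω) {a}).card ≤ d := by
  refine ⟨Finset.card_pos.2 ⟨ω ⟨0, hd⟩ a, ?_⟩, by simpa using NB_EE_card_le ω {a}⟩
  rw [mem_NB_EE]
  exact ⟨a, by simp, ⟨0, hd⟩, rfl⟩
/-- **Theorem 5.1**: if `t_n ≤ n` and `t_n - log_p n → ∞`, then there is a sequence of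
bipartite graphs `G_n` with bipartition `{A_n, B_n}`, `|A_n| = |B_n| = n`, all degrees
(eventually) between `1` and `min {t_n, log_p n + log log n}`, and `c(G_n) → 0`. -/
theorem statement12 (p : ℕ) (hp : p.Prime)
    (t : ℕ → ℕ) (ht : ∀ n, 1 ≤ n → 1 ≤ t n ∧ t n ≤ n)
    (hdiv : Tendsto (fun n : ℕ => (t n : ℝ) - Real.log n / Real.log p) atTop atTop) :
    ∃ E : (n : ℕ) → Finset (Fin n × Fin n),
      (∀ᶠ n in atTop, ∀ a : Fin n,
        1 ≤ (NB (E n) {a}).card ∧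
        ((NB (E n) {a}).card : ℝ) ≤
          min (t n : ℝ) (Real.log n / Real.log p + Real.log (Real.log n))) ∧
      (∀ᶠ n in atTop, ∀ b : Fin n,
        1 ≤ (NA (E n) {b}).card ∧
        ((NA (E n) {b}).card : ℝ) ≤
          min (t n : ℝ) (Real.log n / Real.log p + Real.log (Real.log n))) ∧
      Tendsto (fun n => cGraph p (E n)) atTop (nhds 0) := by
  have hp2 : 2 ≤ p := hp.two_le
  have hp2' : (2 : ℝ) ≤ p := by exact_mod_cast hp2
  have hpp : (0 : ℝ) < p := by linarith
  have hlog2 : (1 / 2 : ℝ) ≤ Real.log p := by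
    have := Real.log_two_gt_d9
    have h2 : Real.log 2 ≤ Real.log p := Real.log_le_log (by norm_num) hp2'
    linarith
  have hlogp : 0 < Real.log p := by linarith
  set L : ℕ → ℝ := fun n => Real.log n / Real.log p with hL
  set m : ℕ → ℝ := fun n => min (t n : ℝ) (L n + Real.log (Real.log n)) with hm
  set d : ℕ → ℕ := fun n => ⌊m n⌋₊ with hd
  have hlogn : Tendsto (fun n : ℕ => Real.log n) atTop atTop :=
    Real.tendsto_log_atTop.comp tendsto_natCast_atTop_atTop
  have hloglog : Tendsto (fun n : ℕ => Real.log (Real.log n)) atTop atTop :=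
    Real.tendsto_log_atTop.comp hlogn
  have hmL : Tendsto (fun n => m n - L n) atTop atTop := by
    rw [tendsto_atTop] at hdiv hloglog ⊢
    intro b
    filter_upwards [hdiv b, hloglog b] with n h1 h2
    simp only [hm]
    rw [le_sub_iff_add_le, le_min_iff]
    constructor <;> linarith
  have hL0 : ∀ n : ℕ, 0 ≤ L n := fun n => div_nonneg (Real.log_natCast_nonneg n) hlogp.le
  have hdL : Tendsto (fun n => (d n : ℝ) - L n) atTop atTop := by
    rw [tendsto_atTop] at hmL ⊢
    intro b
    filter_upwards [hmL (b + 1)] with n h1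
    have := Nat.lt_floor_add_one (m n)
    simp only [hd]
    linarith
  have hdle : ∀ᶠ n in atTop, (d n : ℝ) ≤ m n := by
    filter_upwards [(tendsto_atTop.1 hmL) 0] with n h1
    exact Nat.floor_le (by linarith [hL0 n])
  have hdtop : Tendsto d atTop atTop := by
    rw [← tendsto_natCast_atTop_iff (R := ℝ)]
    exact tendsto_atTop_mono (fun n => by linarith [hL0 n]) hdL
  have hd4 : ∀ᶠ n in atTop, (d n : ℝ) ≤ 4 * Real.log n := by
    filter_upwards [hdle, (tendsto_atTop.1 hlogn) 1] with n h1 h2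
    have h3 : m n ≤ L n + Real.log (Real.log n) := min_le_right _ _
    have h4 : Real.log (Real.log n) ≤ Real.log n := by
      have := Real.log_le_sub_one_of_pos (show 0 < Real.log (n : ℝ) by linarith)
      linarith
    have h5 : L n ≤ 2 * Real.log n := by
      simp only [hL]
      rw [div_le_iff₀ hlogp]
      nlinarith
    linarith
  have hsq : ∀ᶠ n : ℕ in atTop, (p : ℝ) * (d n : ℝ) ^ 2 ≤ Real.sqrt n := by
    have ho := (Real.isLittleO_pow_log_id_atTop (n := 4)).comp_tendsto
      (tendsto_natCast_atTop_atTop (R := ℝ))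
    have hc : (0 : ℝ) < ((16 * (p : ℝ)) ^ 2)⁻¹ := by positivity
    filter_upwards [hd4, ho.def hc, (tendsto_atTop.1 hlogn) 1] with n h1 h2 h3
    simp only [Function.comp, id, Real.norm_eq_abs, abs_pow, Nat.abs_cast] at h2
    rw [abs_of_nonneg (by linarith), inv_mul_eq_div, le_div_iff₀ (by positivity)] at h2
    apply Real.le_sqrt_of_sq_le
    calc ((p : ℝ) * (d n : ℝ) ^ 2) ^ 2 ≤ ((p : ℝ) * (4 * Real.log n) ^ 2) ^ 2 := by gcongr
      _ = Real.log n ^ 4 * (16 * p) ^ 2 := by ring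
      _ ≤ n := h2
  set r : ℕ → ℝ := fun n => p * Real.exp 1 ^ 2 * (n * ((p : ℝ)⁻¹) ^ (d n)) with hr
  have hr0 : Tendsto r atTop (nhds 0) := by
    have h1 : Tendsto (fun n => p * Real.exp 1 ^ 2 *
        Real.exp (-(((d n : ℝ) - L n) * Real.log p))) atTop (nhds (p * Real.exp 1 ^ 2 * 0)) := by
      apply Tendsto.const_mul
      apply Real.tendsto_exp_neg_atTop_nhds_zero.comp
      exact hdL.atTop_mul_const hlogp
    rw [mul_zero] at h1
    refine h1.congr' ?_
    filter_upwards [eventually_ge_atTop 1] with n hn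
    have hn0 : (0 : ℝ) < n := by exact_mod_cast hn
    simp only [hr, hL]
    congr 1
    have e1 : -(((d n : ℝ) - Real.log n / Real.log p) * Real.log p) =
        Real.log n - d n * Real.log p := by field_simp; ring
    rw [e1, Real.exp_sub, Real.exp_log hn0, Real.exp_nat_mul, Real.exp_log hpp, inv_pow]
    rfl
  set B : ℕ → ℝ := fun n =>
    2 * (2 * r n + Real.exp (-(n / (64 * p)))) + Real.exp (-n) with hB
  have hB0 : Tendsto B atTop (nhds 0) := by
    have e1 : Tendsto (fun n : ℕ => Real.exp (-((n : ℝ) / (64 * p)))) atTop (nhds 0) := by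
      apply Real.tendsto_exp_neg_atTop_nhds_zero.comp
      exact (tendsto_natCast_atTop_atTop (R := ℝ)).atTop_div_const (by positivity)
    have e2 : Tendsto (fun n : ℕ => Real.exp (-(n : ℝ))) atTop (nhds 0) :=
      Real.tendsto_exp_neg_atTop_nhds_zero.comp (tendsto_natCast_atTop_atTop (R := ℝ))
    have := (((hr0.const_mul 2).add e1).const_mul 2).add e2
    simpa [hB] using this
  have hex : ∀ᶠ n in atTop, ∃ ω : Fin (d n) → Equiv.Perm (Fin n), cGraph p (EE ω) ≤ B n := by
    filter_upwards [hd4, hsq, hdtop.eventually_ge_atTop (12 * (2 ^ 14 * p ^ 3) ^ 2),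
      eventually_ge_atTop (2 ^ 14 * p ^ 3), hr0.eventually_le_const (by norm_num : (0 : ℝ) < 1 / 2),
      hB0.eventually_lt_const (by norm_num : (0 : ℝ) < 1)] with n h1 h2 h3 h4 h5 h6
    refine finite_main p n (d n) hp2 h4 ?_ h2 h1 h3 (r n) rfl h5 h6
    have hn1 : 1 ≤ n := le_trans (Nat.succ_le_of_lt (by positivity)) h4
    have hd16 : 16 ≤ d n := by
      refine le_trans ?_ h3
      have : 1 ≤ p ^ 3 := Nat.one_le_pow _ _ (by omega)
      nlinarith
    have hs : Real.sqrt n ≤ n := by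
      rw [Real.sqrt_le_left (by positivity)]
      have : (1 : ℝ) ≤ n := by exact_mod_cast hn1
      nlinarith
    have h7 : p * (d n) ^ 2 ≤ n := by exact_mod_cast h2.trans hs
    calc 16 * p * d n = p * (16 * d n) := by ring
      _ ≤ p * (d n * d n) := Nat.mul_le_mul_left _ (Nat.mul_le_mul_right _ hd16)
      _ = p * (d n) ^ 2 := by ring
      _ ≤ n := h7
  classical
  refine ⟨fun n => if h : ∃ ω : Fin (d n) → Equiv.Perm (Fin n), cGraph p (EE ω) ≤ B n
    then EE h.choose else ∅, ?_, ?_, ?_⟩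
  · filter_upwards [hex, hdle, hdtop.eventually_ge_atTop 1] with n h1 h2 h3 a
    rw [dif_pos h1]
    have := deg_NB h3 h1.choose a
    exact ⟨this.1, le_trans (by exact_mod_cast this.2) h2⟩
  · filter_upwards [hex, hdle, hdtop.eventually_ge_atTop 1] with n h1 h2 h3 a
    rw [dif_pos h1, NA_EE_inv]
    have := deg_NB h3 (h1.choose)⁻¹ a
    exact ⟨this.1, le_trans (by exact_mod_cast this.2) h2⟩
  · refine tendsto_of_tendsto_of_tendsto_of_le_of_le' tendsto_const_nhds hB0 ?_ ?_
    · refine Eventually.of_forall fun n => ?_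
      unfold cGraph
      positivity
    · filter_upwards [hex] with n h1
      rw [dif_pos h1]
      exact h1.choose_spec
end

section
/- Let (t_n)_{n≥1} be a sequence of positive integers such that t_n < log_p n + log log n for each n and lim_{n→∞} (t_n − log_p n) = ∞. Let A_n, B_n be disjoint sets of size n, let f_n be chosen uniformly at random from Ω_{A_n, B_n, t_n}, and let G_n = φ(f_n) be the associated t_n-regular bipartite multigraph. Then for every δ > 0 there exists n_0 ∈ N such that P(c(G_n) < δ) ≥ 0.9 for all n ≥ n_0. -/
open Filter

/-- In the configuration model, a `d`-regular bipartite multigraph on `A = B = Fin n` is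
encoded by a bijection `f : A × [d] ≃ B × [d]`; `NBf f S` is the neighborhood in `B` of a
set `S ⊆ A` in the multigraph `φ(f)`. -/
def NBf {n d : ℕ} (f : (Fin n × Fin d) ≃ (Fin n × Fin d)) (S : Finset (Fin n)) :
    Finset (Fin n) :=
  Finset.univ.filter fun b => ∃ a ∈ S, ∃ i : Fin d, (f (a, i)).1 = b

/-- `c(φ(f)) = Σ_{S ∈ F_A} p^{|S| - |N(S)|}`, where `F_A` is the collection of nonempty
proper subsets `S ⊊ A` with `N(S) ≠ B` and `N(w) ⊄ N(S)` for all `w ∈ A \ S`. -/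
noncomputable def cConfig (p : ℕ) {n d : ℕ} (f : (Fin n × Fin d) ≃ (Fin n × Fin d)) : ℝ :=
  ∑ S ∈ Finset.univ.filter (fun S : Finset (Fin n) =>
      S.Nonempty ∧ S ≠ Finset.univ ∧ NBf f S ≠ Finset.univ ∧
        ∀ w ∉ S, ¬ NBf f {w} ⊆ NBf f S),
    (p : ℝ) ^ ((S.card : ℤ) - ((NBf f S).card : ℤ))

/-- The space of configurations. -/
abbrev Om (n d : ℕ) := (Fin n × Fin d) ≃ (Fin n × Fin d)

/-- The set of right vertices hit by the half-edges in `X`. -/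
def hitV {n d : ℕ} (X : Finset (Fin n × Fin d)) (f : Om n d) : Finset (Fin n) :=
  X.image fun y => (f y).1

theorem sum_hit_swap {n d : ℕ} (h : Finset (Fin n) → ℝ) (X : Finset (Fin n × Fin d))
    (x y : Fin n × Fin d) (hx : x ∉ X) (hy : y ∉ X) :
    ∑ f : Om n d, h (hitV (insert x X) f) = ∑ f : Om n d, h (hitV (insert y X) f) := by
  let e : Om n d ≃ Om n d :=
    ⟨fun f => (Equiv.swap x y).trans f, fun f => (Equiv.swap x y).trans f,
      fun f => by ext z : 1; simp, fun f => by ext z : 1; simp⟩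
  rw [← Equiv.sum_comp e]
  refine Finset.sum_congr rfl fun f _ => ?_
  congr 1
  unfold hitV
  rw [Finset.image_insert, Finset.image_insert]
  congr 1
  · simp [e]
  · refine Finset.image_congr fun z hz => ?_
    have h1 : z ≠ x := fun hh => hx (hh ▸ hz)
    have h2 : z ≠ y := fun hh => hy (hh ▸ hz)
    simp [e, Equiv.swap_apply_of_ne_of_ne h1 h2]

theorem avg_hit {n d : ℕ} (h : Finset (Fin n) → ℝ) (X : Finset (Fin n × Fin d))
    (x : Fin n × Fin d) (hx : x ∉ X) :
    (Xᶜ.card : ℝ) * ∑ f : Om n d, h (hitV (insert x X) f)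
      = ∑ f : Om n d, ∑ y ∈ Xᶜ, h (hitV (insert y X) f) := by
  rw [Finset.sum_comm, ← nsmul_eq_mul, ← Finset.sum_const]
  refine Finset.sum_congr rfl fun y hy => ?_
  exact sum_hit_swap h X x y hx (by simpa using hy)

theorem card_pre {n d : ℕ} (f : Om n d) (U : Finset (Fin n)) :
    (Finset.univ.filter fun y => (f y).1 ∈ U).card = U.card * d := by
  have : (Finset.univ.filter fun y => (f y).1 ∈ U)
      = (U ×ˢ (Finset.univ : Finset (Fin d))).map f.symm.toEmbedding := by
    ext y
    simp [Finset.mem_map_equiv, Finset.mem_product]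
  rw [this]
  simp

theorem card_old {n d : ℕ} (f : Om n d) (X : Finset (Fin n × Fin d)) (U : Finset (Fin n))
    (hU : ∀ y ∈ X, (f y).1 ∈ U) :
    ((Xᶜ.filter fun y => (f y).1 ∈ U).card : ℝ) * n ≤ U.card * Xᶜ.card := by
  have h1 : (Xᶜ.filter fun y => (f y).1 ∈ U).card + X.card = U.card * d := by
    rw [← card_pre f U, ← Finset.card_union_of_disjoint]
    · congr 1
      ext y
      by_cases hy : y ∈ X
      · simp [hy, hU y hy]
      · simp [hy]
    · rw [Finset.disjoint_left]
      intro y hy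
      simp at hy
      exact hy.1
  have h2 : Xᶜ.card + X.card = n * d := by
    rw [Finset.card_compl_add_card]; simp
  have h3 : U.card ≤ n := by simpa using Finset.card_le_univ U
  have h1' : ((Xᶜ.filter fun y => (f y).1 ∈ U).card : ℝ) + X.card = U.card * d := by
    exact_mod_cast h1
  have h2' : (Xᶜ.card : ℝ) + X.card = n * d := by exact_mod_cast h2
  have h3' : (U.card : ℝ) ≤ n := by exact_mod_cast h3
  have h4 : (0 : ℝ) ≤ X.card := by positivity
  nlinarith [mul_nonneg h4 (sub_nonneg.2 h3')]

theorem hitV_insert {n d : ℕ} (X : Finset (Fin n × Fin d)) (y) (f : Om n d) :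
    hitV (insert y X) f = insert (f y).1 (hitV X f) := by
  simp [hitV, Finset.image_insert]

theorem mem_hitV {n d : ℕ} {X : Finset (Fin n × Fin d)} {f : Om n d} {y} (hy : y ∈ X) :
    (f y).1 ∈ hitV X f := Finset.mem_image_of_mem (fun y => (f y).1) hy

theorem step_pow {n d : ℕ} (hn : 0 < n) (w : ℝ) (hw : 0 ≤ w) (X : Finset (Fin n × Fin d))
    (x : Fin n × Fin d) (hx : x ∉ X) :
    ∑ f : Om n d, w ^ (hitV (insert x X) f).card
      ≤ (w + X.card / n) * ∑ f : Om n d, w ^ (hitV X f).card := by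
  have hn' : (0 : ℝ) < n := by exact_mod_cast hn
  have hpos : (0 : ℝ) < Xᶜ.card := by
    exact_mod_cast Finset.card_pos.2 ⟨x, by simpa using hx⟩
  refine le_of_mul_le_mul_left ?_ hpos
  rw [avg_hit (fun V => w ^ V.card) X x hx]
  have key : ∀ f : Om n d, ∑ y ∈ Xᶜ, w ^ (hitV (insert y X) f).card
      ≤ (Xᶜ.card : ℝ) * ((w + X.card / n) * w ^ (hitV X f).card) := by
    intro f
    set N := (hitV X f).card with hN
    have hNX : (N : ℝ) ≤ X.card := by exact_mod_cast Finset.card_image_le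
    have h1 : ∀ y ∈ Xᶜ, w ^ (hitV (insert y X) f).card
        ≤ w * w ^ N + (if (f y).1 ∈ hitV X f then w ^ N else 0) := by
      intro y _
      rw [hitV_insert]
      split_ifs with h
      · rw [Finset.insert_eq_of_mem h]
        have := mul_nonneg hw (pow_nonneg hw N)
        linarith
      · rw [Finset.card_insert_of_notMem h, ← hN, pow_succ]
        linarith
    refine (Finset.sum_le_sum h1).trans ?_
    rw [Finset.sum_add_distrib, ← Finset.sum_filter, Finset.sum_const, Finset.sum_const,
      nsmul_eq_mul, nsmul_eq_mul]
    have h2 := card_old f X (hitV X f) (fun y hy => mem_hitV hy)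
    rw [← hN] at h2
    have h3 : ((Xᶜ.filter fun y => (f y).1 ∈ hitV X f).card : ℝ) ≤ Xᶜ.card * (X.card / n) := by
      rw [← mul_div_assoc, le_div_iff₀ hn']
      nlinarith
    have h4 := mul_le_mul_of_nonneg_right h3 (pow_nonneg hw N)
    nlinarith
  calc _ ≤ ∑ f : Om n d, (Xᶜ.card : ℝ) * ((w + X.card / n) * w ^ (hitV X f).card) :=
        Finset.sum_le_sum fun f _ => key f
    _ = _ := by rw [← Finset.mul_sum, ← Finset.mul_sum]

theorem exp_pow {n d : ℕ} (hn : 0 < n) (w : ℝ) (hw : 0 ≤ w) (m : ℕ) (X : Finset (Fin n × Fin d))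
    (hX : X.card ≤ m) :
    ∑ f : Om n d, w ^ (hitV X f).card
      ≤ (w + m / n) ^ X.card * Fintype.card (Om n d) := by
  induction X using Finset.induction_on with
  | empty => simp [hitV]
  | insert x X hx ih =>
    rw [Finset.card_insert_of_notMem hx] at hX ⊢
    refine (step_pow hn w hw X x hx).trans ?_
    have h1 := ih (by omega)
    have h2 : w + (X.card : ℝ) / n ≤ w + m / n := by
      have : (X.card : ℝ) ≤ m := by exact_mod_cast (by omega : X.card ≤ m)
      gcongr
    calc _ ≤ (w + m / n) * ((w + m / n) ^ X.card * Fintype.card (Om n d)) := by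
          gcongr
      _ = _ := by ring

theorem step_rect {n d : ℕ} (hn : 0 < n) (U : Finset (Fin n)) (X : Finset (Fin n × Fin d))
    (x : Fin n × Fin d) (hx : x ∉ X) :
    ∑ f : Om n d, (if hitV (insert x X) f ⊆ U then (1 : ℝ) else 0)
      ≤ (U.card / n) * ∑ f : Om n d, (if hitV X f ⊆ U then (1 : ℝ) else 0) := by
  have hn' : (0 : ℝ) < n := by exact_mod_cast hn
  have hpos : (0 : ℝ) < Xᶜ.card := by
    exact_mod_cast Finset.card_pos.2 ⟨x, by simpa using hx⟩
  refine le_of_mul_le_mul_left ?_ hpos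
  rw [avg_hit (fun V => if V ⊆ U then (1 : ℝ) else 0) X x hx, Finset.mul_sum, Finset.mul_sum]
  refine Finset.sum_le_sum fun f _ => ?_
  by_cases h : hitV X f ⊆ U
  · have h2 := card_old f X U (fun y hy => h (mem_hitV hy))
    simp only [hitV_insert, Finset.insert_subset_iff, h, and_true, if_true, mul_one]
    rw [← Finset.sum_filter, Finset.sum_const, nsmul_eq_mul, mul_one, ← mul_div_assoc,
      le_div_iff₀ hn']
    linarith
  · simp [hitV_insert, Finset.insert_subset_iff, h]

theorem exp_rect {n d : ℕ} (hn : 0 < n) (U : Finset (Fin n)) (X : Finset (Fin n × Fin d)) :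
    ∑ f : Om n d, (if hitV X f ⊆ U then (1 : ℝ) else 0)
      ≤ (U.card / n : ℝ) ^ X.card * Fintype.card (Om n d) := by
  induction X using Finset.induction_on with
  | empty => simp [hitV]
  | insert x X hx ih =>
    rw [Finset.card_insert_of_notMem hx]
    refine (step_rect hn U X x hx).trans ?_
    calc _ ≤ (U.card / n : ℝ) * ((U.card / n : ℝ) ^ X.card * Fintype.card (Om n d)) := by
          gcongr
      _ = _ := by ring

theorem NBf_eq_hit {n d : ℕ} (f : Om n d) (S : Finset (Fin n)) :
    NBf f S = hitV (S ×ˢ Finset.univ) f := by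
  ext b
  simp [NBf, hitV]

theorem exp_NBf {n d : ℕ} (hn : 0 < n) (w : ℝ) (hw : 0 ≤ w) (hw1 : w ≤ 1) (S : Finset (Fin n))
    (m : ℕ) (hm : m ≤ S.card * d) :
    ∑ f : Om n d, w ^ (NBf f S).card ≤ (w + m / n) ^ m * Fintype.card (Om n d) := by
  obtain ⟨X, hXS, hX⟩ := Finset.exists_subset_card_eq
    (s := S ×ˢ (Finset.univ : Finset (Fin d))) (n := m) (by simpa using hm)
  have := exp_pow hn w hw m X hX.le
  rw [hX] at this
  refine le_trans (Finset.sum_le_sum fun f _ => ?_) this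
  refine pow_le_pow_of_le_one hw hw1 (Finset.card_le_card ?_)
  rw [NBf_eq_hit]
  exact Finset.image_subset_image hXS

theorem exp_NBf_rect {n d : ℕ} (hn : 0 < n) (S U : Finset (Fin n)) :
    ∑ f : Om n d, (if NBf f S ⊆ U then (1 : ℝ) else 0)
      ≤ (U.card / n : ℝ) ^ (S.card * d) * Fintype.card (Om n d) := by
  have := exp_rect (d := d) hn U (S ×ˢ Finset.univ)
  simp only [NBf_eq_hit]
  simpa using this

/-- Total weight of the small sets. -/
noncomputable def smallSum (p : ℕ) {n d : ℕ} (K : ℕ) (f : Om n d) : ℝ :=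
  ∑ S ∈ Finset.univ.filter (fun S : Finset (Fin n) => 1 ≤ S.card ∧ S.card ≤ K),
    (p : ℝ) ^ S.card * ((p : ℝ)⁻¹) ^ (NBf f S).card

/-- Number of large empty rectangles. -/
noncomputable def rectSum {n d : ℕ} (K : ℕ) (f : Om n d) : ℝ :=
  ∑ S ∈ Finset.univ.filter (fun S : Finset (Fin n) => K < S.card),
    ∑ T ∈ Finset.univ.filter (fun T : Finset (Fin n) => K < T.card),
      (if NBf f S ⊆ Tᶜ then (1 : ℝ) else 0)

theorem symm_nbr {n d : ℕ} (f : Om n d) (S : Finset (Fin n))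
    (hS : ∀ w ∉ S, ¬ NBf f {w} ⊆ NBf f S) : NBf f.symm (NBf f S)ᶜ = Sᶜ := by
  ext a
  simp only [NBf, Finset.mem_filter, Finset.mem_univ, true_and, Finset.mem_compl]
  constructor
  · rintro ⟨b, hb, i, h⟩ ha
    apply hb
    refine ⟨a, ha, (f.symm (b, i)).2, ?_⟩
    rw [← h]; simp
  · intro ha
    have := hS a ha
    rw [Finset.not_subset] at this
    obtain ⟨b, hb, hb'⟩ := this
    simp only [NBf, Finset.mem_filter, Finset.mem_univ, true_and, Finset.mem_singleton,
      exists_eq_left] at hb hb'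
    obtain ⟨i, hi⟩ := hb
    refine ⟨b, hb', (f (a, i)).2, ?_⟩
    rw [← hi]; simp

theorem c_le {p : ℕ} (hp : 0 < p) {n d : ℕ} (K : ℕ) (f : Om n d) (hR : rectSum K f < 1) :
    cConfig p f ≤ smallSum p K f + smallSum p K f.symm := by
  have hp' : (p : ℝ) ≠ 0 := by positivity
  have hterm : ∀ a b : ℕ, (p : ℝ) ^ ((a : ℤ) - (b : ℤ)) = (p : ℝ) ^ a * ((p : ℝ)⁻¹) ^ b := by
    intro a b
    rw [zpow_sub₀ hp', zpow_natCast, zpow_natCast, inv_pow]; rfl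
  have hnorect : ∀ S T : Finset (Fin n), K < S.card → K < T.card → ¬ NBf f S ⊆ Tᶜ := by
    intro S T hS hT h
    have h1 : (1 : ℝ) ≤ rectSum K f := by
      unfold rectSum
      calc (1 : ℝ) = (if NBf f S ⊆ Tᶜ then (1 : ℝ) else 0) := by simp [h]
        _ ≤ ∑ T ∈ Finset.univ.filter (fun T : Finset (Fin n) => K < T.card),
              (if NBf f S ⊆ Tᶜ then (1 : ℝ) else 0) :=
            Finset.single_le_sum (f := fun T => if NBf f S ⊆ Tᶜ then (1 : ℝ) else 0)
              (fun T _ => by positivity) (by simp [hT])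
        _ ≤ _ := Finset.single_le_sum (f := fun S =>
              ∑ T ∈ Finset.univ.filter (fun T : Finset (Fin n) => K < T.card),
              (if NBf f S ⊆ Tᶜ then (1 : ℝ) else 0))
              (fun T _ => by positivity) (by simp [hS])
    linarith
  unfold cConfig
  rw [← Finset.sum_filter_add_sum_filter_not _ (fun S : Finset (Fin n) => S.card ≤ K)]
  refine add_le_add ?_ ?_
  · unfold smallSum
    simp only [hterm]
    refine Finset.sum_le_sum_of_subset_of_nonneg ?_ (fun _ _ _ => by positivity)
    intro S hS
    simp only [Finset.mem_filter, Finset.mem_univ, true_and] at hS ⊢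
    exact ⟨Finset.card_pos.2 hS.1.1, hS.2⟩
  · set F := (Finset.univ.filter (fun S : Finset (Fin n) =>
      S.Nonempty ∧ S ≠ Finset.univ ∧ NBf f S ≠ Finset.univ ∧
        ∀ w ∉ S, ¬ NBf f {w} ⊆ NBf f S)).filter (fun S => ¬ S.card ≤ K) with hF
    have hinj : Set.InjOn (fun S => (NBf f S)ᶜ) (F : Set (Finset (Fin n))) := by
      intro S hS S' hS' h
      simp only [hF, Finset.coe_filter, Finset.mem_filter, Finset.mem_univ, true_and,
        Set.mem_ofPred_eq] at hS hS'
      have h1 := symm_nbr f S hS.1.2.2.2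
      have h2 := symm_nbr f S' hS'.1.2.2.2
      simp only at h
      rw [h, h2] at h1
      exact (compl_injective h1).symm
    have hsum : ∑ S ∈ F, (p : ℝ) ^ ((S.card : ℤ) - ((NBf f S).card : ℤ))
        = ∑ T ∈ F.image (fun S => (NBf f S)ᶜ),
          (p : ℝ) ^ T.card * ((p : ℝ)⁻¹) ^ (NBf f.symm T).card := by
      rw [Finset.sum_image hinj]
      refine Finset.sum_congr rfl fun S hS => ?_
      simp only [hF, Finset.mem_filter, Finset.mem_univ, true_and] at hS
      rw [symm_nbr f S hS.1.2.2.2, ← hterm]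
      congr 1
      have e1 := Finset.card_compl_add_card S
      have e2 := Finset.card_compl_add_card (NBf f S)
      omega
    rw [hsum]
    unfold smallSum
    refine Finset.sum_le_sum_of_subset_of_nonneg ?_ (fun _ _ _ => by positivity)
    intro T hT
    rw [Finset.mem_image] at hT
    obtain ⟨S, hS, rfl⟩ := hT
    simp only [hF, Finset.mem_filter, Finset.mem_univ, true_and, not_le] at hS ⊢
    constructor
    · rw [Nat.one_le_iff_ne_zero, Ne, Finset.card_eq_zero, Finset.compl_eq_empty_iff]
      exact hS.1.2.2.1
    · by_contra hh
      exact hnorect S _ hS.2 (not_le.1 hh) (by simp)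

theorem exp_small {n d : ℕ} (hn : 0 < n) (p : ℕ) (hp : 0 < p) (K : ℕ) (b : ℕ → ℝ)
    (hb : ∀ k, 1 ≤ k → k ≤ K → k ≤ n → ∃ m, m ≤ k * d ∧
      (n.choose k : ℝ) * p ^ k * ((p : ℝ)⁻¹ + m / n) ^ m ≤ b k) (hb0 : ∀ k, 0 ≤ b k) :
    ∑ f : Om n d, smallSum p K f
      ≤ (∑ k ∈ Finset.Icc 1 n, b k) * Fintype.card (Om n d) := by
  have hp1 : (1 : ℝ) ≤ p := by exact_mod_cast hp
  have hw0 : (0 : ℝ) ≤ (p : ℝ)⁻¹ := by positivity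
  have hw1 : (p : ℝ)⁻¹ ≤ 1 := inv_le_one_of_one_le₀ hp1
  unfold smallSum
  rw [Finset.sum_comm]
  rw [← Finset.sum_fiberwise_of_maps_to (t := Finset.Icc 1 n) (g := Finset.card)]
  · rw [Finset.sum_mul]
    refine Finset.sum_le_sum fun k hk => ?_
    rw [Finset.mem_Icc] at hk
    by_cases hkK : k ≤ K
    · obtain ⟨m, hm, hle⟩ := hb k hk.1 hkK hk.2
      calc _ ≤ ∑ S ∈ Finset.powersetCard k (Finset.univ : Finset (Fin n)),
            (p : ℝ) ^ k * (((p : ℝ)⁻¹ + m / n) ^ m * Fintype.card (Om n d)) := by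
            refine (Finset.sum_le_sum (g := fun S => (p : ℝ) ^ k *
              (((p : ℝ)⁻¹ + m / n) ^ m * Fintype.card (Om n d))) fun S hS => ?_).trans
              (Finset.sum_le_sum_of_subset_of_nonneg ?_ ?_)
            · simp only [Finset.mem_filter] at hS
              rw [← Finset.mul_sum, hS.2]
              gcongr
              exact exp_NBf hn _ hw0 hw1 S m (by rw [hS.2]; exact hm)
            · intro S hS
              simp only [Finset.mem_filter] at hS
              simp [Finset.mem_powersetCard, hS.2]
            · intros; positivity
        _ = ((n.choose k : ℝ) * p ^ k * ((p : ℝ)⁻¹ + m / n) ^ m) * Fintype.card (Om n d) := by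
            rw [Finset.sum_const, Finset.card_powersetCard, nsmul_eq_mul]
            simp only [Finset.card_univ, Fintype.card_fin]
            ring
        _ ≤ _ := by gcongr
    · rw [Finset.sum_eq_zero_iff_of_nonneg (fun _ _ => by positivity) |>.2]
      · have := hb0 k
        positivity
      · intro S hS
        simp only [Finset.mem_filter] at hS
        omega
  · intro S hS
    simp only [Finset.mem_filter] at hS
    rw [Finset.mem_Icc]
    exact ⟨hS.2.1, by simpa using Finset.card_le_univ S⟩

theorem exp_rectSum {n d : ℕ} (hn : 0 < n) (ε : ℝ) (hε : 0 < ε) (K : ℕ) (hK : ε * n ≤ K + 1)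
    (hd : 3 ≤ ε ^ 2 * d) :
    ∑ f : Om n d, rectSum K f ≤ Real.exp (-n) * Fintype.card (Om n d) := by
  have hn' : (0 : ℝ) < n := by exact_mod_cast hn
  unfold rectSum
  rw [Finset.sum_comm]
  have key : ∀ S ∈ Finset.univ.filter (fun S : Finset (Fin n) => K < S.card),
      ∀ T ∈ Finset.univ.filter (fun S : Finset (Fin n) => K < S.card),
      ∑ f : Om n d, (if NBf f S ⊆ Tᶜ then (1 : ℝ) else 0)
        ≤ Real.exp (-(3 * n)) * Fintype.card (Om n d) := by
    intro S hS T hT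
    simp only [Finset.mem_filter, Finset.mem_univ, true_and] at hS hT
    refine (exp_NBf_rect hn S Tᶜ).trans ?_
    gcongr
    have hS' : ε * n ≤ S.card := hK.trans (by exact_mod_cast hS)
    have hT' : ε * n ≤ T.card := hK.trans (by exact_mod_cast hT)
    have h1 : ((Tᶜ.card : ℝ) / n) ≤ Real.exp (-ε) := by
      have e1 : (Tᶜ.card : ℝ) + T.card = n := by
        exact_mod_cast (by rw [Finset.card_compl_add_card]; simp : Tᶜ.card + T.card = n)
      have e2 : (Tᶜ.card : ℝ) / n ≤ 1 - ε := by
        rw [div_le_iff₀ hn']; nlinarith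
      have := Real.add_one_le_exp (-ε)
      linarith
    calc _ ≤ (Real.exp (-ε)) ^ (S.card * d) := by gcongr
      _ = Real.exp (-(ε * S.card * d)) := by
        rw [← Real.exp_nat_mul]; congr 1; push_cast; ring
      _ ≤ _ := by
        rw [Real.exp_le_exp]
        have h0 : (0 : ℝ) ≤ d := by positivity
        have : ε * n * (ε * d) ≤ S.card * (ε * d) := by gcongr
        nlinarith
  calc _ ≤ ∑ S ∈ Finset.univ.filter (fun S : Finset (Fin n) => K < S.card),
      ∑ T ∈ Finset.univ.filter (fun S : Finset (Fin n) => K < S.card),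
        Real.exp (-(3 * n)) * Fintype.card (Om n d) := by
        refine Finset.sum_le_sum fun S hS => ?_
        rw [Finset.sum_comm]
        exact Finset.sum_le_sum fun T hT => key S hS T hT
    _ ≤ ∑ S : Finset (Fin n), ∑ T : Finset (Fin n),
        Real.exp (-(3 * n)) * Fintype.card (Om n d) := by
        refine (Finset.sum_le_sum fun S hS => Finset.sum_le_sum_of_subset_of_nonneg
          (Finset.subset_univ _) (fun _ _ _ => by positivity)).trans
          (Finset.sum_le_sum_of_subset_of_nonneg
          (Finset.subset_univ _) (fun _ _ _ => by positivity))
    _ = (2 : ℝ) ^ n * 2 ^ n * Real.exp (-(3 * n)) * Fintype.card (Om n d) := by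
        simp; ring
    _ ≤ _ := by
        gcongr
        have h2 : (2 : ℝ) ^ n ≤ Real.exp n := by
          have := Real.add_one_le_exp (1 : ℝ)
          calc (2 : ℝ) ^ n ≤ (Real.exp 1) ^ n := by gcongr; linarith
            _ = _ := by rw [← Real.exp_nat_mul, mul_one]
        calc _ ≤ Real.exp n * Real.exp n * Real.exp (-(3 * n)) := by gcongr
          _ = _ := by rw [← Real.exp_add, ← Real.exp_add]; congr 1; ring

theorem choose_exp_bound (n k : ℕ) : (n.choose k : ℝ) ≤ 64 ^ k * Real.exp (n / 64) := by
  by_cases hk : k ≤ n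
  · have h1 : (n.choose k : ℝ) * (1 / 64) ^ k ≤ (1 / 64 + 1) ^ n := by
      rw [add_pow]
      have := Finset.single_le_sum (s := Finset.range (n + 1))
        (f := fun m => (1 / 64 : ℝ) ^ m * 1 ^ (n - m) * (n.choose m : ℝ))
        (fun i _ => by positivity) (Finset.mem_range.2 (Nat.lt_succ_of_le hk))
      simp only [one_pow, mul_one] at this ⊢
      linarith
    have h2 : ((1 / 64 : ℝ) + 1) ^ n ≤ Real.exp (n / 64) := by
      calc _ ≤ (Real.exp (1 / 64)) ^ n := by gcongr; exact Real.add_one_le_exp _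
        _ = _ := by rw [← Real.exp_nat_mul]; congr 1; ring
    have h3 : (n.choose k : ℝ) = 64 ^ k * ((n.choose k : ℝ) * (1 / 64) ^ k) := by
      rw [one_div, inv_pow]; field_simp
    rw [h3]
    gcongr
    exact h1.trans h2
  · rw [Nat.choose_eq_zero_of_lt (by omega)]
    simp only [Nat.cast_zero]
    positivity

theorem choose_div_bound (n k : ℕ) (hk : 1 ≤ k) :
    (n.choose k : ℝ) ≤ (Real.exp 1 * n / k) ^ k := by
  have hk0 : (0 : ℝ) < k := by exact_mod_cast hk
  have h1 : (n.choose k : ℝ) ≤ (n : ℝ) ^ k / k.factorial := Nat.choose_le_pow_div k n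
  have h2 : (k : ℝ) ^ k / k.factorial ≤ Real.exp k := Real.pow_div_factorial_le_exp _ hk0.le k
  have h3 : (0 : ℝ) < k.factorial := by exact_mod_cast k.factorial_pos
  refine h1.trans ?_
  rw [div_pow, mul_pow, ← Real.exp_nat_mul, mul_one]
  rw [div_le_iff₀ h3] at h2
  rw [div_le_div_iff₀ h3 (by positivity)]
  have : (0 : ℝ) ≤ (n : ℝ) ^ k := by positivity
  nlinarith

theorem term_bound (n d p k K : ℕ) (hn : 0 < n) (hp : 2 ≤ p) (ε : ℝ)
    (hε' : ε * Real.log (64 * p) ≤ 1 / 64)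
    (hK : (K : ℝ) ≤ ε * n) (hk : 1 ≤ k) (hkK : k ≤ K) :
    ∃ m, m ≤ k * d ∧
      (n.choose k : ℝ) * p ^ k * ((p : ℝ)⁻¹ + m / n) ^ m ≤
        (Real.exp 1 * p * n * ((p : ℝ)⁻¹) ^ d) ^ k
        + (Real.exp 1 * p ^ 2 * d ^ 2 * (3 / 4) ^ d) ^ k + Real.exp (1 / 4 - n / 32) := by
  have hn' : (0 : ℝ) < n := by exact_mod_cast hn
  have hp2 : (2 : ℝ) ≤ p := by exact_mod_cast hp
  have hp0 : (0 : ℝ) < p := by linarith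
  have hk0 : (0 : ℝ) < k := by exact_mod_cast hk
  have hx : (0 : ℝ) ≤ (Real.exp 1 * p * n * ((p : ℝ)⁻¹) ^ d) ^ k := by positivity
  have hy : (0 : ℝ) ≤ (Real.exp 1 * p ^ 2 * d ^ 2 * (3 / 4) ^ d) ^ k := by positivity
  have hz := (Real.exp_pos (1 / 4 - n / 32 : ℝ)).le
  have hquarter : ∀ m : ℕ, 4 * m ≤ n → (p : ℝ)⁻¹ + m / n ≤ 3 / 4 := by
    intro m hm
    have h1 : (p : ℝ)⁻¹ ≤ 1 / 2 := by rw [inv_le_comm₀ hp0 (by norm_num)]; norm_num; exact hp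
    have h2 : (m : ℝ) / n ≤ 1 / 4 := by
      rw [div_le_iff₀ hn']
      have : (4 * m : ℝ) ≤ n := by exact_mod_cast hm
      linarith
    linarith
  by_cases c1 : p * k * d ^ 2 ≤ n
  · -- very small sets
    refine ⟨k * d, le_rfl, ?_⟩
    have c1' : (p * k * d ^ 2 : ℝ) ≤ n := by exact_mod_cast c1
    have h1 : ((p : ℝ)⁻¹ + (k * d : ℕ) / n) ^ (k * d) ≤ ((p : ℝ)⁻¹) ^ (k * d) * Real.exp k := by
      have e1 : (p : ℝ)⁻¹ + (k * d : ℕ) / n = (p : ℝ)⁻¹ * (p * k * d / n + 1) := by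
        push_cast; field_simp; ring
      rw [e1, mul_pow]
      gcongr
      calc _ ≤ (Real.exp (p * k * d / n)) ^ (k * d) := by
            gcongr; exact Real.add_one_le_exp _
        _ = Real.exp (k * ((p * k * d ^ 2) / n)) := by
            rw [← Real.exp_nat_mul]; congr 1; push_cast; ring
        _ ≤ _ := by
            rw [Real.exp_le_exp]
            have : (p * k * d ^ 2 : ℝ) / n ≤ 1 := by rw [div_le_one hn']; exact c1'
            nlinarith
    have h2 : (n.choose k : ℝ) ≤ (n : ℝ) ^ k := by exact_mod_cast Nat.choose_le_pow n k
    calc _ ≤ (n : ℝ) ^ k * p ^ k * (((p : ℝ)⁻¹) ^ (k * d) * Real.exp k) := by gcongr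
      _ = (Real.exp 1 * p * n * ((p : ℝ)⁻¹) ^ d) ^ k := by
        rw [mul_pow, mul_pow, mul_pow, ← Real.exp_nat_mul, mul_one, ← pow_mul, mul_comm d k]
        ring
      _ ≤ _ := by linarith
  · have c1' : (n : ℝ) ≤ p * k * d ^ 2 := by exact_mod_cast (not_le.1 c1).le
    by_cases c2 : 4 * (k * d) ≤ n
    · refine ⟨k * d, le_rfl, ?_⟩
      have h1 := hquarter _ c2
      have h2 := choose_div_bound n k hk
      have h3 : Real.exp 1 * n / k ≤ Real.exp 1 * (p * d ^ 2) := by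
        rw [mul_div_assoc]
        gcongr
        rw [div_le_iff₀ hk0]; linarith
      calc _ ≤ (Real.exp 1 * (p * d ^ 2)) ^ k * p ^ k * (3 / 4) ^ (k * d) := by
            gcongr
            refine h2.trans ?_
            gcongr
        _ = (Real.exp 1 * p ^ 2 * d ^ 2 * (3 / 4) ^ d) ^ k := by
            rw [mul_comm k d, pow_mul, ← mul_pow, ← mul_pow]; congr 1; ring
        _ ≤ _ := by linarith
    · refine ⟨n / 4, by omega, ?_⟩
      have h1 := hquarter (n / 4) (by omega)
      have hkK' : (k : ℝ) ≤ ε * n := le_trans (by exact_mod_cast hkK) hK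
      have h64 : (0 : ℝ) < 64 * p := by positivity
      have hlog : 0 ≤ Real.log (64 * p) := Real.log_nonneg (by linarith)
      have h2 : (n.choose k : ℝ) * p ^ k ≤ Real.exp (n / 32) := by
        calc _ ≤ 64 ^ k * Real.exp (n / 64) * (p : ℝ) ^ k := by
              gcongr; exact choose_exp_bound n k
          _ = (64 * p : ℝ) ^ k * Real.exp (n / 64) := by rw [mul_pow]; ring
          _ = Real.exp (k * Real.log (64 * p)) * Real.exp (n / 64) := by
              rw [Real.exp_nat_mul, Real.exp_log h64]
          _ = Real.exp (k * Real.log (64 * p) + n / 64) := by rw [Real.exp_add]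
          _ ≤ _ := by
              rw [Real.exp_le_exp]
              have : (k : ℝ) * Real.log (64 * p) ≤ ε * n * Real.log (64 * p) := by gcongr
              nlinarith
      have h3 : ((p : ℝ)⁻¹ + (n / 4 : ℕ) / n) ^ (n / 4) ≤ Real.exp (1 / 4 - n / 16) := by
        calc _ ≤ (Real.exp (-(1 / 4))) ^ (n / 4) := by
              gcongr
              have := Real.add_one_le_exp (-(1 / 4) : ℝ)
              linarith
          _ = Real.exp ((n / 4 : ℕ) * (-(1 / 4))) := by rw [← Real.exp_nat_mul]
          _ ≤ _ := by
              rw [Real.exp_le_exp]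
              have : (n : ℝ) ≤ 4 * (n / 4 : ℕ) + 4 := by
                exact_mod_cast (by omega : n ≤ 4 * (n / 4) + 4)
              linarith
      calc _ ≤ Real.exp (n / 32) * Real.exp (1 / 4 - n / 16) := by gcongr
        _ = Real.exp (1 / 4 - n / 32) := by rw [← Real.exp_add]; congr 1; ring
        _ ≤ _ := by linarith

theorem geom_bound (x : ℝ) (hx : 0 ≤ x) (hx2 : x ≤ 1 / 2) (n : ℕ) :
    ∑ k ∈ Finset.Icc 1 n, x ^ k ≤ 2 * x := by
  have : ∀ n : ℕ, ∑ k ∈ Finset.Icc 1 n, x ^ k ≤ 2 * x - 2 * (x ^ n * x) := by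
    intro n
    induction n with
    | zero => simp
    | succ n ih =>
      rw [Finset.sum_Icc_succ_top (by omega)]
      have h := pow_nonneg hx n
      rw [pow_succ]
      nlinarith [mul_nonneg h hx]
  have h := mul_nonneg (pow_nonneg hx n) hx
  linarith [this n]

theorem main_bound (n d p : ℕ) (hn : 0 < n) (hp : 2 ≤ p) (ε δ x y : ℝ) (hε : 0 < ε)
    (hε' : ε * Real.log (64 * p) ≤ 1 / 64) (hd : 3 ≤ ε ^ 2 * d) (hδ : 0 < δ)
    (hx : x = Real.exp 1 * p * n * ((p : ℝ)⁻¹) ^ d)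
    (hy : y = Real.exp 1 * p ^ 2 * d ^ 2 * (3 / 4) ^ d)
    (hx2 : x ≤ 1 / 2) (hy2 : y ≤ 1 / 2)
    (htot : 2 * (2 * x + 2 * y + n * Real.exp (1 / 4 - n / 32)) + δ * Real.exp (-n) ≤ δ / 10) :
    (0.9 : ℝ) ≤ (Nat.card {f : Om n d // cConfig p f < δ} : ℝ) / (Nat.card (Om n d) : ℝ) := by
  classical
  have hx0 : 0 ≤ x := by rw [hx]; positivity
  have hy0 : 0 ≤ y := by rw [hy]; positivity
  set K := ⌊ε * n⌋₊ with hKdef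
  have hK1 : (K : ℝ) ≤ ε * n := Nat.floor_le (by positivity)
  have hK2 : ε * n ≤ K + 1 := (Nat.lt_floor_add_one _).le
  set C : ℝ := (Fintype.card (Om n d) : ℝ) with hC
  have hC0 : 0 < C := by rw [hC]; exact_mod_cast Fintype.card_pos
  have hA : ∑ f : Om n d, smallSum p K f
      ≤ (2 * x + 2 * y + n * Real.exp (1 / 4 - n / 32)) * C := by
    have := exp_small (d := d) hn p (by omega) K
      (fun k => x ^ k + y ^ k + Real.exp (1 / 4 - n / 32))
      (fun k hk hkK _ => by
        rw [hx, hy]; exact term_bound n d p k K hn hp ε hε' hK1 hk hkK)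
      (fun k => by positivity)
    refine this.trans ?_
    gcongr
    rw [Finset.sum_add_distrib, Finset.sum_add_distrib, Finset.sum_const, nsmul_eq_mul,
      Nat.card_Icc]
    have h1 := geom_bound x hx0 hx2 n
    have h2 := geom_bound y hy0 hy2 n
    simp only [Nat.add_sub_cancel]
    linarith
  have hB : ∑ f : Om n d, smallSum p K f.symm = ∑ f : Om n d, smallSum p K f := by
    let e : Om n d ≃ Om n d := ⟨Equiv.symm, Equiv.symm, fun f => rfl, fun f => rfl⟩
    exact Equiv.sum_comp e (fun f => smallSum p K f)
  have hR := exp_rectSum (d := d) hn ε hε K hK2 hd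
  rw [← hC] at hR
  set X : Om n d → ℝ := fun f => smallSum p K f + smallSum p K f.symm + δ * rectSum K f with hX
  have hEX : ∑ f, X f ≤ δ / 10 * C := by
    rw [hX]
    simp only
    rw [Finset.sum_add_distrib, Finset.sum_add_distrib, ← Finset.mul_sum, hB]
    have := mul_le_mul_of_nonneg_right htot hC0.le
    nlinarith
  have hs0 : ∀ f : Om n d, 0 ≤ smallSum p K f := fun f => by
    unfold smallSum; positivity
  have hr0 : ∀ f : Om n d, 0 ≤ rectSum K f := fun f => by
    unfold rectSum; positivity
  have hbad : ∀ f : Om n d, ¬ cConfig p f < δ → δ ≤ X f := by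
    intro f hf
    rw [not_lt] at hf
    have h1 := hs0 f
    have h2 := hs0 f.symm
    have h3 := hr0 f
    simp only [hX]
    by_cases h : rectSum K f < 1
    · have := c_le (p := p) (by omega) K f h
      nlinarith
    · nlinarith [not_lt.1 h]
  have hX0 : ∀ f, 0 ≤ X f := fun f => by
    have h1 := hs0 f
    have h2 := hs0 f.symm
    have h3 := hr0 f
    simp only [hX]; positivity
  have hmarkov : δ * ((Finset.univ.filter fun f : Om n d => ¬ cConfig p f < δ).card : ℝ)
      ≤ δ / 10 * C := by
    refine le_trans ?_ hEX
    rw [mul_comm, ← nsmul_eq_mul, ← Finset.sum_const]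
    refine (Finset.sum_le_sum fun f hf => hbad f (Finset.mem_filter.1 hf).2).trans ?_
    exact Finset.sum_le_sum_of_subset_of_nonneg (Finset.subset_univ _) (fun f _ _ => hX0 f)
  have hsplit : ((Finset.univ.filter fun f : Om n d => cConfig p f < δ).card : ℝ)
      + ((Finset.univ.filter fun f : Om n d => ¬ cConfig p f < δ).card : ℝ) = C := by
    rw [hC]
    exact_mod_cast Finset.card_filter_add_card_filter_not
      (s := (Finset.univ : Finset (Om n d))) (fun f => cConfig p f < δ)
  rw [Nat.card_eq_fintype_card, Nat.card_eq_fintype_card, ← hC, Fintype.card_subtype,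
    le_div_iff₀ hC0]
  have h10 : ((Finset.univ.filter fun f : Om n d => ¬ cConfig p f < δ).card : ℝ) ≤ C / 10 := by
    refine le_of_mul_le_mul_left ?_ hδ
    linarith
  linarith

/-- **Theorem 5.2**: for positive integers `t_n` with `t_n < log_p n + log log n`
(for large `n`) and `t_n - log_p n → ∞`, if `f_n` is uniformly random in
`Ω_{A_n, B_n, t_n}` and `G_n = φ(f_n)`, then for every `δ > 0` there is `n₀` with
`P(c(G_n) < δ) ≥ 0.9` for all `n ≥ n₀`. -/
theorem statement13 (p : ℕ) (hp : p.Prime)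
    (t : ℕ → ℕ) (htpos : ∀ n, 1 ≤ n → 1 ≤ t n)
    (hub : ∀ᶠ n : ℕ in atTop,
      (t n : ℝ) < Real.log n / Real.log p + Real.log (Real.log n))
    (hdiv : Tendsto (fun n : ℕ => (t n : ℝ) - Real.log n / Real.log p) atTop atTop) :
    ∀ δ : ℝ, 0 < δ → ∃ n₀ : ℕ, ∀ n, n₀ ≤ n →
      (0.9 : ℝ) ≤
        (Nat.card {f : (Fin n × Fin (t n)) ≃ (Fin n × Fin (t n)) // cConfig p f < δ} : ℝ) /
          (Nat.card ((Fin n × Fin (t n)) ≃ (Fin n × Fin (t n))) : ℝ) := by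
  intro δ hδ
  have hp2 : (2 : ℝ) ≤ p := by exact_mod_cast hp.two_le
  have hp0 : (0 : ℝ) < p := by linarith
  have hL : 0 < Real.log p := Real.log_pos (by linarith)
  have h64 : 0 < Real.log (64 * p) := Real.log_pos (by linarith)
  set ε : ℝ := 1 / 64 / Real.log (64 * p) with hε
  have hε0 : 0 < ε := by positivity
  have hε' : ε * Real.log (64 * p) ≤ 1 / 64 := by rw [hε]; field_simp; exact le_rfl
  -- `t n → ∞`
  have ht : Tendsto (fun n => (t n : ℝ)) atTop atTop := by
    refine tendsto_atTop_mono (fun n => ?_) hdiv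
    have : 0 ≤ Real.log n / Real.log p := div_nonneg (Real.log_natCast_nonneg n) hL.le
    linarith
  have htN : Tendsto t atTop atTop := tendsto_natCast_atTop_iff.1 ht
  have hxlim : Tendsto (fun n : ℕ => Real.exp 1 * p * n * ((p : ℝ)⁻¹) ^ (t n)) atTop (nhds 0) := by
    have h1 : Tendsto (fun n : ℕ => Real.exp 1 * p *
        Real.exp (-(((t n : ℝ) - Real.log n / Real.log p) * Real.log p))) atTop (nhds 0) := by
      have := (Real.tendsto_exp_neg_atTop_nhds_zero.comp
        (hdiv.atTop_mul_const hL)).const_mul (Real.exp 1 * p)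
      simpa [Function.comp_def] using this
    refine h1.congr' ?_
    filter_upwards [eventually_gt_atTop 0] with n hn
    have hn' : (0 : ℝ) < n := by exact_mod_cast hn
    have : -(((t n : ℝ) - Real.log n / Real.log p) * Real.log p)
        = Real.log n + (t n : ℝ) * (-Real.log p) := by
      field_simp; ring
    rw [this, Real.exp_add, Real.exp_log hn', Real.exp_nat_mul, Real.exp_neg, Real.exp_log hp0]
    ring
  have hylim : Tendsto (fun n : ℕ => Real.exp 1 * p ^ 2 * (t n : ℝ) ^ 2 * (3 / 4) ^ (t n))
      atTop (nhds 0) := by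
    have h := (tendsto_pow_const_mul_const_pow_of_lt_one 2 (r := (3 / 4 : ℝ)) (by norm_num)
      (by norm_num)).const_mul (Real.exp 1 * p ^ 2)
    rw [mul_zero] at h
    refine (h.comp htN).congr fun n => ?_
    simp only [Function.comp]; ring
  have hzlim : Tendsto (fun n : ℕ => (n : ℝ) * Real.exp (1 / 4 - n / 32)) atTop (nhds 0) := by
    have h1 : Tendsto (fun n : ℕ => (n : ℝ) / 32) atTop atTop :=
      tendsto_natCast_atTop_atTop.atTop_div_const (by norm_num)
    have h := ((Real.tendsto_pow_mul_exp_neg_atTop_nhds_zero 1).comp h1).const_mul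
      (32 * Real.exp (1 / 4))
    rw [mul_zero] at h
    refine h.congr fun n => ?_
    simp only [Function.comp, pow_one]
    rw [sub_eq_add_neg, Real.exp_add]; ring
  have hrlim : Tendsto (fun n : ℕ => δ * Real.exp (-(n : ℝ))) atTop (nhds 0) := by
    have h := (Real.tendsto_exp_neg_atTop_nhds_zero.comp
      (tendsto_natCast_atTop_atTop (R := ℝ))).const_mul δ
    rw [mul_zero] at h
    exact h
  have htot : Tendsto (fun n : ℕ =>
      2 * (2 * (Real.exp 1 * p * n * ((p : ℝ)⁻¹) ^ (t n))
        + 2 * (Real.exp 1 * p ^ 2 * (t n : ℝ) ^ 2 * (3 / 4) ^ (t n))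
        + (n : ℝ) * Real.exp (1 / 4 - n / 32)) + δ * Real.exp (-(n : ℝ))) atTop (nhds 0) := by
    have := ((((hxlim.const_mul 2).add (hylim.const_mul 2)).add hzlim).const_mul 2).add hrlim
    simpa using this
  have hev : ∀ᶠ n : ℕ in atTop, (0.9 : ℝ) ≤
        (Nat.card {f : (Fin n × Fin (t n)) ≃ (Fin n × Fin (t n)) // cConfig p f < δ} : ℝ) /
          (Nat.card ((Fin n × Fin (t n)) ≃ (Fin n × Fin (t n))) : ℝ) := by
    filter_upwards [eventually_gt_atTop 0, hxlim.eventually_le_const (by norm_num : (0 : ℝ) < 1 / 2),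
      hylim.eventually_le_const (by norm_num : (0 : ℝ) < 1 / 2),
      htot.eventually_le_const (by positivity : (0 : ℝ) < δ / 10),
      ht.eventually_ge_atTop (3 / ε ^ 2)] with n hn h1 h2 h3 h4
    refine main_bound n (t n) p hn hp.two_le ε δ _ _ hε0 hε' ?_ hδ rfl rfl h1 h2 h3
    rw [div_le_iff₀ (by positivity)] at h4
    linarith
  exact eventually_atTop.1 hev
end

section
/- Let a ≥ 2 be an integer and R = Z/aZ. Let M_n be an ε-balanced random n×n matrix over R having k-step stairs of 0 with respect to α_n^{(i)} and β_n^{(i)}. If lim_{n→∞} (n − α_n^{(i)} − β_n^{(i)}) = ∞ for every 1 ≤ i ≤ k, then for every finite abelian group G whose exponent divides a, lim_{n→∞} E(#Sur(cok(M_n), G)) = 1, where #Sur(cok(M_n), G) is the number of surjective group homomorphisms from cok(M_n) onto G. -/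
open MeasureTheory Filter
open scoped Classical

instance zmodMeasurableSpace {a : ℕ} : MeasurableSpace (ZMod a) := ⊤

/-- A distribution `ν` on `R = ℤ/aℤ` is `ε`-balanced if for every maximal ideal `P` of `R`
and every `r ∈ R/P`, `P(ξ ≡ r (mod P)) ≤ 1 - ε`. -/
def IsEpsBalanced {a : ℕ} (ε : ℝ) (ν : Measure (ZMod a)) : Prop :=
  ∀ P : Ideal (ZMod a), P.IsMaximal →
    ∀ r : ZMod a ⧸ P, ν {x | Ideal.Quotient.mk P x = r} ≤ ENNReal.ofReal (1 - ε)

/-- The law of a random `n × n` matrix over `ℤ/aℤ` having `k`-step stairs of `0` with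
respect to `α^{(l)} = α l` and `β^{(l)} = β l`: the entries `(i, j)` with `1 ≤ i ≤ α^{(l)}`
and `1 ≤ j ≤ β^{(l)}` for some `1 ≤ l ≤ k` are `0`, and the remaining entries are
independent with distributions `ν (i, j)`. -/
noncomputable def stairsLaw {a : ℕ} {n : ℕ}
    (ν : Fin n × Fin n → Measure (ZMod a)) (k : ℕ) (α β : ℕ → ℕ) :
    Measure (Fin n → Fin n → ZMod a) :=
  (Measure.pi ν).map fun ω i j =>
    if ∃ l ∈ Finset.Icc 1 k, (i : ℕ) < α l ∧ (j : ℕ) < β l then 0 else ω (i, j)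

/-- The cokernel `R^n / M R^n` of the matrix with entries `g` over `R = ℤ/aℤ`. -/
abbrev cok {a : ℕ} {n : ℕ} (g : Fin n → Fin n → ZMod a) : Type :=
  (Fin n → ZMod a) ⧸ LinearMap.range (Matrix.of g).mulVecLin

/-- The number of surjective homomorphisms from `cok g` onto `G`. -/
noncomputable def nSur {a : ℕ} {n : ℕ} (g : Fin n → Fin n → ZMod a)
    (G : Type) [AddCommGroup G] : ℕ :=
  Nat.card {f : cok g →+ G // Function.Surjective f}


namespace St17

set_option linter.unusedSectionVars false

variable {G : Type} [AddCommGroup G] [Fintype G]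

/-- The weight of a pair. -/
noncomputable def w (δ : ℝ) (g : G) (χ : AddChar G ℂ) : ℝ := if χ g = 1 then 1 else δ

lemma w_nonneg {δ : ℝ} (h : 0 < δ) (g : G) (χ : AddChar G ℂ) : 0 ≤ w δ g χ := by
  unfold w; split_ifs <;> linarith

lemma w_le_one {δ : ℝ} (h : δ < 1) (g : G) (χ : AddChar G ℂ) : w δ g χ ≤ 1 := by
  unfold w; split_ifs <;> linarith

noncomputable def cntC {b : ℕ} (χ : Fin b → AddChar G ℂ) (g : G) : ℕ :=
  (Finset.univ.filter fun j => χ j g ≠ 1).card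

noncomputable def cntR {b : ℕ} (f : Fin b → G) (ψ : AddChar G ℂ) : ℕ :=
  (Finset.univ.filter fun j => ψ (f j) ≠ 1).card

noncomputable def perp (H : AddSubgroup G) : Finset (AddChar G ℂ) :=
  Finset.univ.filter fun χ => ∀ h ∈ H, χ h = 1

lemma mem_perp {H : AddSubgroup G} {χ : AddChar G ℂ} : χ ∈ perp H ↔ ∀ h ∈ H, χ h = 1 := by
  simp [perp]

lemma card_perp (H : AddSubgroup G) :
    (Nat.card H : ℝ) * ((perp H).card : ℝ) = (Fintype.card G : ℝ) := by
  have h1 : ∑ χ : AddChar G ℂ, ∑ h : H, χ (h : G) = (Nat.card H : ℂ) * ((perp H).card : ℂ) := by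
    have : ∀ χ : AddChar G ℂ, ∑ h : H, χ (h : G) = if χ ∈ perp H then (Nat.card H : ℂ) else 0 := by
      intro χ
      have := AddChar.sum_eq_ite (χ.compAddMonoidHom H.subtype)
      simp only [AddChar.compAddMonoidHom_apply, AddSubgroup.subtype_apply] at this
      rw [this]
      have h2 : (χ.compAddMonoidHom H.subtype = 0) ↔ χ ∈ perp H := by
        rw [mem_perp, DFunLike.ext_iff]
        simp
      simp [h2]
    rw [Finset.sum_congr rfl fun χ _ => this χ]
    rw [← Finset.sum_filter]
    simp [mul_comm]
  have h2 : ∑ χ : AddChar G ℂ, ∑ h : H, χ (h : G) = (Fintype.card G : ℂ) := by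
    rw [Finset.sum_comm]
    simp_rw [AddChar.sum_apply_eq_ite]
    simp
  have h3 := h1.symm.trans h2
  exact_mod_cast h3

lemma prod_w {b : ℕ} (δ : ℝ) (χ : Fin b → AddChar G ℂ) (g : G) :
    ∏ j, w δ g (χ j) = δ ^ (cntC χ g) := by
  simp [w, cntC, Finset.prod_ite]

noncomputable def Phi {b : ℕ} (δ : ℝ) (χ : Fin b → AddChar G ℂ) : ℝ := ∑ g : G, ∏ j, w δ g (χ j)

lemma sum_f {b : ℕ} (δ : ℝ) (χ : Fin b → AddChar G ℂ) :
    ∑ f : Fin b → G, ∏ i, ∏ j, w δ (f i) (χ j) = Phi δ χ ^ b := by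
  rw [Phi, Fintype.sum_pow]

lemma exists_H {b : ℕ} (κ : ℝ) (hκ : 0 ≤ κ) (χ : Fin b → AddChar G ℂ) :
    ∃ H : AddSubgroup G, (∀ g, g ∉ H → κ * b ≤ cntC χ g) ∧
      (((Finset.univ.filter fun j => χ j ∉ perp H).card : ℝ) ≤ Fintype.card G * (κ * b)) := by
  set S : Finset G := Finset.univ.filter fun g => (cntC χ g : ℝ) < κ * b with hS
  refine ⟨AddSubgroup.closure (S : Set G), ?_, ?_⟩
  · intro g hg
    by_contra hlt
    exact hg (AddSubgroup.subset_closure (by simpa [hS] using hlt))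
  · have hsub : (Finset.univ.filter fun j => χ j ∉ perp (AddSubgroup.closure (S : Set G))) ⊆
        S.biUnion fun g => Finset.univ.filter fun j => χ j g ≠ 1 := by
      intro j hj
      simp only [Finset.mem_filter, Finset.mem_univ, true_and, Finset.mem_biUnion] at hj ⊢
      by_contra hcon
      push Not at hcon
      apply hj
      rw [mem_perp]
      intro h hh
      induction hh using AddSubgroup.closure_induction with
      | mem x hx => exact hcon x hx
      | zero => simp
      | add x y _ _ hx hy => rw [AddChar.map_add_eq_mul, hx, hy, one_mul]
      | neg x _ hx => rw [AddChar.map_neg_eq_inv, hx, inv_one]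
    calc (((Finset.univ.filter fun j => χ j ∉ perp (AddSubgroup.closure (S : Set G))).card : ℕ) : ℝ)
        ≤ ((∑ g ∈ S, cntC χ g : ℕ) : ℝ) := by
          exact_mod_cast (Finset.card_le_card hsub).trans Finset.card_biUnion_le
      _ = ∑ g ∈ S, (cntC χ g : ℝ) := by push_cast; rfl
      _ ≤ ∑ g ∈ S, κ * b := Finset.sum_le_sum fun g hg => by
          simp only [hS, Finset.mem_filter] at hg; exact hg.2.le
      _ = S.card * (κ * b) := by simp
      _ ≤ Fintype.card G * (κ * b) := by
          gcongr
          exact Finset.card_le_univ S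

def Good {b : ℕ} (κ : ℝ) (f : Fin b → G) (χ : Fin b → AddChar G ℂ) : Prop :=
  ∃ H : AddSubgroup G, (∀ i, f i ∈ H) ∧ (∀ j, χ j ∈ perp H) ∧ (∀ g, g ∉ H → κ * b ≤ cntC χ g) ∧
    (∀ ψ, ψ ∉ perp H → κ * b ≤ cntR f ψ)

noncomputable def badSum (G : Type) [AddCommGroup G] [Fintype G] (δ κ : ℝ) (b : ℕ) : ℝ :=
  ∑ χ : Fin b → AddChar G ℂ, ∑ f : Fin b → G,
    if Good κ f χ then 0 else ∏ i, ∏ j, w δ (f i) (χ j)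

lemma pow_cnt_le {δ κ : ℝ} (h0 : 0 < δ) (h1 : δ < 1) {b c : ℕ} (h : κ * b ≤ c) :
    δ ^ c ≤ (δ ^ κ) ^ b := by
  rw [← Real.rpow_natCast δ c, ← Real.rpow_mul_natCast h0.le]
  exact Real.rpow_le_rpow_of_exponent_ge h0 h1.le h

lemma sum_mem_one (H : AddSubgroup G) : ∑ g : G, (if g ∈ H then (1:ℝ) else 0) = Nat.card H := by
  rw [Finset.sum_boole, Nat.card_eq_fintype_card, Fintype.card_subtype]

lemma card_H_pos (H : AddSubgroup G) : (1:ℝ) ≤ Nat.card H := by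
  exact_mod_cast Nat.card_pos

lemma card_H_le (H : AddSubgroup G) : (Nat.card H : ℝ) ≤ Fintype.card G := by
  rw [← Nat.card_eq_fintype_card]
  exact_mod_cast Nat.card_le_card_of_injective _ H.subtype_injective

lemma Phi_nonneg {b : ℕ} {δ : ℝ} (h0 : 0 < δ) (χ : Fin b → AddChar G ℂ) : 0 ≤ Phi δ χ :=
  Finset.sum_nonneg fun _ _ => Finset.prod_nonneg fun _ _ => w_nonneg h0 _ _

lemma Phi_le {b : ℕ} {δ κ : ℝ} (h0 : 0 < δ) (h1 : δ < 1) (χ : Fin b → AddChar G ℂ)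
    (H : AddSubgroup G) (hH : ∀ g, g ∉ H → κ * b ≤ cntC χ g) :
    Phi δ χ ≤ Nat.card H * (1 + Fintype.card G * (δ ^ κ) ^ b) := by
  have hq : 0 ≤ (δ ^ κ) ^ b := pow_nonneg (Real.rpow_nonneg h0.le _) _
  have : Phi δ χ ≤ ∑ g : G, ((if g ∈ H then (1:ℝ) else 0) + (δ ^ κ) ^ b) := by
    refine Finset.sum_le_sum fun g _ => ?_
    split_ifs with hg
    · have := Finset.prod_le_one (s := Finset.univ) (fun j _ => w_nonneg h0 g (χ j))
        (fun j _ => w_le_one h1 g (χ j))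
      linarith
    · rw [prod_w, zero_add]; exact pow_cnt_le h0 h1 (hH g hg)
  rw [Finset.sum_add_distrib, sum_mem_one] at this
  simp only [Finset.sum_const, Finset.card_univ, nsmul_eq_mul] at this
  have h2 := card_H_pos H
  have : 0 ≤ ((Nat.card H : ℝ) - 1) * (Fintype.card G * (δ ^ κ) ^ b) := by
    apply mul_nonneg <;> [linarith; positivity]
  linarith

lemma Phi_le' {b : ℕ} {δ κ : ℝ} (h0 : 0 < δ) (h1 : δ < 1) (χ : Fin b → AddChar G ℂ)
    (H : AddSubgroup G) (hH : ∀ g, g ∉ H → κ * b ≤ cntC χ g) (hr : ∃ j, χ j ∉ perp H) :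
    Phi δ χ ≤ Nat.card H * (1 - (1 - δ) / Fintype.card G + Fintype.card G * (δ ^ κ) ^ b) := by
  have hq : 0 ≤ (δ ^ κ) ^ b := pow_nonneg (Real.rpow_nonneg h0.le _) _
  obtain ⟨j0, hj0⟩ := hr
  rw [mem_perp] at hj0
  push Not at hj0
  obtain ⟨g0, hg0, hne⟩ := hj0
  have : Phi δ χ ≤ ∑ g : G, ((if g ∈ H then (1:ℝ) else 0) + (δ ^ κ) ^ b
      - if g = g0 then (1 - δ) else 0) := by
    refine Finset.sum_le_sum fun g _ => ?_
    by_cases hgg : g = g0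
    · subst hgg
      rw [if_pos hg0, if_pos rfl, prod_w]
      have : δ ^ (cntC χ g) ≤ δ ^ 1 := by
        apply pow_le_pow_of_le_one h0.le h1.le
        apply Finset.card_pos.mpr
        exact ⟨j0, by simpa using hne⟩
      linarith
    rw [if_neg hgg, sub_zero]
    split_ifs with hg
    · have := Finset.prod_le_one (s := Finset.univ) (fun j _ => w_nonneg h0 g (χ j))
        (fun j _ => w_le_one h1 g (χ j))
      linarith
    · rw [prod_w, zero_add]; exact pow_cnt_le h0 h1 (hH g hg)
  rw [Finset.sum_sub_distrib, Finset.sum_add_distrib, sum_mem_one] at this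
  simp only [Finset.sum_const, Finset.card_univ, nsmul_eq_mul, Finset.sum_ite_eq',
    Finset.mem_univ, if_true] at this
  have h2 := card_H_pos H
  have h3 := card_H_le H
  have h4 : (Nat.card H : ℝ) * ((1 - δ) / Fintype.card G) ≤ 1 - δ := by
    rw [mul_div_assoc', div_le_iff₀ (by linarith), mul_comm]
    apply mul_le_mul_of_nonneg_left h3; linarith
  have : 0 ≤ ((Nat.card H : ℝ) - 1) * (Fintype.card G * (δ ^ κ) ^ b) := by
    apply mul_nonneg <;> [linarith; positivity]
  linarith

/-- Chernoff bound. -/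
lemma chernoff {T : Type} [Fintype T] (b : ℕ) (S : T → Prop) (Q : T → Prop) (t x : ℝ) (ht : 1 ≤ t) :
    ((Finset.univ.filter fun f : Fin b → T => (∀ i, Q (f i)) ∧
        ((Finset.univ.filter fun i => S (f i)).card : ℝ) ≤ x * b).card : ℝ) ≤
      (t ^ x * ∑ a : T, if Q a then (if S a then t⁻¹ else 1) else 0) ^ b := by
  have ht0 : 0 < t := by linarith
  rw [mul_pow, Fintype.sum_pow, Finset.mul_sum, Finset.card_filter, Nat.cast_sum]
  refine Finset.sum_le_sum fun f _ => ?_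
  split_ifs with h
  · have : ∏ i, (if Q (f i) then (if S (f i) then t⁻¹ else (1:ℝ)) else 0) =
        t⁻¹ ^ (Finset.univ.filter fun i => S (f i)).card := by
      rw [Finset.prod_congr rfl fun i _ => if_pos (h.1 i)]
      simp [Finset.prod_ite]
    rw [this, inv_pow, ← Real.rpow_mul_natCast ht0.le, ← Real.rpow_natCast,
      ← div_eq_mul_inv, ← Real.rpow_sub ht0]
    have := Real.one_le_rpow ht (sub_nonneg.mpr h.2)
    simpa using this
  · simp only [Nat.cast_zero]
    apply mul_nonneg (by positivity)
    apply Finset.prod_nonneg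
    intro i _
    split_ifs <;> positivity

lemma chi_count {b : ℕ} (H : AddSubgroup G) (t κ : ℝ) (ht : 1 ≤ t) :
    ((Finset.univ.filter fun χ : Fin b → AddChar G ℂ =>
      ((Finset.univ.filter fun j => χ j ∉ perp H).card : ℝ) ≤ Fintype.card G * (κ * b)).card : ℝ) ≤
    (t ^ (Fintype.card G * κ) * ((perp H).card * (1 + Fintype.card G / t))) ^ b := by
  have h := chernoff b (fun ψ : AddChar G ℂ => ψ ∉ perp H) (fun _ => True) t
    (Fintype.card G * κ) ht
  have ht0 : 0 < t := by linarith
  have hp : (1:ℝ) ≤ (perp H).card := by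
    have : 0 < (perp H).card := Finset.card_pos.mpr ⟨0, by simp [mem_perp]⟩
    exact_mod_cast this
  simp only [true_and, implies_true, if_true, mul_assoc] at h
  refine le_trans (le_of_eq (by congr!)) (h.trans ?_)
  have hs : (∑ a : AddChar G ℂ, if a ∉ perp H then t⁻¹ else (1:ℝ)) ≤
      (perp H).card * (1 + Fintype.card G / t) := by
    calc (∑ a : AddChar G ℂ, if a ∉ perp H then t⁻¹ else (1:ℝ))
        ≤ ∑ a : AddChar G ℂ, ((if a ∈ perp H then 1 else 0) + t⁻¹) := by
          refine Finset.sum_le_sum fun a _ => ?_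
          have : 0 < t⁻¹ := by positivity
          by_cases ha : a ∈ perp H <;> simp [ha]; linarith
      _ = (perp H).card + Fintype.card G / t := by
          rw [Finset.sum_add_distrib, Finset.sum_boole]
          simp [div_eq_mul_inv]
      _ ≤ _ := by
          have : 0 ≤ (((perp H).card : ℝ) - 1) * (Fintype.card G / t) := by
            apply mul_nonneg <;> [linarith; positivity]
          linarith
  apply pow_le_pow_left₀
  · apply mul_nonneg (by positivity)
    apply Finset.sum_nonneg; intro a _; split_ifs <;> positivity
  · refine mul_le_mul_of_nonneg_left (le_trans (le_of_eq (by congr!)) hs) (by positivity)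

lemma half_H (H : AddSubgroup G) (ψ : AddChar G ℂ) (hψ : ψ ∉ perp H) :
    (∑ a : G, if a ∈ H then (if ψ a ≠ 1 then (2:ℝ)⁻¹ else 1) else 0) ≤ Nat.card H * (3/4) := by
  rw [mem_perp] at hψ
  push Not at hψ
  obtain ⟨h0, hh0, hne⟩ := hψ
  set F : G → ℝ := fun a => if a ∈ H then (if ψ a ≠ 1 then (2:ℝ)⁻¹ else 1) else 0
  have h1 : ∑ a, F a = ∑ a, F (a + h0) := (Equiv.sum_comp (Equiv.addRight h0) F).symm
  have h2 : ∑ a, (F a + F (a + h0)) ≤ ∑ a : G, (3/2) * (if a ∈ H then (1:ℝ) else 0) := by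
    refine Finset.sum_le_sum fun a _ => ?_
    simp only [F, H.add_mem_cancel_right hh0]
    by_cases ha : a ∈ H
    · simp only [ha, if_true]
      by_cases hψa : ψ a = 1
      · have : ψ (a + h0) ≠ 1 := by rw [AddChar.map_add_eq_mul, hψa, one_mul]; exact hne
        simp [hψa, this]; norm_num
      · simp only [ne_eq, hψa, not_false_eq_true, if_true]
        split_ifs <;> norm_num
    · simp [ha]
  rw [Finset.sum_add_distrib, ← h1, ← Finset.mul_sum, sum_mem_one] at h2
  linarith

lemma nonrobust {b : ℕ} (H : AddSubgroup G) (κ : ℝ) (ψ : AddChar G ℂ) (hψ : ψ ∉ perp H) :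
    ((Finset.univ.filter fun f : Fin b → G => (∀ i, f i ∈ H) ∧ (cntR f ψ : ℝ) ≤ κ * b).card : ℝ) ≤
      (2 ^ κ * (3/4) * Nat.card H) ^ b := by
  have h := chernoff b (fun a : G => ψ a ≠ 1) (fun a => a ∈ H) 2 κ (by norm_num)
  refine le_trans ?_ (h.trans (pow_le_pow_left₀ ?_ ?_ b))
  · exact le_of_eq (by unfold cntR; congr!)
  · apply mul_nonneg (by positivity)
    apply Finset.sum_nonneg; intro a _; split_ifs <;> positivity
  · rw [mul_assoc, mul_comm (3/4 : ℝ)]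
    gcongr
    exact le_trans (le_of_eq (by congr!)) (half_H H ψ hψ)

end St17

namespace St17

variable {G : Type} [AddCommGroup G] [Fintype G]

lemma prodw_nonneg {b : ℕ} {δ : ℝ} (h0 : 0 < δ) (f : Fin b → G) (χ : Fin b → AddChar G ℂ) :
    0 ≤ ∏ i, ∏ j, w δ (f i) (χ j) :=
  Finset.prod_nonneg fun _ _ => Finset.prod_nonneg fun _ _ => w_nonneg h0 _ _

noncomputable def badT {b : ℕ} (δ κ : ℝ) (χ : Fin b → AddChar G ℂ) : ℝ :=
  ∑ f : Fin b → G, if Good κ f χ then 0 else ∏ i, ∏ j, w δ (f i) (χ j)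

lemma badT_nonneg {b : ℕ} {δ κ : ℝ} (h0 : 0 < δ) (χ : Fin b → AddChar G ℂ) : 0 ≤ badT δ κ χ := by
  apply Finset.sum_nonneg
  intro f _
  split_ifs
  · exact le_rfl
  · exact prodw_nonneg h0 _ _

lemma badT_le_A {b : ℕ} {δ κ : ℝ} (h0 : 0 < δ) (h1 : δ < 1) (χ : Fin b → AddChar G ℂ)
    (H : AddSubgroup G) (hH : ∀ g, g ∉ H → κ * b ≤ cntC χ g) (hr : ∃ j, χ j ∉ perp H) :
    badT δ κ χ ≤
      (Nat.card H * (1 - (1 - δ) / Fintype.card G + Fintype.card G * (δ ^ κ) ^ b)) ^ b := by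
  refine le_trans ?_ (pow_le_pow_left₀ (Phi_nonneg h0 χ) (Phi_le' h0 h1 χ H hH hr) b)
  rw [← sum_f]
  refine Finset.sum_le_sum fun f _ => ?_
  split_ifs
  · exact prodw_nonneg h0 _ _
  · exact le_rfl

lemma badT_le_B {b : ℕ} {δ κ : ℝ} (h0 : 0 < δ) (h1 : δ < 1) (χ : Fin b → AddChar G ℂ)
    (H : AddSubgroup G) (hH : ∀ g, g ∉ H → κ * b ≤ cntC χ g) (hr : ∀ j, χ j ∈ perp H) :
    badT δ κ χ ≤
      (Nat.card H : ℝ) ^ b * ((1 + Fintype.card G * (δ ^ κ) ^ b) ^ b - 1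
        + Fintype.card G * (2 ^ κ * (3/4)) ^ b) := by
  have hsum : badT δ κ χ ≤ ∑ f : Fin b → G, ((∏ i, ∏ j, w δ (f i) (χ j))
      - (if ∀ i, f i ∈ H then 1 else 0)
      + ∑ ψ : AddChar G ℂ, if ψ ∉ perp H ∧ (∀ i, f i ∈ H) ∧ (cntR f ψ : ℝ) ≤ κ * b
          then (1:ℝ) else 0) := by
    refine Finset.sum_le_sum fun f _ => ?_
    have hnn : ∀ ψ : AddChar G ℂ, (0:ℝ) ≤ if ψ ∉ perp H ∧ (∀ i, f i ∈ H) ∧ (cntR f ψ : ℝ) ≤ κ * b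
          then (1:ℝ) else 0 := by intro ψ; split_ifs <;> norm_num
    have hs := Finset.sum_nonneg (s := Finset.univ) fun ψ _ => hnn ψ
    by_cases hf : ∀ i, f i ∈ H
    · have hone : ∏ i, ∏ j, w δ (f i) (χ j) = 1 := by
        apply Finset.prod_eq_one; intro i _
        apply Finset.prod_eq_one; intro j _
        rw [w, if_pos]
        exact mem_perp.1 (hr j) _ (hf i)
      rw [if_pos hf, hone]
      split_ifs with hg
      · linarith
      · have : ∃ ψ, ψ ∉ perp H ∧ (cntR f ψ : ℝ) < κ * b := by
          by_contra hcon
          push Not at hcon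
          exact hg ⟨H, hf, hr, hH, hcon⟩
        obtain ⟨ψ, hψ, hc⟩ := this
        have := Finset.single_le_sum (fun ψ _ => hnn ψ) (Finset.mem_univ ψ)
        rw [if_pos ⟨hψ, hf, hc.le⟩] at this
        linarith
    · rw [if_neg hf]
      have := prodw_nonneg h0 f χ
      split_ifs <;> linarith
  refine hsum.trans ?_
  rw [Finset.sum_add_distrib, Finset.sum_sub_distrib, sum_f, Finset.sum_comm]
  have e1 : ∑ f : Fin b → G, (if ∀ i, f i ∈ H then (1:ℝ) else 0) = (Nat.card H : ℝ) ^ b := by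
    rw [← sum_mem_one, Fintype.sum_pow]
    refine Finset.sum_congr rfl fun f _ => ?_
    rw [Finset.prod_boole]
    simp
  have e2 : ∑ ψ : AddChar G ℂ, ∑ f : Fin b → G,
      (if ψ ∉ perp H ∧ (∀ i, f i ∈ H) ∧ (cntR f ψ : ℝ) ≤ κ * b then (1:ℝ) else 0) ≤
      ∑ ψ : AddChar G ℂ, ((2:ℝ) ^ κ * (3/4) * (Nat.card H : ℝ)) ^ b := by
    refine Finset.sum_le_sum fun ψ _ => ?_
    by_cases hψ : ψ ∈ perp H
    · simp only [hψ, not_true_eq_false, false_and, if_false, Finset.sum_const_zero]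
      positivity
    · simp only [hψ, not_false_eq_true, true_and]
      rw [Finset.sum_boole]
      exact le_trans (le_of_eq (by congr!)) (nonrobust H κ ψ hψ)
  have e3 := pow_le_pow_left₀ (Phi_nonneg h0 χ) (Phi_le h0 h1 χ H hH) b
  rw [mul_pow] at e3
  simp only [Finset.sum_const, Finset.card_univ, AddChar.card_eq, nsmul_eq_mul] at e2
  rw [mul_pow] at e2
  rw [e1]
  linarith

noncomputable def Eb (g δ κ t : ℝ) (b : ℕ) : ℝ :=
  (t ^ (g * κ) * (1 + g / t) * (1 - (1 - δ) / g + g * (δ ^ κ) ^ b)) ^ b +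
    ((1 + g * (δ ^ κ) ^ b) ^ b - 1 + g * (2 ^ κ * (3/4)) ^ b)

lemma badSum_le {δ κ t : ℝ} (h0 : 0 < δ) (h1 : δ < 1) (hκ : 0 ≤ κ) (ht : 1 ≤ t) (b : ℕ) :
    badSum G δ κ b ≤ (Fintype.card G : ℝ) ^ b * (Fintype.card (AddSubgroup G) *
      Eb (Fintype.card G) δ κ t b) := by
  set g : ℝ := (Fintype.card G : ℝ) with hg
  have hg1 : 1 ≤ g := by rw [hg]; exact_mod_cast Fintype.card_pos
  set q : ℝ := (δ ^ κ) ^ b with hq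
  have hq0 : 0 ≤ q := pow_nonneg (Real.rpow_nonneg h0.le _) _
  set Cond : AddSubgroup G → (Fin b → AddChar G ℂ) → Prop := fun H χ =>
    (∀ g, g ∉ H → κ * b ≤ cntC χ g) ∧
      (((Finset.univ.filter fun j => χ j ∉ perp H).card : ℝ) ≤ Fintype.card G * (κ * b)) with hCond
  have hA0 : 0 ≤ 1 - (1 - δ) / g + g * q := by
    have : (1 - δ) / g ≤ 1 := by rw [div_le_one (by linarith)]; linarith
    have : 0 ≤ g * q := by positivity
    linarith
  have hB0 : 0 ≤ (1 + g * q) ^ b - 1 + g * (2 ^ κ * (3/4)) ^ b := by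
    have : 1 ≤ (1 + g * q) ^ b := one_le_pow₀ (by
      have : 0 ≤ g * q := by positivity
      linarith)
    have : 0 ≤ g * (2 ^ κ * (3/4)) ^ b := by positivity
    linarith
  have step1 : badSum G δ κ b ≤ ∑ χ : Fin b → AddChar G ℂ, ∑ H : AddSubgroup G,
      if Cond H χ then badT δ κ χ else 0 := by
    refine Finset.sum_le_sum fun χ _ => ?_
    obtain ⟨H, hH⟩ := exists_H κ hκ χ
    have := Finset.single_le_sum (f := fun H => if Cond H χ then badT δ κ χ else 0)
      (s := Finset.univ) (fun H _ => by
        split_ifs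
        · exact badT_nonneg h0 χ
        · exact le_rfl) (Finset.mem_univ H)
    rw [if_pos (show Cond H χ from hH)] at this
    exact this
  rw [Finset.sum_comm] at step1
  refine step1.trans ?_
  have step2 : ∀ H : AddSubgroup G, (∑ χ : Fin b → AddChar G ℂ,
      if Cond H χ then badT δ κ χ else 0) ≤ g ^ b * Eb g δ κ t b := by
    intro H
    set A : ℝ := (Nat.card H * (1 - (1 - δ) / g + g * q)) ^ b with hA
    set B : ℝ := (Nat.card H : ℝ) ^ b * ((1 + g * q) ^ b - 1 + g * (2 ^ κ * (3/4)) ^ b) with hB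
    have hAn : 0 ≤ A := by positivity
    have hBn : 0 ≤ B := by positivity
    have h1' : (∑ χ : Fin b → AddChar G ℂ, if Cond H χ then badT δ κ χ else 0) ≤
        ∑ χ : Fin b → AddChar G ℂ,
          ((if ((Finset.univ.filter fun j => χ j ∉ perp H).card : ℝ) ≤ Fintype.card G * (κ * b)
            then (1:ℝ) else 0) * A + (if ∀ j, χ j ∈ perp H then 1 else 0) * B) := by
      refine Finset.sum_le_sum fun χ _ => ?_
      split_ifs with hc hx hy hy hx hy hy
      · rw [one_mul, one_mul]
        exact (badT_le_B h0 h1 χ H hc.1 hy).trans (by linarith)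
      · push Not at hy
        rw [one_mul, zero_mul, add_zero]
        exact badT_le_A h0 h1 χ H hc.1 hy
      · exact absurd hc.2 hx
      · exact absurd hc.2 hx
      all_goals positivity
    refine h1'.trans ?_
    rw [Finset.sum_add_distrib, ← Finset.sum_mul, ← Finset.sum_mul]
    have c1 : (∑ χ : Fin b → AddChar G ℂ,
        if ((Finset.univ.filter fun j => χ j ∉ perp H).card : ℝ) ≤ Fintype.card G * (κ * b)
            then (1:ℝ) else 0) ≤ (t ^ (g * κ) * ((perp H).card * (1 + g / t))) ^ b := by
      rw [Finset.sum_boole]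
      exact chi_count H t κ ht
    have c2 : (∑ χ : Fin b → AddChar G ℂ, if ∀ j, χ j ∈ perp H then (1:ℝ) else 0) =
        ((perp H).card : ℝ) ^ b := by
      have : ((perp H).card : ℝ) = ∑ ψ : AddChar G ℂ, if ψ ∈ perp H then (1:ℝ) else 0 := by
        rw [Finset.sum_boole]; simp
      rw [this, Fintype.sum_pow]
      refine Finset.sum_congr rfl fun f _ => ?_
      rw [Finset.prod_boole]
      simp
    rw [c2]
    have c3 := mul_le_mul_of_nonneg_right c1 hAn
    have hcp := card_perp H
    refine (add_le_add_left c3 _).trans (le_of_eq ?_)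
    rw [Eb, ← hq, hg, ← hcp, hcp, ← hg, hA, hB]
    have : g ^ b = (Nat.card H : ℝ) ^ b * ((perp H).card : ℝ) ^ b := by
      rw [← mul_pow, hcp]
    rw [this]
    simp only [mul_pow]
    ring
  calc _ ≤ ∑ H : AddSubgroup G, g ^ b * Eb g δ κ t b := Finset.sum_le_sum fun H _ => step2 H
    _ = _ := by simp; ring

lemma exists_params {g δ : ℝ} (hg : 1 ≤ g) (h0 : 0 < δ) (h1 : δ < 1) :
    ∃ κ t : ℝ, 0 < κ ∧ 1 ≤ t ∧ Tendsto (Eb g δ κ t) atTop (nhds 0) := by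
  set γ : ℝ := (1 - δ) / g with hγ
  have hγ0 : 0 < γ := by apply div_pos <;> linarith
  have hγ1 : γ < 1 := by rw [hγ, div_lt_one (by linarith)]; linarith
  set t : ℝ := 2 * g / γ with ht
  have ht1 : 1 ≤ t := by rw [ht, le_div_iff₀ hγ0]; linarith
  have ht0 : 0 < t := by linarith
  have hc1 : Tendsto (fun κ : ℝ => t ^ (g * κ)) (nhds 0) (nhds 1) := by
    have : Continuous fun κ : ℝ => t ^ (g * κ) := by
      apply Continuous.rpow continuous_const (by fun_prop)
      intro x; left; exact ht0.ne'
    simpa using this.tendsto 0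
  have hc2 : Tendsto (fun κ : ℝ => (2:ℝ) ^ κ) (nhds 0) (nhds 1) := by
    have : Continuous fun κ : ℝ => (2:ℝ) ^ κ := by
      apply Continuous.rpow continuous_const (by fun_prop)
      intro x; left; norm_num
    simpa using this.tendsto 0
  have ev := ((hc1.eventually_lt_const (show 1 < 1 + γ/2 by linarith)).and
    (hc2.eventually_lt_const (show (1:ℝ) < 7/6 by norm_num)))
  have ev' := (ev.filter_mono (nhdsWithin_le_nhds (s := Set.Ioi 0))).and self_mem_nhdsWithin
  obtain ⟨κ, ⟨hk1, hk2⟩, hk0⟩ := ev'.exists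
  have hk0 : 0 < κ := hk0
  refine ⟨κ, t, hk0, ht1, ?_⟩
  have hq0 : 0 < δ ^ κ := Real.rpow_pos_of_pos h0 _
  have hq1 : δ ^ κ < 1 := Real.rpow_lt_one h0.le h1 hk0
  have hgt : g / t = γ / 2 := by rw [ht]; field_simp
  have hqb : Tendsto (fun b : ℕ => (δ ^ κ) ^ b) atTop (nhds 0) :=
    tendsto_pow_atTop_nhds_zero_of_lt_one hq0.le hq1
  -- first term
  have T1 : Tendsto (fun b : ℕ => (t ^ (g * κ) * (1 + g / t) *
      (1 - (1 - δ) / g + g * (δ ^ κ) ^ b)) ^ b) atTop (nhds 0) := by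
    have hlim : Tendsto (fun b : ℕ => t ^ (g * κ) * (1 + g / t) *
      (1 - (1 - δ) / g + g * (δ ^ κ) ^ b)) atTop (nhds (t ^ (g * κ) * (1 + g / t) *
      (1 - (1 - δ) / g + g * 0))) :=
      ((hqb.const_mul g).const_add _).const_mul _
    have hL : t ^ (g * κ) * (1 + g / t) * (1 - (1 - δ) / g + g * 0) < 1 - γ^2/4 := by
      rw [hgt, ← hγ, mul_zero, add_zero, mul_assoc]
      have : (1 + γ/2) * (1 - γ) ≤ 1 - γ/2 := by nlinarith
      have hpos : 0 < (1 + γ/2) * (1 - γ) := by apply mul_pos <;> linarith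
      calc t ^ (g * κ) * ((1 + γ/2) * (1 - γ)) < (1 + γ/2) * ((1 + γ/2) * (1 - γ)) := by gcongr
        _ ≤ (1 + γ/2) * (1 - γ/2) := by gcongr
        _ = 1 - γ^2/4 := by ring
    have hev := hlim.eventually_lt_const hL
    have hr0 : 0 ≤ 1 - γ^2/4 := by nlinarith
    refine squeeze_zero' (Eventually.of_forall fun b => ?_) (hev.mono fun b hb => ?_)
      (tendsto_pow_atTop_nhds_zero_of_lt_one hr0 (show 1 - γ^2/4 < 1 by nlinarith))
    · apply pow_nonneg
      rw [hgt, ← hγ]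
      have : 0 ≤ g * (δ ^ κ) ^ b := by positivity
      apply mul_nonneg (by positivity)
      linarith
    · apply pow_le_pow_left₀ _ hb.le
      rw [hgt, ← hγ]
      have : 0 ≤ g * (δ ^ κ) ^ b := by positivity
      apply mul_nonneg (by positivity)
      linarith
  have T2 : Tendsto (fun b : ℕ => (1 + g * (δ ^ κ) ^ b) ^ b - 1) atTop (nhds 0) := by
    have hlim : Tendsto (fun b : ℕ => Real.exp (g * ((b:ℝ) * (δ ^ κ) ^ b)) - 1) atTop (nhds 0) := by
      have h := tendsto_self_mul_const_pow_of_lt_one hq0.le hq1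
      have := ((Real.continuous_exp.tendsto _).comp (h.const_mul g)).sub_const 1
      simpa using this
    refine squeeze_zero (fun b => ?_) (fun b => ?_) hlim
    · have : 1 ≤ (1 + g * (δ ^ κ) ^ b) ^ b := one_le_pow₀ (by
        have : 0 ≤ g * (δ ^ κ) ^ b := by positivity
        linarith)
      linarith
    · have h := Real.add_one_le_exp (g * (δ ^ κ) ^ b)
      have h' : (1 + g * (δ ^ κ) ^ b) ^ b ≤ (Real.exp (g * (δ ^ κ) ^ b)) ^ b :=
        pow_le_pow_left₀ (by positivity) (by linarith) b
      rw [← Real.exp_nat_mul] at h'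
      have e : (b:ℝ) * (g * (δ ^ κ) ^ b) = g * ((b:ℝ) * (δ ^ κ) ^ b) := by ring
      rw [e] at h'
      linarith
  have T3 : Tendsto (fun b : ℕ => g * ((2:ℝ) ^ κ * (3/4)) ^ b) atTop (nhds 0) := by
    have := (tendsto_pow_atTop_nhds_zero_of_lt_one (r := (2:ℝ) ^ κ * (3/4)) (by positivity)
      (by linarith)).const_mul g
    simpa using this
  have := T1.add (T2.add T3)
  simp only [add_zero] at this
  exact this

end St17

namespace St17

variable {G : Type} [AddCommGroup G] [Fintype G]

noncomputable def W {b : ℕ} (δ : ℝ) (f : Fin b → G) (χ : Fin b → AddChar G ℂ) : ℝ :=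
  ∏ i, ∏ j, w δ (f i) (χ j)

lemma W_nonneg {b : ℕ} {δ : ℝ} (h0 : 0 < δ) (f : Fin b → G) (χ : Fin b → AddChar G ℂ) :
    0 ≤ W δ f χ := prodw_nonneg h0 f χ

noncomputable def totSum (G : Type) [AddCommGroup G] [Fintype G] (δ : ℝ) (b : ℕ) : ℝ :=
  ∑ f : Fin b → G, ∑ χ : Fin b → AddChar G ℂ, W δ f χ

lemma badSum_eq (δ κ : ℝ) (b : ℕ) : badSum G δ κ b =
    ∑ f : Fin b → G, ∑ χ : Fin b → AddChar G ℂ, (if Good κ f χ then 0 else 1) * W δ f χ := by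
  rw [badSum, Finset.sum_comm]
  refine Finset.sum_congr rfl fun f _ => Finset.sum_congr rfl fun χ _ => ?_
  split_ifs <;> simp [W]

lemma W_le_one {b : ℕ} {δ : ℝ} (h0 : 0 < δ) (h1 : δ < 1) (f : Fin b → G)
    (χ : Fin b → AddChar G ℂ) : W δ f χ ≤ 1 :=
  Finset.prod_le_one (fun _ _ => Finset.prod_nonneg fun _ _ => w_nonneg h0 _ _)
    fun _ _ => Finset.prod_le_one (fun _ _ => w_nonneg h0 _ _) fun _ _ => w_le_one h1 _ _

lemma totSum_nonneg {δ : ℝ} (h0 : 0 < δ) (b : ℕ) : 0 ≤ totSum G δ b :=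
  Finset.sum_nonneg fun _ _ => Finset.sum_nonneg fun _ _ => W_nonneg h0 _ _

lemma totSum_le {δ κ : ℝ} (h0 : 0 < δ) (h1 : δ < 1) (b : ℕ) :
    totSum G δ b ≤ badSum G δ κ b + (Fintype.card G : ℝ) ^ b * Fintype.card (AddSubgroup G) := by
  have key : totSum G δ b ≤ badSum G δ κ b + ∑ f : Fin b → G, ∑ χ : Fin b → AddChar G ℂ,
      ∑ H : AddSubgroup G, (if ∀ i, f i ∈ H then (1:ℝ) else 0) *
        (if ∀ i, χ i ∈ perp H then 1 else 0) := by
    rw [badSum_eq, ← Finset.sum_add_distrib]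
    refine Finset.sum_le_sum fun f _ => ?_
    rw [← Finset.sum_add_distrib]
    refine Finset.sum_le_sum fun χ _ => ?_
    have hnn : ∀ H : AddSubgroup G, (0:ℝ) ≤ (if ∀ i, f i ∈ H then (1:ℝ) else 0) *
        (if ∀ i, χ i ∈ perp H then 1 else 0) := by
      intro H; split_ifs <;> norm_num
    have hs := Finset.sum_nonneg (s := Finset.univ) fun H _ => hnn H
    split_ifs with hg
    · obtain ⟨H, h2, h3, -⟩ := hg
      have := Finset.single_le_sum (fun H _ => hnn H) (Finset.mem_univ H)
      rw [if_pos h2, if_pos h3] at this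
      have := W_le_one h0 h1 f χ
      linarith
    · linarith
  refine key.trans (le_of_eq ?_)
  congr 1
  have e1 : ∀ H : AddSubgroup G, ∑ f : Fin b → G, (if ∀ i, f i ∈ H then (1:ℝ) else 0)
      = (Nat.card H : ℝ) ^ b := by
    intro H
    rw [← sum_mem_one, Fintype.sum_pow]
    refine Finset.sum_congr rfl fun f _ => ?_
    rw [Finset.prod_boole]
    simp
  have e2 : ∀ H : AddSubgroup G, (∑ χ : Fin b → AddChar G ℂ,
      if ∀ j, χ j ∈ perp H then (1:ℝ) else 0) = ((perp H).card : ℝ) ^ b := by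
    intro H
    have : ((perp H).card : ℝ) = ∑ ψ : AddChar G ℂ, if ψ ∈ perp H then (1:ℝ) else 0 := by
      rw [Finset.sum_boole]; simp
    rw [this, Fintype.sum_pow]
    refine Finset.sum_congr rfl fun f _ => ?_
    rw [Finset.prod_boole]
    simp
  calc _ = ∑ f : Fin b → G, ∑ H : AddSubgroup G, ∑ χ : Fin b → AddChar G ℂ,
        (if ∀ i, f i ∈ H then (1:ℝ) else 0) * (if ∀ i, χ i ∈ perp H then 1 else 0) := by
        refine Finset.sum_congr rfl fun f _ => Finset.sum_comm
    _ = ∑ H : AddSubgroup G, ∑ f : Fin b → G, ∑ χ : Fin b → AddChar G ℂ,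
        (if ∀ i, f i ∈ H then (1:ℝ) else 0) * (if ∀ i, χ i ∈ perp H then 1 else 0) :=
        Finset.sum_comm
    _ = ∑ H : AddSubgroup G, (Fintype.card G : ℝ) ^ b := by
        refine Finset.sum_congr rfl fun H _ => ?_
        rw [← Finset.sum_mul_sum, e1, e2, ← mul_pow, card_perp]
    _ = _ := by simp [mul_comm]

section comb
variable {L : Type} [Fintype L] [DecidableEq L] {D : ℕ} {bl : L → ℕ}

noncomputable def CP (δ : ℝ) (f : Fin D ⊕ (Σ l : L, Fin (bl l)) → G)
    (χ : Fin D ⊕ (Σ l : L, Fin (bl l)) → AddChar G ℂ) : ℝ :=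
  W δ (fun i => f (.inl i)) (fun j => χ (.inl j)) *
  (∏ i, ∏ x, w δ (f (.inl i)) (χ (.inr x))) *
  (∏ x, ∏ j, w δ (f (.inr x)) (χ (.inl j))) *
  ∏ l, W δ (fun i => f (.inr ⟨l, i⟩)) (fun j => χ (.inr ⟨l, j⟩))

lemma CP_bound {δ κ : ℝ} (h0 : 0 < δ) (h1 : δ < 1) (f : Fin D ⊕ (Σ l : L, Fin (bl l)) → G)
    (χ : Fin D ⊕ (Σ l : L, Fin (bl l)) → AddChar G ℂ)
    (hf : AddSubgroup.closure (Set.range f) = ⊤) (hχ : χ ≠ 0) :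
    CP δ f χ ≤ (((if Good κ (fun i => f (.inl i)) (fun j => χ (.inl j)) then 0 else 1)
        + (δ ^ κ) ^ D) * W δ (fun i => f (.inl i)) (fun j => χ (.inl j))) *
      ∏ l, W δ (fun i => f (.inr ⟨l, i⟩)) (fun j => χ (.inr ⟨l, j⟩)) := by
  have hq0 : 0 ≤ (δ ^ κ) ^ D := pow_nonneg (Real.rpow_nonneg h0.le _) _
  set W0 := W δ (fun i => f (.inl i)) (fun j => χ (.inl j))
  have hW0 : 0 ≤ W0 := W_nonneg h0 _ _
  set c1 := ∏ i, ∏ x, w δ (f (.inl i)) (χ (.inr x)) with hc1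
  set c2 := ∏ x, ∏ j, w δ (f (.inr x)) (χ (.inl j)) with hc2
  have hc1' : c1 = ∏ x, ∏ i, w δ (f (.inl i)) (χ (.inr x)) := Finset.prod_comm
  have c1n : 0 ≤ c1 := Finset.prod_nonneg fun _ _ => Finset.prod_nonneg fun _ _ => w_nonneg h0 _ _
  have c2n : 0 ≤ c2 := Finset.prod_nonneg fun _ _ => Finset.prod_nonneg fun _ _ => w_nonneg h0 _ _
  have in1 : ∀ x, ∏ i, w δ (f (.inl i)) (χ (.inr x)) ≤ 1 := fun x =>
    Finset.prod_le_one (fun _ _ => w_nonneg h0 _ _) fun _ _ => w_le_one h1 _ _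
  have in2 : ∀ x, ∏ j, w δ (f (.inr x)) (χ (.inl j)) ≤ 1 := fun x =>
    Finset.prod_le_one (fun _ _ => w_nonneg h0 _ _) fun _ _ => w_le_one h1 _ _
  have c1l : c1 ≤ 1 := hc1' ▸ Finset.prod_le_one
    (fun _ _ => Finset.prod_nonneg fun _ _ => w_nonneg h0 _ _) fun x _ => in1 x
  have c2l : c2 ≤ 1 := Finset.prod_le_one
    (fun _ _ => Finset.prod_nonneg fun _ _ => w_nonneg h0 _ _) fun x _ => in2 x
  have hlast : 0 ≤ ∏ l, W δ (fun i => f (.inr ⟨l, i⟩)) (fun j => χ (.inr ⟨l, j⟩)) :=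
    Finset.prod_nonneg fun _ _ => W_nonneg h0 _ _
  refine mul_le_mul_of_nonneg_right ?_ hlast
  have single : ∀ (F : (Σ l : L, Fin (bl l)) → ℝ), (∀ x, 0 ≤ F x) → (∀ x, F x ≤ 1) →
      ∀ x, ∏ y, F y ≤ F x := by
    intro F hF hF1 x
    rw [← Finset.mul_prod_erase Finset.univ F (Finset.mem_univ x)]
    exact mul_le_of_le_one_right (hF x) (Finset.prod_le_one (fun y _ => hF y) fun y _ => hF1 y)
  have main : c1 * c2 ≤ (if Good κ (fun i => f (.inl i)) (fun j => χ (.inl j)) then 0 else 1)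
        + (δ ^ κ) ^ D := by
    split_ifs with hg
    · rw [zero_add]
      obtain ⟨H, hf0, hχ0, hr1, hr2⟩ := hg
      by_cases hx : ∃ x, f (.inr x) ∉ H
      · obtain ⟨x, hx⟩ := hx
        have h3 := hr1 _ hx
        have h4 : c2 ≤ (δ ^ κ) ^ D := by
          refine (single _ (fun x => Finset.prod_nonneg fun _ _ => w_nonneg h0 _ _) in2 x).trans ?_
          rw [prod_w δ (fun j => χ (.inl j))]
          exact pow_cnt_le h0 h1 h3
        exact (mul_le_of_le_one_left c2n c1l).trans h4
      · push Not at hx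
        have hH : H = ⊤ := by
          rw [eq_top_iff, ← hf, AddSubgroup.closure_le]
          rintro _ ⟨y, rfl⟩
          rcases y with y | y
          · exact hf0 y
          · exact hx y
        have hperp : ∀ ψ, ψ ∈ perp H → ψ = 0 := by
          intro ψ hψ
          rw [mem_perp] at hψ
          ext g
          rw [hψ g (by rw [hH]; trivial)]
          simp
        obtain ⟨y, hy⟩ := Function.ne_iff.1 hχ
        rcases y with y | x
        · exact absurd (hperp _ (hχ0 y)) hy
        · have h3 := hr2 (χ (.inr x)) (fun h => hy (hperp _ h))
          have h4 : c1 ≤ (δ ^ κ) ^ D := by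
            rw [hc1']
            refine (single _ (fun x => Finset.prod_nonneg fun _ _ => w_nonneg h0 _ _)
              in1 x).trans ?_
            have : ∏ i, w δ (f (.inl i)) (χ (.inr x)) =
                δ ^ (cntR (fun i => f (.inl i)) (χ (.inr x))) := by
              simp [w, cntR, Finset.prod_ite]
            rw [this]
            exact pow_cnt_le h0 h1 h3
          exact (mul_le_of_le_one_right c1n c2l).trans h4
    · have := mul_le_one₀ c1l c2n c2l
      linarith
  calc W0 * c1 * c2 = (c1 * c2) * W0 := by ring
    _ ≤ _ := mul_le_mul_of_nonneg_right main hW0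

/-- Splitting of functions. -/
def splitE (P : Type) : (Fin D ⊕ (Σ l : L, Fin (bl l)) → P) ≃
    (Fin D → P) × ((l : L) → Fin (bl l) → P) :=
  (Equiv.sumArrowEquivProdArrow _ _ _).trans
    (Equiv.prodCongr (Equiv.refl _) (Equiv.piCurry fun _ _ => P))

lemma sum_split (δ : ℝ) (F : (Fin D → G) → (Fin D → AddChar G ℂ) → ℝ) :
    (∑ f : Fin D ⊕ (Σ l : L, Fin (bl l)) → G, ∑ χ : Fin D ⊕ (Σ l : L, Fin (bl l)) → AddChar G ℂ,
      F (fun i => f (.inl i)) (fun j => χ (.inl j)) *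
      ∏ l, W δ (fun i => f (.inr ⟨l, i⟩)) (fun j => χ (.inr ⟨l, j⟩))) =
    (∑ f0, ∑ χ0, F f0 χ0) * ∏ l, totSum G δ (bl l) := by
  have h1 : (∑ f : Fin D ⊕ (Σ l : L, Fin (bl l)) → G,
      ∑ χ : Fin D ⊕ (Σ l : L, Fin (bl l)) → AddChar G ℂ,
      F (fun i => f (.inl i)) (fun j => χ (.inl j)) *
      ∏ l, W δ (fun i => f (.inr ⟨l, i⟩)) (fun j => χ (.inr ⟨l, j⟩))) =
      ∑ f : (Fin D → G) × ((l : L) → Fin (bl l) → G),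
      ∑ χ : (Fin D → AddChar G ℂ) × ((l : L) → Fin (bl l) → AddChar G ℂ),
        F f.1 χ.1 * ∏ l, W δ (f.2 l) (χ.2 l) := by
    refine Fintype.sum_equiv (splitE G) _ _ fun f => ?_
    refine Fintype.sum_equiv (splitE (AddChar G ℂ)) _ _ fun χ => ?_
    rfl
  rw [h1]
  have h2 : ∏ l, totSum G δ (bl l) = ∑ f : (l : L) → Fin (bl l) → G,
      ∑ χ : (l : L) → Fin (bl l) → AddChar G ℂ, ∏ l, W δ (f l) (χ l) := by
    simp only [totSum]
    rw [Fintype.prod_sum]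
    refine Finset.sum_congr rfl fun f _ => ?_
    rw [Fintype.prod_sum]
  rw [h2, Fintype.sum_prod_type]
  simp_rw [Fintype.sum_prod_type, Finset.sum_mul, Finset.mul_sum]
  refine Finset.sum_congr rfl fun f0 _ => ?_
  rw [Finset.sum_comm]

lemma CP_sum {δ κ : ℝ} (h0 : 0 < δ) (h1 : δ < 1) :
    (∑ f : Fin D ⊕ (Σ l : L, Fin (bl l)) → G, ∑ χ : Fin D ⊕ (Σ l : L, Fin (bl l)) → AddChar G ℂ,
      if AddSubgroup.closure (Set.range f) = ⊤ ∧ χ ≠ 0 then CP δ f χ else 0) ≤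
    (badSum G δ κ D + (δ ^ κ) ^ D * totSum G δ D) * ∏ l, totSum G δ (bl l) := by
  have hq0 : 0 ≤ (δ ^ κ) ^ D := pow_nonneg (Real.rpow_nonneg h0.le _) _
  have e : badSum G δ κ D + (δ ^ κ) ^ D * totSum G δ D = ∑ f0 : Fin D → G,
      ∑ χ0 : Fin D → AddChar G ℂ,
        ((if Good κ f0 χ0 then 0 else 1) + (δ ^ κ) ^ D) * W δ f0 χ0 := by
    rw [badSum_eq, totSum]
    simp_rw [add_mul, Finset.sum_add_distrib, Finset.mul_sum]
  rw [e, ← sum_split]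
  refine Finset.sum_le_sum fun f _ => Finset.sum_le_sum fun χ _ => ?_
  split_ifs with h h' h'
  · simpa [h'] using CP_bound (κ := κ) h0 h1 f χ h.1 h.2
  · simpa [h'] using CP_bound (κ := κ) h0 h1 f χ h.1 h.2
  all_goals
    have := W_nonneg h0 (fun i => f (.inl i)) (fun j => χ (.inl j))
    have : 0 ≤ ∏ l, W δ (fun i => f (.inr ⟨l, i⟩)) (fun j => χ (.inr ⟨l, j⟩)) :=
      Finset.prod_nonneg fun _ _ => W_nonneg h0 _ _
    positivity

end comb

/-- The key combinatorial estimate. -/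
lemma exists_eta (G : Type) [AddCommGroup G] [Fintype G] {δ : ℝ} (h0 : 0 < δ) (h1 : δ < 1)
    (k : ℕ) : ∃ η : ℕ → ℝ, Tendsto η atTop (nhds 0) ∧ ∀ (D : ℕ) (bl : Fin (k + 1) → ℕ),
    (∑ f : Fin D ⊕ (Σ l : Fin (k + 1), Fin (bl l)) → G,
      ∑ χ : Fin D ⊕ (Σ l : Fin (k + 1), Fin (bl l)) → AddChar G ℂ,
      if AddSubgroup.closure (Set.range f) = ⊤ ∧ χ ≠ 0 then CP δ f χ else 0) ≤
    η D * (Fintype.card G : ℝ) ^ (D + ∑ l, bl l) := by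
  set g : ℝ := (Fintype.card G : ℝ) with hg
  have hg1 : 1 ≤ g := by rw [hg]; exact_mod_cast Fintype.card_pos
  obtain ⟨κ, t, hκ, ht, hlim⟩ := exists_params hg1 h0 h1
  set s : ℝ := (Fintype.card (AddSubgroup G) : ℝ) with hs
  have hs0 : 0 ≤ s := by positivity
  obtain ⟨M, hM⟩ := hlim.bddAbove_range
  have hM' : ∀ b, Eb g δ κ t b ≤ M := fun b => hM ⟨b, rfl⟩
  have hq0 : 0 ≤ δ ^ κ := Real.rpow_nonneg h0.le _
  have hq1 : δ ^ κ < 1 := Real.rpow_lt_one h0.le h1 hκ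
  set C : ℝ := s * M + s with hC
  have hbad : ∀ b, badSum G δ κ b ≤ g ^ b * (s * Eb g δ κ t b) := fun b =>
    badSum_le h0 h1 hκ.le ht b
  have htot : ∀ b, totSum G δ b ≤ g ^ b * C := by
    intro b
    have := totSum_le (G := G) (κ := κ) h0 h1 b
    have h2 := hbad b
    have h3 : g ^ b * (s * Eb g δ κ t b) ≤ g ^ b * (s * M) := by
      gcongr; exact hM' b
    rw [hC, mul_add]; linarith
  have hC0 : 0 ≤ C := by
    have h2 := htot 0
    have := totSum_nonneg (G := G) h0 0
    simp at h2
    linarith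
  refine ⟨fun D => (s * Eb g δ κ t D + (δ ^ κ) ^ D * C) * C ^ (k + 1), ?_, ?_⟩
  · have := ((hlim.const_mul s).add
      ((tendsto_pow_atTop_nhds_zero_of_lt_one hq0 hq1).mul_const C)).mul_const (C ^ (k+1))
    simpa using this
  · intro D bl
    refine (CP_sum (κ := κ) h0 h1).trans ?_
    have hp : ∏ l, totSum G δ (bl l) ≤ g ^ (∑ l, bl l) * C ^ (k + 1) := by
      calc ∏ l, totSum G δ (bl l) ≤ ∏ l, (g ^ (bl l) * C) :=
            Finset.prod_le_prod (fun l _ => totSum_nonneg h0 _) fun l _ => htot _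
        _ = _ := by rw [Finset.prod_mul_distrib, Finset.prod_pow_eq_pow_sum]; simp
    have hf : badSum G δ κ D + (δ ^ κ) ^ D * totSum G δ D ≤
        g ^ D * (s * Eb g δ κ t D + (δ ^ κ) ^ D * C) := by
      have h2 := hbad D
      have h3 : (δ ^ κ) ^ D * totSum G δ D ≤ (δ ^ κ) ^ D * (g ^ D * C) := by
        gcongr; exact htot D
      linarith
    have hl : 0 ≤ badSum G δ κ D + (δ ^ κ) ^ D * totSum G δ D := by
      have : 0 ≤ badSum G δ κ D := Finset.sum_nonneg fun χ _ => badT_nonneg h0 χ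
      have := totSum_nonneg (G := G) h0 D
      positivity
    calc _ ≤ (g ^ D * (s * Eb g δ κ t D + (δ ^ κ) ^ D * C)) * (g ^ (∑ l, bl l) * C ^ (k + 1)) :=
          mul_le_mul hf hp (Finset.prod_nonneg fun l _ => totSum_nonneg h0 _) (hl.trans hf)
      _ = _ := by rw [pow_add]; ring

end St17

namespace St17

lemma exists_structure (n D k : ℕ) (α β : ℕ → ℕ) (hD : D ≤ n)
    (h : ∀ l ∈ Finset.Icc 1 k, α l + β l + D ≤ n) :
    ∃ (bl : Fin (k + 1) → ℕ) (er ec : (Fin D ⊕ (Σ l : Fin (k + 1), Fin (bl l))) ≃ Fin n),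
      (∀ i y, ¬ ∃ l ∈ Finset.Icc 1 k, (er (.inl i) : ℕ) < α l ∧ (ec y : ℕ) < β l) ∧
      (∀ x j, ¬ ∃ l ∈ Finset.Icc 1 k, (er x : ℕ) < α l ∧ (ec (.inl j) : ℕ) < β l) ∧
      (∀ s i j, ¬ ∃ l ∈ Finset.Icc 1 k,
        (er (.inr ⟨s, i⟩) : ℕ) < α l ∧ (ec (.inr ⟨s, j⟩) : ℕ) < β l) := by
  obtain ⟨m, rfl⟩ := Nat.exists_eq_add_of_le hD
  set lab : Fin m → Fin (k + 1) := fun x =>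
    ⟨((Finset.Icc 1 k).filter fun l => β l ≤ x).card, by
      have := Finset.card_filter_le (Finset.Icc 1 k) (fun l => β l ≤ x)
      simp at this ⊢; omega⟩ with hlab
  set bl : Fin (k + 1) → ℕ := fun s => Fintype.card {x // lab x = s}
  let eX : (Σ s : Fin (k + 1), Fin (bl s)) ≃ Fin m :=
    (Equiv.sigmaCongrRight fun s => (Fintype.equivFin {x // lab x = s}).symm).trans
      (Equiv.sigmaFiberEquiv lab)
  have heX : ∀ s i, lab (eX ⟨s, i⟩) = s := fun s i =>
    ((Fintype.equivFin {x // lab x = s}).symm i).2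
  let er : (Fin D ⊕ (Σ s : Fin (k + 1), Fin (bl s))) ≃ Fin (D + m) :=
    ((Equiv.sumCongr (Equiv.refl _) eX).trans finSumFinEquiv).trans Fin.revPerm
  let ec : (Fin D ⊕ (Σ s : Fin (k + 1), Fin (bl s))) ≃ Fin (D + m) :=
    (((Equiv.sumCongr (Equiv.refl _) eX).trans (Equiv.sumComm _ _)).trans finSumFinEquiv).trans
      (finCongr (Nat.add_comm m D))
  have er1 : ∀ i, (er (.inl i) : ℕ) = D + m - (i + 1) := fun i => by simp [er]
  have er2 : ∀ x, (er (.inr x) : ℕ) = D + m - (D + eX x + 1) := fun i => by simp [er]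
  have ec1 : ∀ i, (ec (.inl i) : ℕ) = m + i := fun i => by simp [ec, Nat.add_comm]
  have ec2 : ∀ x, (ec (.inr x) : ℕ) = eX x := fun i => by simp [ec]
  refine ⟨bl, er, ec, ?_, ?_, ?_⟩
  · rintro i y ⟨l, hl, h1, -⟩
    have := h l hl
    have := i.2
    rw [er1] at h1
    omega
  · rintro x j ⟨l, hl, -, h2⟩
    have := h l hl
    rw [ec1] at h2
    omega
  · rintro s i j ⟨l, hl, h1, h2⟩
    have := h l hl
    rw [er2] at h1
    rw [ec2] at h2
    have hx := (eX ⟨s, i⟩).2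
    have h3 : β l ≤ eX ⟨s, i⟩ := by omega
    have hlt : ((Finset.Icc 1 k).filter fun l => β l ≤ (eX ⟨s, j⟩ : ℕ)).card <
        ((Finset.Icc 1 k).filter fun l => β l ≤ (eX ⟨s, i⟩ : ℕ)).card := by
      apply Finset.card_lt_card
      rw [Finset.ssubset_iff_of_subset]
      · exact ⟨l, by simp only [Finset.mem_filter]; exact ⟨hl, h3⟩,
          by simp only [Finset.mem_filter, not_and, not_le]; exact fun _ => h2⟩
      · intro l' hl'
        simp only [Finset.mem_filter] at hl' ⊢
        exact ⟨hl'.1, by omega⟩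
    have e1 := congrArg Fin.val (heX s i)
    have e2 := congrArg Fin.val (heX s j)
    simp only [hlab] at e1 e2
    omega

variable {G : Type} [AddCommGroup G] [Fintype G]

lemma prod_le_CP {n D : ℕ} {L : Type} [Fintype L] [DecidableEq L] {bl : L → ℕ} {δ : ℝ} (h0 : 0 < δ)
    (er ec : (Fin D ⊕ (Σ l : L, Fin (bl l))) ≃ Fin n) (Z : Fin n → Fin n → Prop)
    (hz1 : ∀ i y, ¬ Z (er (.inl i)) (ec y)) (hz2 : ∀ x j, ¬ Z (er x) (ec (.inl j)))
    (hz3 : ∀ s i j, ¬ Z (er (.inr ⟨s, i⟩)) (ec (.inr ⟨s, j⟩)))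
    (f : Fin n → G) (χ : Fin n → AddChar G ℂ) (c : Fin n → Fin n → ℝ)
    (hc0 : ∀ i j, 0 ≤ c i j) (hc1 : ∀ i j, c i j ≤ 1)
    (hc : ∀ i j, ¬ Z i j → c i j ≤ w δ (f i) (χ j)) :
    ∏ i, ∏ j, c i j ≤ CP δ (f ∘ er) (χ ∘ ec) := by
  have e : ∏ i, ∏ j, c i j = ∏ x, ∏ y, c (er x) (ec y) := by
    rw [← Equiv.prod_comp er]
    refine Finset.prod_congr rfl fun x _ => ?_
    rw [← Equiv.prod_comp ec]
  rw [e]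
  simp only [Fintype.prod_sum_type, Finset.prod_mul_distrib]
  rw [CP, ← mul_assoc]
  have pn : ∀ {A B : Type} [Fintype A] [Fintype B] (F : A → B → ℝ), (∀ a b, 0 ≤ F a b) →
      0 ≤ ∏ a, ∏ b, F a b := fun F hF =>
    Finset.prod_nonneg fun _ _ => Finset.prod_nonneg fun _ _ => hF _ _
  have pl : ∀ {A B : Type} [Fintype A] [Fintype B] (F F' : A → B → ℝ), (∀ a b, 0 ≤ F a b) →
      (∀ a b, F a b ≤ F' a b) → ∏ a, ∏ b, F a b ≤ ∏ a, ∏ b, F' a b := fun F F' hF hF' =>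
    Finset.prod_le_prod (fun _ _ => Finset.prod_nonneg fun _ _ => hF _ _)
      fun _ _ => Finset.prod_le_prod (fun _ _ => hF _ _) fun _ _ => hF' _ _
  have i1 := pl (fun i j => c (er (.inl i)) (ec (.inl j)))
    (fun i j => w δ ((f ∘ er) (.inl i)) ((χ ∘ ec) (.inl j))) (fun _ _ => hc0 _ _)
    (fun i j => hc _ _ (hz1 _ _))
  have i2 := pl (fun i j => c (er (.inl i)) (ec (.inr j)))
    (fun i j => w δ ((f ∘ er) (.inl i)) ((χ ∘ ec) (.inr j))) (fun _ _ => hc0 _ _)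
    (fun i j => hc _ _ (hz1 _ _))
  have i3 := pl (fun i j => c (er (.inr i)) (ec (.inl j)))
    (fun i j => w δ ((f ∘ er) (.inr i)) ((χ ∘ ec) (.inl j))) (fun _ _ => hc0 _ _)
    (fun i j => hc _ _ (hz2 _ _))
  have i4 : ∏ x, ∏ y, c (er (.inr x)) (ec (.inr y)) ≤
      ∏ l, W δ (fun i => (f ∘ er) (.inr ⟨l, i⟩)) (fun j => (χ ∘ ec) (.inr ⟨l, j⟩)) := by
    rw [Fintype.prod_sigma]
    refine Finset.prod_le_prod (fun l _ => pn _ fun _ _ => hc0 _ _) fun l _ => ?_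
    refine Finset.prod_le_prod (fun i _ => Finset.prod_nonneg fun _ _ => hc0 _ _) fun i _ => ?_
    rw [Fintype.prod_sigma, ← Finset.mul_prod_erase Finset.univ _ (Finset.mem_univ l)]
    refine (mul_le_of_le_one_right (Finset.prod_nonneg fun _ _ => hc0 _ _)
      (Finset.prod_le_one (fun _ _ => Finset.prod_nonneg fun _ _ => hc0 _ _)
        fun _ _ => Finset.prod_le_one (fun _ _ => hc0 _ _) fun _ _ => hc1 _ _)).trans ?_
    exact Finset.prod_le_prod (fun _ _ => hc0 _ _) fun j _ => hc _ _ (hz3 _ _ _)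
  have n1 := pn (fun i j => c (er (.inl i)) (ec (.inl j))) (fun _ _ => hc0 _ _)
  have n2 := pn (fun i j => c (er (.inl i)) (ec (.inr j))) (fun _ _ => hc0 _ _)
  have n3 := pn (fun i j => c (er (.inr i)) (ec (.inl j))) (fun _ _ => hc0 _ _)
  have n4 := pn (fun i j => c (er (.inr i)) (ec (.inr j))) (fun _ _ => hc0 _ _)
  have m12 := mul_le_mul i1 i2 n2 (n1.trans i1)
  have m123 := mul_le_mul m12 i3 n3 ((mul_nonneg n1 n2).trans m12)
  refine le_trans (le_of_eq ?_) (mul_le_mul m123 i4 n4 ((mul_nonneg (mul_nonneg n1 n2) n3).trans m123))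
  ring

/-- Combined: the error term for stairs. -/
lemma stairs_error (G : Type) [AddCommGroup G] [Fintype G] {δ : ℝ} (h0 : 0 < δ) (h1 : δ < 1)
    (k : ℕ) : ∃ η : ℕ → ℝ, Tendsto η atTop (nhds 0) ∧ ∀ (n D : ℕ) (α β : ℕ → ℕ), D ≤ n →
    (∀ l ∈ Finset.Icc 1 k, α l + β l + D ≤ n) →
    ∀ c : (Fin n → G) → (Fin n → AddChar G ℂ) → Fin n → Fin n → ℝ,
    (∀ f χ i j, 0 ≤ c f χ i j) → (∀ f χ i j, c f χ i j ≤ 1) →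
    (∀ f χ (i j : Fin n), (¬ ∃ l ∈ Finset.Icc 1 k, (i : ℕ) < α l ∧ (j : ℕ) < β l) →
      c f χ i j ≤ w δ (f i) (χ j)) →
    (∑ f : Fin n → G, ∑ χ : Fin n → AddChar G ℂ,
      if AddSubgroup.closure (Set.range f) = ⊤ ∧ χ ≠ 0 then ∏ i, ∏ j, c f χ i j else 0) ≤
    η D * (Fintype.card G : ℝ) ^ n := by
  obtain ⟨η, hη, hb⟩ := exists_eta G h0 h1 k
  refine ⟨η, hη, ?_⟩
  intro n D α β hD hst c hc0 hc1 hc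
  obtain ⟨bl, er, ec, hz1, hz2, hz3⟩ := exists_structure n D k α β hD hst
  have hcard : D + ∑ l, bl l = n := by
    have := Fintype.card_congr er
    simpa using this
  have := hb D bl
  rw [hcard] at this
  refine le_trans ?_ this
  have key : ∀ f χ, (if AddSubgroup.closure (Set.range f) = ⊤ ∧ χ ≠ 0
      then ∏ i, ∏ j, c f χ i j else 0) ≤
      (if AddSubgroup.closure (Set.range (f ∘ er)) = ⊤ ∧ χ ∘ ec ≠ 0
        then CP δ (f ∘ er) (χ ∘ ec) else 0) := by
    intro f χ
    have e1 : Set.range (f ∘ er) = Set.range f := er.surjective.range_comp f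
    have e2 : χ ∘ ec ≠ 0 ↔ χ ≠ 0 := by
      rw [not_iff_not]
      constructor
      · intro h
        funext j
        have := congrFun h (ec.symm j)
        simpa using this
      · rintro rfl; rfl
    by_cases h : AddSubgroup.closure (Set.range f) = ⊤ ∧ χ ≠ 0
    · rw [if_pos h, if_pos ⟨by rw [e1]; exact h.1, e2.2 h.2⟩]
      exact prod_le_CP h0 er ec (fun i j => ∃ l ∈ Finset.Icc 1 k, (i : ℕ) < α l ∧ (j : ℕ) < β l)
        hz1 hz2 hz3 f χ (c f χ) (hc0 f χ) (hc1 f χ) (hc f χ)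
    · rw [if_neg h, if_neg (fun h2 => h ⟨e1 ▸ h2.1, e2.1 h2.2⟩)]
  refine (Finset.sum_le_sum fun f _ => Finset.sum_le_sum fun χ _ => key f χ).trans (le_of_eq ?_)
  refine Fintype.sum_equiv (Equiv.arrowCongr er.symm (Equiv.refl G)) _ _ fun f => ?_
  refine Fintype.sum_equiv (Equiv.arrowCongr ec.symm (Equiv.refl _)) _ _ fun χ => ?_
  rfl

end St17

namespace St17

section five
variable {a n : ℕ} {G : Type} [AddCommGroup G] [Module (ZMod a) G]

lemma surj_iff (f : Fin n → G) :
    Function.Surjective (Fintype.linearCombination (ZMod a) f) ↔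
      AddSubgroup.closure (Set.range f) = ⊤ := by
  constructor
  · intro h
    rw [eq_top_iff]
    rintro x -
    obtain ⟨v, rfl⟩ := h x
    rw [Fintype.linearCombination_apply]
    refine sum_mem fun i _ => ?_
    have h1 : f i ∈ AddSubgroup.toZModSubmodule a (AddSubgroup.closure (Set.range f)) :=
      AddSubgroup.subset_closure ⟨i, rfl⟩
    exact Submodule.smul_mem _ (v i) h1
  · intro h x
    have h1 : AddSubgroup.closure (Set.range f) ≤
        (Fintype.linearCombination (ZMod a) f).toAddMonoidHom.range := by
      rw [AddSubgroup.closure_le]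
      rintro _ ⟨i, rfl⟩
      exact ⟨Pi.single i 1, by simp⟩
    rw [h] at h1
    exact h1 (AddSubgroup.mem_top x)

lemma nSur_eq (g : Fin n → Fin n → ZMod a) :
    nSur g G = Nat.card {f : Fin n → G //
      AddSubgroup.closure (Set.range f) = ⊤ ∧ ∀ j, ∑ i, g i j • f i = 0} := by
  -- linear combination attached to a homomorphism
  have lc : ∀ F : cok g →+ G, ∀ v : Fin n → ZMod a,
      Fintype.linearCombination (ZMod a)
        (fun i => F (Submodule.Quotient.mk (Pi.single i 1))) v =
      F (Submodule.Quotient.mk v) := by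
    intro F v
    have : Fintype.linearCombination (ZMod a)
        (fun i => F (Submodule.Quotient.mk (Pi.single i 1))) =
        (F.toZModLinearMap a).comp (Submodule.mkQ _) := by
      apply LinearMap.pi_ext'
      intro i
      ext
      simp
    rw [this]; rfl
  refine Nat.card_congr (Equiv.ofBijective (fun F => ⟨fun i =>
    F.1 (Submodule.Quotient.mk (Pi.single i 1)), ?_, ?_⟩) ⟨?_, ?_⟩)
  · rw [← surj_iff (a := a)]
    intro x
    obtain ⟨y, rfl⟩ := F.2 x
    obtain ⟨v, rfl⟩ := Submodule.Quotient.mk_surjective _ y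
    exact ⟨v, lc F.1 v⟩
  · intro j
    have h1 := lc F.1 (fun i => g i j)
    rw [Fintype.linearCombination_apply] at h1
    rw [h1]
    have : (Submodule.Quotient.mk (fun i => g i j) : cok g) = 0 := by
      rw [Submodule.Quotient.mk_eq_zero]
      refine ⟨Pi.single j 1, ?_⟩
      ext i
      simp
    rw [this, map_zero]
  · intro F F' h
    have h' := congrArg Subtype.val h
    apply Subtype.ext
    ext y
    obtain ⟨v, rfl⟩ := Submodule.Quotient.mk_surjective _ y
    rw [← lc F.1 v, ← lc F'.1 v]
    simp only at h'
    rw [h']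
  · rintro ⟨f, hf1, hf2⟩
    have hle : LinearMap.range (Matrix.of g).mulVecLin ≤
        LinearMap.ker (Fintype.linearCombination (ZMod a) f) := by
      rintro _ ⟨v, rfl⟩
      rw [LinearMap.mem_ker, Fintype.linearCombination_apply]
      simp only [Matrix.mulVecLin_apply, Matrix.mulVec, dotProduct, Matrix.of_apply,
        Finset.sum_smul]
      rw [Finset.sum_comm]
      refine Finset.sum_eq_zero fun j _ => ?_
      have := congrArg (v j • ·) (hf2 j)
      simp only [smul_zero, Finset.smul_sum] at this
      rw [← this]
      refine Finset.sum_congr rfl fun i _ => ?_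
      rw [smul_smul, mul_comm]
    refine ⟨⟨(Submodule.liftQ _ (Fintype.linearCombination (ZMod a) f) hle).toAddMonoidHom, ?_⟩, ?_⟩
    · intro x
      obtain ⟨v, hv⟩ := (surj_iff (a := a) f).2 hf1 x
      exact ⟨Submodule.Quotient.mk v, by simpa using hv⟩
    · apply Subtype.ext
      funext i
      simp

lemma char_sum {ι : Type} [Fintype ι] (χ : AddChar G ℂ) (v : ι → G) :
    χ (∑ i, v i) = ∏ i, χ (v i) := by
  have h := map_prod χ.toMonoidHom (fun i => Multiplicative.ofAdd (v i)) Finset.univ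
  rw [← ofAdd_sum] at h
  exact h

lemma nSur_char [Fintype G] (g : Fin n → Fin n → ZMod a) :
    (nSur g G : ℂ) = ((Fintype.card G : ℂ) ^ n)⁻¹ * ∑ f : Fin n → G,
      ∑ χ : Fin n → AddChar G ℂ, if AddSubgroup.closure (Set.range f) = ⊤ then
        ∏ i, ∏ j, χ j (g i j • f i) else 0 := by
  have hG : (Fintype.card G : ℂ) ≠ 0 := by
    exact_mod_cast Fintype.card_ne_zero
  rw [nSur_eq, Nat.card_eq_fintype_card, Fintype.card_subtype, Finset.card_eq_sum_ones,
    Finset.sum_filter, Nat.cast_sum, Finset.mul_sum]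
  refine Finset.sum_congr rfl fun f _ => ?_
  by_cases hf : AddSubgroup.closure (Set.range f) = ⊤
  · simp only [hf, true_and, if_true]
    have e : ∀ χ : Fin n → AddChar G ℂ, ∏ i, ∏ j, χ j (g i j • f i) =
        ∏ j, χ j (∑ i, g i j • f i) := by
      intro χ
      rw [Finset.prod_comm]
      refine Finset.prod_congr rfl fun j _ => ?_
      exact (char_sum _ _).symm
    simp only [e]
    rw [← Fintype.prod_sum (fun (j : Fin n) (ψ : AddChar G ℂ) => ψ (∑ i, g i j • f i))]
    simp only [AddChar.sum_apply_eq_ite]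
    by_cases h : ∀ j, ∑ i, g i j • f i = 0
    · simp [h, hG]
    · rw [if_neg h]
      push Not at h
      obtain ⟨j, hj⟩ := h
      rw [Finset.prod_eq_zero (Finset.mem_univ j) (by rw [if_neg hj])]
      simp
  · simp [hf]

end five

end St17

namespace St17

section bal
variable {a : ℕ} {G : Type} [AddCommGroup G] [Fintype G] [Module (ZMod a) G]

lemma exists_gap (G : Type) [AddCommGroup G] [Fintype G] : ∃ c : ℝ, 0 < c ∧ c ≤ 1 ∧
    ∀ (g : G) (χ : AddChar G ℂ), χ g ≠ 1 → (χ g).re ≤ 1 - c := by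
  have key : ∀ p : G × AddChar G ℂ, ∃ c : ℝ, 0 < c ∧ (p.2 p.1 ≠ 1 → (p.2 p.1).re ≤ 1 - c) := by
    rintro ⟨g, χ⟩
    by_cases h : χ g = 1
    · exact ⟨1, one_pos, fun h' => absurd h h'⟩
    · have hn : ‖χ g‖ = 1 := AddChar.norm_apply χ g
      have hlt : (χ g).re < 1 := by
        have h1 := Complex.re_le_norm (χ g)
        rw [hn] at h1
        refine lt_of_le_of_ne h1 fun h2 => h ?_
        have h3 := Complex.sq_norm (χ g)
        rw [hn, Complex.normSq_apply, h2] at h3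
        have : (χ g).im = 0 := by nlinarith
        exact Complex.ext h2 this
      exact ⟨1 - (χ g).re, by linarith, fun _ => by simp⟩
  choose c hc hc' using key
  refine ⟨min 1 (Finset.univ.inf' Finset.univ_nonempty c), ?_, min_le_left _ _, ?_⟩
  · rw [lt_min_iff]
    exact ⟨one_pos, by rw [Finset.lt_inf'_iff]; exact fun p _ => hc p⟩
  · intro g χ h
    have h1 := hc' (g, χ) h
    have h2 : min 1 (Finset.univ.inf' Finset.univ_nonempty c) ≤ c (g, χ) :=
      (min_le_right _ _).trans (Finset.inf'_le _ (Finset.mem_univ _))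
    simp only at h1
    linarith

instance : DiscreteMeasurableSpace (ZMod a) := ⟨fun _ => trivial⟩

lemma bal_set [NeZero a] {ε : ℝ} (h1 : ε < 1) (ν : Measure (ZMod a)) [IsProbabilityMeasure ν]
    (hν : IsEpsBalanced ε ν) (g : G) (χ : AddChar G ℂ) (hg : χ g ≠ 1) (y : ZMod a) :
    ν.real {x | χ ((x - y) • g) = 1} ≤ 1 - ε := by
  let I : Ideal (ZMod a) :=
    { carrier := {x | χ (x • g) = 1}
      add_mem' := by
        intro x z hx hz
        simp only [Set.mem_ofPred_eq] at hx hz ⊢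
        rw [add_smul, AddChar.map_add_eq_mul, hx, hz, one_mul]
      zero_mem' := by simp
      smul_mem' := by
        intro r x hx
        simp only [Set.mem_ofPred_eq] at hx ⊢
        rw [← ZMod.natCast_zmod_val r, smul_eq_mul, mul_smul, Nat.cast_smul_eq_nsmul,
          AddChar.map_nsmul_eq_pow, hx, one_pow] }
  have hI : I ≠ ⊤ := by
    intro h
    rw [Ideal.eq_top_iff_one] at h
    have : χ ((1 : ZMod a) • g) = 1 := h
    rw [one_smul] at this
    exact hg this
  obtain ⟨P, hP, hle⟩ := Ideal.exists_le_maximal I hI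
  have := hν P hP (Ideal.Quotient.mk P y)
  have h2 : ν {x | χ ((x - y) • g) = 1} ≤ ENNReal.ofReal (1 - ε) := by
    refine (measure_mono ?_).trans this
    intro x hx
    simp only [Set.mem_ofPred_eq]
    rw [Ideal.Quotient.eq]
    exact hle hx
  exact ENNReal.toReal_le_of_le_ofReal (by linarith) h2

lemma exists_bal (a : ℕ) [NeZero a] {ε : ℝ} (h0 : 0 < ε) (h1 : ε < 1)
    (G : Type) [AddCommGroup G] [Fintype G] [Module (ZMod a) G] :
    ∃ δ : ℝ, 0 < δ ∧ δ < 1 ∧ ∀ ν : Measure (ZMod a), IsProbabilityMeasure ν →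
      IsEpsBalanced ε ν → ∀ (g : G) (χ : AddChar G ℂ), χ g ≠ 1 →
      ‖∫ x, χ (x • g) ∂ν‖ ≤ δ := by
  obtain ⟨c, hc0, hc1, hc⟩ := exists_gap G
  have hce : c * ε < 1 := by nlinarith
  have hce0 : 0 < c * ε := by positivity
  refine ⟨Real.sqrt (1 - c * ε), Real.sqrt_pos.2 (by linarith), ?_, ?_⟩
  · rw [Real.sqrt_lt' one_pos]; linarith
  intro ν hν hb g χ hg
  apply Real.le_sqrt_of_sq_le
  set p : ZMod a → ℝ := fun x => ν.real {x} with hp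
  have hp0 : ∀ x, 0 ≤ p x := fun x => measureReal_nonneg
  have hsum : ∀ S : Set (ZMod a), ∑ x, (if x ∈ S then p x else 0) = ν.real S := by
    intro S
    rw [← Finset.sum_filter]
    have := sum_measureReal_singleton (μ := ν) (Finset.univ.filter (· ∈ S))
    rw [this]
    congr 1
    ext; simp
  have hp1 : ∑ x, p x = 1 := by
    have := hsum Set.univ
    simpa using this
  have hz : ∫ x, χ (x • g) ∂ν = ∑ x, (p x : ℂ) * χ (x • g) := by
    rw [integral_fintype (Integrable.of_finite)]
    simp [hp]
  rw [hz, Complex.sq_norm]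
  have e : Complex.normSq (∑ x, (p x : ℂ) * χ (x • g)) =
      ∑ y, p y * ∑ x, p x * (χ ((x - y) • g)).re := by
    have : ((Complex.normSq (∑ x, (p x : ℂ) * χ (x • g)) : ℝ) : ℂ) =
        ∑ y, (p y : ℂ) * ∑ x, (p x : ℂ) * (χ ((x - y) • g)) := by
      rw [← Complex.mul_conj, map_sum, mul_comm, Finset.sum_mul]
      refine Finset.sum_congr rfl fun y _ => ?_
      rw [Finset.mul_sum, Finset.mul_sum]
      refine Finset.sum_congr rfl fun x _ => ?_
      rw [map_mul, Complex.conj_ofReal, sub_smul, sub_eq_add_neg, AddChar.map_add_eq_mul,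
        AddChar.map_neg_eq_conj]
      ring
    have h2 := congrArg Complex.re this
    rw [Complex.ofReal_re] at h2
    rw [h2, Complex.re_sum]
    refine Finset.sum_congr rfl fun y _ => ?_
    rw [Complex.re_ofReal_mul, Complex.re_sum]
    congr 1
    refine Finset.sum_congr rfl fun x _ => ?_
    rw [Complex.re_ofReal_mul]
  rw [e]
  have inner : ∀ y, ∑ x, p x * (χ ((x - y) • g)).re ≤ 1 - c * ε := by
    intro y
    have hS := hsum {x | χ ((x - y) • g) = 1}
    have hb' := bal_set h1 ν hb g χ hg y
    rw [← hS] at hb'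
    have : ∑ x, p x * (χ ((x - y) • g)).re ≤
        ∑ x, ((1 - c) * p x + c * (if x ∈ {x | χ ((x - y) • g) = 1} then p x else 0)) := by
      refine Finset.sum_le_sum fun x _ => ?_
      by_cases h : χ ((x - y) • g) = 1
      · rw [if_pos (show x ∈ {x | χ ((x - y) • g) = 1} from h), h, Complex.one_re]; linarith
      · rw [if_neg (show x ∉ {x | χ ((x - y) • g) = 1} from h)]
        have := mul_le_mul_of_nonneg_left (hc _ _ h) (hp0 x)
        linarith
    refine this.trans ?_
    rw [Finset.sum_add_distrib, ← Finset.mul_sum, ← Finset.mul_sum, hp1]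
    nlinarith
  calc ∑ y, p y * ∑ x, p x * (χ ((x - y) • g)).re ≤ ∑ y, p y * (1 - c * ε) :=
        Finset.sum_le_sum fun y _ => mul_le_mul_of_nonneg_left (inner y) (hp0 y)
    _ = 1 - c * ε := by rw [← Finset.sum_mul, hp1, one_mul]

end bal

/-- the proportion of generating tuples -/
lemma gen_tendsto (G : Type) [AddCommGroup G] [Fintype G] :
    Tendsto (fun n : ℕ => ((Fintype.card G : ℝ) ^ n)⁻¹ * ∑ f : Fin n → G,
      if AddSubgroup.closure (Set.range f) = ⊤ then (1 : ℝ) else 0) atTop (nhds 1) := by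
  have hG : 0 < (Fintype.card G : ℝ) := by exact_mod_cast Fintype.card_pos
  have lim : Tendsto (fun n : ℕ => 1 - ∑ H : {H : AddSubgroup G // H ≠ ⊤},
      ((Nat.card H.1 : ℝ) / Fintype.card G) ^ n) atTop (nhds 1) := by
    have : Tendsto (fun n : ℕ => 1 - ∑ H : {H : AddSubgroup G // H ≠ ⊤},
      ((Nat.card H.1 : ℝ) / Fintype.card G) ^ n) atTop
        (nhds (1 - ∑ H : {H : AddSubgroup G // H ≠ ⊤}, 0)) := by
      refine tendsto_const_nhds.sub (tendsto_finsetSum _ fun H _ => ?_)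
      refine tendsto_pow_atTop_nhds_zero_of_lt_one (by positivity) ?_
      rw [div_lt_one hG]
      have h1 : Nat.card H.1 ≠ Nat.card G := fun h =>
        H.2 (AddSubgroup.eq_top_of_card_eq _ h)
      have h2 := Nat.card_le_card_of_injective _ H.1.subtype_injective
      rw [← Nat.card_eq_fintype_card]
      exact_mod_cast lt_of_le_of_ne h2 h1
    simpa using this
  refine tendsto_of_tendsto_of_tendsto_of_le_of_le lim tendsto_const_nhds ?_ ?_
  · intro n
    have hcount : ∀ H : AddSubgroup G, ∑ f : Fin n → G, (if ∀ i, f i ∈ H then (1 : ℝ) else 0) =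
        (Nat.card H : ℝ) ^ n := by
      intro H
      have : ∀ f : Fin n → G, (if ∀ i, f i ∈ H then (1 : ℝ) else 0) =
          ∏ i, if f i ∈ H then (1 : ℝ) else 0 := by
        intro f
        rw [Finset.prod_ite_zero]
        simp
      simp only [this]
      rw [← Fintype.prod_sum (fun (_ : Fin n) (x : G) => if x ∈ H then (1 : ℝ) else 0)]
      have h2 : ∑ x : G, (if x ∈ H then (1 : ℝ) else 0) = Nat.card H := by
        rw [Finset.sum_boole, Nat.card_eq_fintype_card, Fintype.card_subtype]
      rw [h2]; simp
    have hpt : ∀ f : Fin n → G, 1 - ∑ H : {H : AddSubgroup G // H ≠ ⊤},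
        (if ∀ i, f i ∈ H.1 then (1 : ℝ) else 0) ≤
        if AddSubgroup.closure (Set.range f) = ⊤ then (1 : ℝ) else 0 := by
      intro f
      have nn : ∀ H : {H : AddSubgroup G // H ≠ ⊤},
        0 ≤ (if ∀ i, f i ∈ H.1 then (1 : ℝ) else 0) := fun H => by split_ifs <;> norm_num
      split_ifs with h
      · have := Finset.sum_nonneg fun H (_ : H ∈ Finset.univ) => nn H
        linarith
      · have := Finset.single_le_sum (fun H _ => nn H)
          (Finset.mem_univ (⟨AddSubgroup.closure (Set.range f), h⟩ : {H : AddSubgroup G // H ≠ ⊤}))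
        rw [if_pos (show ∀ i, f i ∈ AddSubgroup.closure (Set.range f) from
          fun i => AddSubgroup.subset_closure (Set.mem_range_self i))] at this
        linarith
    have := Finset.sum_le_sum fun f (_ : f ∈ Finset.univ) => hpt f
    rw [Finset.sum_sub_distrib, Finset.sum_comm] at this
    simp only [hcount] at this
    have h3 := mul_le_mul_of_nonneg_left this (by positivity : 0 ≤ ((Fintype.card G : ℝ) ^ n)⁻¹)
    refine le_trans (le_of_eq ?_) h3
    simp only [div_pow]
    rw [mul_sub, ← Finset.sum_div]
    simp
    field_simp
  · intro n
    simp only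
    rw [inv_mul_le_iff₀ (by positivity), mul_one]
    calc _ ≤ ∑ f : Fin n → G, (1 : ℝ) := Finset.sum_le_sum fun f _ => by split_ifs <;> norm_num
      _ = _ := by simp

end St17

namespace St17

section fin
variable {a : ℕ} {G : Type} [AddCommGroup G] [Fintype G] [Module (ZMod a) G]

/-- Fourier coefficient of a single entry. -/
noncomputable def coef {n : ℕ} (ν : Fin n × Fin n → Measure (ZMod a)) (k : ℕ) (α β : ℕ → ℕ)
    (f : Fin n → G) (χ : Fin n → AddChar G ℂ) (i j : Fin n) : ℂ :=
  ∫ x, χ j ((if ∃ l ∈ Finset.Icc 1 k, (i : ℕ) < α l ∧ (j : ℕ) < β l then 0 else x) • f i)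
    ∂(ν (i, j))

lemma expect_eq [NeZero a] {n : ℕ} (ν : Fin n × Fin n → Measure (ZMod a))
    (hprob : ∀ q, IsProbabilityMeasure (ν q)) (k : ℕ) (α β : ℕ → ℕ) :
    ((∫ g, (nSur g G : ℝ) ∂(stairsLaw ν k α β) : ℝ) : ℂ) =
      ((Fintype.card G : ℂ) ^ n)⁻¹ * ∑ f : Fin n → G,
      ∑ χ : Fin n → AddChar G ℂ, if AddSubgroup.closure (Set.range f) = ⊤ then
        ∏ i, ∏ j, coef ν k α β f χ i j else 0 := by
  rw [← integral_complex_ofReal]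
  simp only [Complex.ofReal_natCast, nSur_char]
  rw [stairsLaw, integral_map (Measurable.of_discrete).aemeasurable
    (Measurable.of_discrete).aestronglyMeasurable, integral_const_mul,
    integral_finsetSum _ fun _ _ => Integrable.of_finite]
  congr 1
  refine Finset.sum_congr rfl fun f _ => ?_
  rw [integral_finsetSum _ fun _ _ => Integrable.of_finite]
  refine Finset.sum_congr rfl fun χ _ => ?_
  split_ifs with h
  · have := integral_fintype_prod_eq_prod (𝕜 := ℂ) (μ := ν) (fun (q : Fin n × Fin n) x =>
      χ q.2 ((if ∃ l ∈ Finset.Icc 1 k, (q.1 : ℕ) < α l ∧ (q.2 : ℕ) < β l then 0 else x) • f q.1))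
    simp only [Fintype.prod_prod_type] at this
    exact this
  · simp

lemma coef_zero {n : ℕ} (ν : Fin n × Fin n → Measure (ZMod a))
    (hprob : ∀ q, IsProbabilityMeasure (ν q)) (k : ℕ) (α β : ℕ → ℕ) (f : Fin n → G)
    (i j : Fin n) : coef ν k α β f 0 i j = 1 := by
  simp [coef]

lemma coef_norm_le [NeZero a] {n : ℕ} (ν : Fin n × Fin n → Measure (ZMod a))
    (hprob : ∀ q, IsProbabilityMeasure (ν q)) (k : ℕ) (α β : ℕ → ℕ) (f : Fin n → G)
    (χ : Fin n → AddChar G ℂ) (i j : Fin n) : ‖coef ν k α β f χ i j‖ ≤ 1 := by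
  unfold coef
  refine (norm_integral_le_integral_norm _).trans ?_
  simp [AddChar.norm_apply]

lemma main_bound [NeZero a] {δ : ℝ} {n : ℕ} (ν : Fin n × Fin n → Measure (ZMod a))
    (hprob : ∀ q, IsProbabilityMeasure (ν q))
    (hδ : ∀ q (g : G) (χ : AddChar G ℂ), χ g ≠ 1 → ‖∫ x, χ (x • g) ∂(ν q)‖ ≤ δ)
    (k : ℕ) (α β : ℕ → ℕ) (η : ℝ)
    (hη : ∀ c : (Fin n → G) → (Fin n → AddChar G ℂ) → Fin n → Fin n → ℝ,
    (∀ f χ i j, 0 ≤ c f χ i j) → (∀ f χ i j, c f χ i j ≤ 1) →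
    (∀ f χ (i j : Fin n), (¬ ∃ l ∈ Finset.Icc 1 k, (i : ℕ) < α l ∧ (j : ℕ) < β l) →
      c f χ i j ≤ w δ (f i) (χ j)) →
    (∑ f : Fin n → G, ∑ χ : Fin n → AddChar G ℂ,
      if AddSubgroup.closure (Set.range f) = ⊤ ∧ χ ≠ 0 then ∏ i, ∏ j, c f χ i j else 0) ≤
    η * (Fintype.card G : ℝ) ^ n) :
    |(∫ g, (nSur g G : ℝ) ∂(stairsLaw ν k α β)) - ((Fintype.card G : ℝ) ^ n)⁻¹ *
      ∑ f : Fin n → G, if AddSubgroup.closure (Set.range f) = ⊤ then (1 : ℝ) else 0| ≤ η := by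
  have hG : 0 < (Fintype.card G : ℝ) := by exact_mod_cast Fintype.card_pos
  have hb := hη (fun f χ i j => ‖coef ν k α β f χ i j‖) (fun _ _ _ _ => norm_nonneg _)
    (fun _ _ _ _ => coef_norm_le ν hprob k α β _ _ _ _) (by
      intro f χ i j h
      unfold w
      split_ifs with h1
      · exact coef_norm_le ν hprob k α β _ _ _ _
      · simp only [coef, if_neg h]
        exact hδ _ _ _ h1)
  rw [← Real.norm_eq_abs, ← Complex.norm_real, Complex.ofReal_sub, expect_eq ν hprob]
  push_cast
  rw [← mul_sub, ← Finset.sum_sub_distrib, norm_mul, norm_inv, norm_pow, Complex.norm_natCast,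
    inv_mul_le_iff₀ (by positivity), mul_comm]
  refine le_trans ?_ hb
  refine (norm_sum_le _ _).trans (Finset.sum_le_sum fun f _ => ?_)
  by_cases hf : AddSubgroup.closure (Set.range f) = ⊤
  · have e : (∑ χ : Fin n → AddChar G ℂ, if AddSubgroup.closure (Set.range f) = ⊤ then
        ∏ i, ∏ j, coef ν k α β f χ i j else 0) -
        (if AddSubgroup.closure (Set.range f) = ⊤ then (1 : ℂ) else 0) =
        ∑ χ : Fin n → AddChar G ℂ,
          if AddSubgroup.closure (Set.range f) = ⊤ ∧ χ ≠ 0 then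
            ∏ i, ∏ j, coef ν k α β f χ i j else 0 := by
      have h1 : (if AddSubgroup.closure (Set.range f) = ⊤ then (1 : ℂ) else 0) =
          ∑ χ : Fin n → AddChar G ℂ, if χ = 0 then (1 : ℂ) else 0 := by
        rw [if_pos hf]; simp
      rw [h1, ← Finset.sum_sub_distrib]
      refine Finset.sum_congr rfl fun χ _ => ?_
      by_cases hχ : χ = 0
      · subst hχ
        rw [if_pos hf, if_pos rfl, if_neg (fun h => h.2 rfl)]
        simp [coef_zero ν hprob]
      · rw [if_pos hf, if_neg hχ, if_pos ⟨hf, hχ⟩, sub_zero]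
    rw [apply_ite Complex.ofReal, Complex.ofReal_one, Complex.ofReal_zero, e]
    refine (norm_sum_le _ _).trans (le_of_eq (Finset.sum_congr rfl fun χ _ => ?_))
    split_ifs
    · simp only [norm_prod]
    · exact norm_zero
  · simp [hf]

end fin

end St17

/-- **Theorem 7.5**: let `M_n` be an `ε`-balanced random `n × n` matrix over `R = ℤ/aℤ`
having `k`-step stairs of `0` with respect to `α_n^{(i)}` and `β_n^{(i)}`.  If
`n - α_n^{(i)} - β_n^{(i)} → ∞` for every `1 ≤ i ≤ k`, then for every finite abelian group
`G` whose exponent divides `a`, `E(#Sur(cok(M_n), G)) → 1`. -/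
theorem statement17 (a : ℕ) (ha : 2 ≤ a) (ε : ℝ) (hε0 : 0 < ε) (hε1 : ε < 1)
    (k : ℕ) (hk : 1 ≤ k) (α β : ℕ → ℕ → ℕ)
    (hα : ∀ n, k ≤ n → (∀ l, 1 ≤ l → l < k → α n (l + 1) < α n l) ∧
      1 ≤ α n k ∧ α n 1 ≤ n)
    (hβ : ∀ n, k ≤ n → (∀ l, 1 ≤ l → l < k → β n l < β n (l + 1)) ∧
      1 ≤ β n 1 ∧ β n k ≤ n)
    (ν : (n : ℕ) → Fin n × Fin n → Measure (ZMod a))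
    (hprob : ∀ n q, IsProbabilityMeasure (ν n q))
    (hbal : ∀ n q, IsEpsBalanced ε (ν n q))
    (hdiv : ∀ l, 1 ≤ l → l ≤ k →
      Tendsto (fun n : ℕ => (n : ℤ) - α n l - β n l) atTop atTop)
    (G : Type) [AddCommGroup G] [Fintype G] (hGexp : AddMonoid.exponent G ∣ a) :
    Tendsto (fun n =>
        ∫ g, (nSur g G : ℝ) ∂(stairsLaw (ν n) k (α n) (β n)))
      atTop (nhds 1) := by
  haveI : NeZero a := ⟨by omega⟩
  letI : Module (ZMod a) G := AddCommGroup.zmodModule (n := a) fun x =>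
    AddMonoid.exponent_dvd_iff_forall_nsmul_eq_zero.1 hGexp x
  obtain ⟨δ, hδ0, hδ1, hδ⟩ := St17.exists_bal a hε0 hε1 G
  obtain ⟨η, hη, hbound⟩ := St17.stairs_error G hδ0 hδ1 k
  have hgen := St17.gen_tendsto G
  have hdiff : Tendsto (fun n => (∫ g, (nSur g G : ℝ) ∂(stairsLaw (ν n) k (α n) (β n))) -
      ((Fintype.card G : ℝ) ^ n)⁻¹ * ∑ f : Fin n → G,
        if AddSubgroup.closure (Set.range f) = ⊤ then (1 : ℝ) else 0) atTop (nhds 0) := by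
    rw [Metric.tendsto_atTop]
    intro r hr
    obtain ⟨D, hD⟩ := (hη.eventually (gt_mem_nhds hr)).exists
    have hev : ∀ᶠ n : ℕ in atTop, ∀ l ∈ Finset.Icc 1 k, α n l + β n l + D ≤ n := by
      rw [Filter.eventually_all_finset]
      intro l hl
      rw [Finset.mem_Icc] at hl
      filter_upwards [(hdiv l hl.1 hl.2).eventually (eventually_ge_atTop (D : ℤ))] with n hn
      omega
    obtain ⟨N, hN⟩ := eventually_atTop.1 (hev.and (eventually_ge_atTop D))
    refine ⟨N, fun n hn => ?_⟩
    obtain ⟨h1, h2⟩ := hN n hn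
    rw [Real.dist_eq, sub_zero]
    exact (St17.main_bound (ν n) (hprob n) (fun q => hδ _ (hprob n q) (hbal n q)) k (α n) (β n)
      (η D) (hbound n D (α n) (β n) h2 h1)).trans_lt hD
  have := hdiff.add hgen
  simpa using this
end
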